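/- arXiv:1211.7259 — 5 statements merged into one kernel-verified Lean document; each statement's English description precedes it below -/
import Mathlib

section
/- Let k, l be integers with 1 ≤ l < k, set p = k/l, and let r be a real number with 0 < r ≤ p. Then there exists a unique probability measure μ(p,r) on ℝ such that ∫ x^m dμ(p,r)(x) = A_m(p,r) for every natural number m. Moreover, μ(p,r) is absolutely continuous with respect to Lebesgue measure and its support equals the interval [0, c(p)]. -/
open MeasureTheory Real

/-- The Raney numbers (two-parameter Fuss–Catalan numbers):
`A 0 (p,r) = 1` and `A m (p,r) = (r/m!)·∏_{i=1}^{m−1} (m·p + r − i)` for `m ≥ 1`. -/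
noncomputable def raney (p r : ℝ) : ℕ → ℝ
  | 0 => 1
  | (m + 1) => (r / (Nat.factorial (m + 1) : ℝ)) *
      ∏ i ∈ Finset.Icc 1 m, (((m : ℝ) + 1) * p + r - (i : ℝ))

/-- `c(p) = p^p·(p−1)^(1−p)`. -/
noncomputable def cRaney (p : ℝ) : ℝ := p ^ p * (p - 1) ^ (1 - p)

namespace Raney

open Filter Topology Set

section Moments

variable {μ ν : Measure ℝ} {c : ℝ}

lemma integrable_pow_of_ae_abs_le [IsFiniteMeasure μ] (h : ∀ᵐ x ∂μ, |x| ≤ c) (m : ℕ) :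
    Integrable (fun x : ℝ => x ^ m) μ := by
  refine Integrable.of_bound (by fun_prop) (c ^ m) ?_
  filter_upwards [h] with x hx
  rw [norm_pow, Real.norm_eq_abs]
  gcongr

lemma measure_eq_zero_of_integral_pow_le [IsFiniteMeasure ν] (hc : 0 ≤ c)
    (hint : ∀ m : ℕ, Integrable (fun x : ℝ => x ^ m) ν)
    (h : ∀ m : ℕ, ∫ x, x ^ (2 * m) ∂ν ≤ c ^ (2 * m)) {d : ℝ} (hd : c < d) :
    ν {x | d ≤ |x|} = 0 := by
  have hd0 : 0 < d := hc.trans_lt hd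
  have key (m : ℕ) : ν.real {x | d ≤ |x|} ≤ ((c / d) ^ 2) ^ m := by
    have h1 := mul_meas_ge_le_integral_of_nonneg (μ := ν)
      (ae_of_all _ fun x => by rw [pow_mul]; positivity) (hint (2 * m)) (d ^ (2 * m))
    have h2 : ν.real {x | d ≤ |x|} ≤ ν.real {x | d ^ (2 * m) ≤ x ^ (2 * m)} := by
      refine measureReal_mono fun x (hx : d ≤ |x|) => ?_
      change d ^ (2 * m) ≤ x ^ (2 * m)
      rw [pow_mul x, ← sq_abs, ← pow_mul]
      gcongr
    rw [← pow_mul, div_pow, le_div_iff₀ (by positivity)]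
    calc ν.real {x | d ≤ |x|} * d ^ (2 * m)
        ≤ d ^ (2 * m) * ν.real {x | d ^ (2 * m) ≤ x ^ (2 * m)} := by
          rw [mul_comm]; gcongr
      _ ≤ c ^ (2 * m) := h1.trans (h m)
  have hlt : (c / d) ^ 2 < 1 :=
    pow_lt_one₀ (by positivity) ((div_lt_one hd0).2 hd) two_ne_zero
  have h0 := ge_of_tendsto' (tendsto_pow_atTop_nhds_zero_of_lt_one (by positivity) hlt) key
  exact (measureReal_eq_zero_iff).1 (le_antisymm h0 measureReal_nonneg)

lemma ae_abs_le_of_integral_pow_le [IsFiniteMeasure ν] (hc : 0 ≤ c)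
    (hint : ∀ m : ℕ, Integrable (fun x : ℝ => x ^ m) ν)
    (h : ∀ m : ℕ, ∫ x, x ^ (2 * m) ∂ν ≤ c ^ (2 * m)) : ∀ᵐ x ∂ν, |x| ≤ c := by
  have h1 : ∀ᵐ x ∂ν, ∀ n : ℕ, |x| < c + 1 / ((n : ℝ) + 1) := by
    refine ae_all_iff.2 fun n => ?_
    simpa [ae_iff] using measure_eq_zero_of_integral_pow_le hc hint h
      (lt_add_of_pos_right c (Nat.one_div_pos_of_nat (n := n) (α := ℝ)))
  filter_upwards [h1] with x hx
  refine le_of_forall_pos_le_add fun ε hε => ?_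
  obtain ⟨n, hn⟩ := exists_nat_one_div_lt hε
  linarith [hx n]

lemma integral_eval_eq_of_integral_pow_eq
    (hμ : ∀ m : ℕ, Integrable (fun x : ℝ => x ^ m) μ)
    (hν : ∀ m : ℕ, Integrable (fun x : ℝ => x ^ m) ν)
    (h : ∀ m : ℕ, ∫ x, x ^ m ∂ν = ∫ x, x ^ m ∂μ) (P : Polynomial ℝ) :
    ∫ x, P.eval x ∂ν = ∫ x, P.eval x ∂μ := by
  simp only [Polynomial.eval_eq_sum_range]
  rw [integral_finsetSum _ fun i _ => (hν i).const_mul _,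
    integral_finsetSum _ fun i _ => (hμ i).const_mul _]
  simp only [integral_const_mul, h]

lemma integrable_eval (hμ : ∀ m : ℕ, Integrable (fun x : ℝ => x ^ m) μ) (P : Polynomial ℝ) :
    Integrable (fun x => P.eval x) μ := by
  simp only [Polynomial.eval_eq_sum_range]
  exact integrable_finsetSum _ fun i _ => (hμ i).const_mul _

/-- Two probability measures on `[-c, c]` with the same moments are equal. -/
lemma eq_of_integral_pow_eq [IsProbabilityMeasure μ] [IsProbabilityMeasure ν]
    (hμ : ∀ᵐ x ∂μ, |x| ≤ c) (hν : ∀ᵐ x ∂ν, |x| ≤ c)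
    (h : ∀ m : ℕ, ∫ x, x ^ m ∂ν = ∫ x, x ^ m ∂μ) : ν = μ := by
  refine ext_of_forall_integral_eq_of_IsFiniteMeasure fun f => ?_
  have near {ρ : Measure ℝ} [IsProbabilityMeasure ρ] (hρ : ∀ᵐ x ∂ρ, |x| ≤ c) {ε : ℝ}
      {P : Polynomial ℝ} (hP : ∀ x ∈ Icc (-c) c, |P.eval x - f x| < ε) :
      |∫ x, P.eval x ∂ρ - ∫ x, f x ∂ρ| ≤ ε := by
    rw [← integral_sub (integrable_eval (integrable_pow_of_ae_abs_le hρ) P) (f.integrable ρ)]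
    have := norm_integral_le_of_norm_le_const (μ := ρ) (f := fun x => P.eval x - f x) (C := ε) (by
      filter_upwards [hρ] with x hx
      exact (hP x (abs_le.1 hx)).le)
    simpa using this
  refine eq_of_forall_dist_le fun ε hε => ?_
  obtain ⟨P, hP⟩ := exists_polynomial_near_of_continuousOn (-c) c f f.continuous.continuousOn
    (ε / 2) (half_pos hε)
  have h1 := near hμ hP
  have h2 := near hν hP
  rw [integral_eval_eq_of_integral_pow_eq (integrable_pow_of_ae_abs_le hμ)
    (integrable_pow_of_ae_abs_le hν) h] at h2
  rw [Real.dist_eq]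
  rw [abs_le] at *
  constructor <;> linarith [h1.1, h1.2, h2.1, h2.2]

/-- A probability measure on `[-c, c]` all of whose moments are nonzero is determined by its
moments among all probability measures on the line. -/
lemma eq_of_integral_pow_eq_of_ne_zero [IsProbabilityMeasure μ] [IsProbabilityMeasure ν]
    (hc : 0 ≤ c) (hμ : ∀ᵐ x ∂μ, |x| ≤ c) (hne : ∀ m : ℕ, ∫ x, x ^ m ∂μ ≠ 0)
    (h : ∀ m : ℕ, ∫ x, x ^ m ∂ν = ∫ x, x ^ m ∂μ) : ν = μ := by
  refine eq_of_integral_pow_eq hμ (ae_abs_le_of_integral_pow_le hc (fun m => ?_) fun m => ?_) h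
  · exact not_imp_comm.1 integral_undef (by rw [h]; exact hne m)
  · rw [h]
    have := norm_integral_le_of_norm_le_const (μ := μ) (f := fun x => x ^ (2 * m))
      (C := c ^ (2 * m)) (by
        filter_upwards [hμ] with x hx
        rw [norm_pow, Real.norm_eq_abs]
        gcongr)
    simpa using (le_abs_self _).trans this

end Moments

lemma integrableOn_Ioo_deriv_of_nonneg {a b fa fb : ℝ} {g g' : ℝ → ℝ}
    (hg : ∀ x ∈ Ioo a b, HasDerivAt g (g' x) x) (hnonneg : ∀ x ∈ Ioo a b, 0 ≤ g' x)
    (ha : Tendsto g (𝓝[>] a) (𝓝 fa)) (hb : Tendsto g (𝓝[<] b) (𝓝 fb)) :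
    IntegrableOn g' (Ioo a b) := by
  have hcont : ContinuousOn g (Ioo a b) := fun x hx => (hg x hx).continuousAt.continuousWithinAt
  refine (intervalIntegral.integrableOn_deriv_of_nonneg
    (continuousOn_Icc_extendFrom_Ioo hcont ha hb) (fun x hx => ?_) hnonneg).mono_set
    Ioo_subset_Ioc_self
  refine (hg x hx).congr_of_eventuallyEq ?_
  filter_upwards [Ioo_mem_nhds hx.1 hx.2] with y hy using extendFrom_extends hcont y hy

lemma integral_Ioo_deriv_of_nonneg {a b fa fb : ℝ} {g g' : ℝ → ℝ} (hab : a < b)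
    (hg : ∀ x ∈ Ioo a b, HasDerivAt g (g' x) x) (hnonneg : ∀ x ∈ Ioo a b, 0 ≤ g' x)
    (ha : Tendsto g (𝓝[>] a) (𝓝 fa)) (hb : Tendsto g (𝓝[<] b) (𝓝 fb)) :
    ∫ x in Ioo a b, g' x = fb - fa := by
  rw [← integral_Ioc_eq_integral_Ioo, ← intervalIntegral.integral_of_le hab.le]
  refine intervalIntegral.integral_eq_sub_of_hasDerivAt_of_tendsto hab hg ?_ ha hb
  rw [intervalIntegrable_iff_integrableOn_Ioo_of_le hab.le]
  exact integrableOn_Ioo_deriv_of_nonneg hg hnonneg ha hb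

/-- The quotient `exp z * (exp (s z) - 1) / (exp z - 1)`, with the singularity at `0` removed. -/
noncomputable def expQuot (s : ℝ) (z : ℂ) : ℂ :=
  Complex.exp z * dslope (fun w : ℂ => Complex.exp (s * w)) 0 z / dslope Complex.exp 0 z

/-- The open horizontal strip `|Im z| < π`. -/
def strip : Set ℂ := {z | z.im ∈ Ioo (-π) π}

lemma exp_sub_one_ne_zero {z : ℂ} (hz : z ∈ strip) (h0 : z ≠ 0) : Complex.exp z - 1 ≠ 0 := by
  intro h
  have h1 := Complex.log_exp hz.1 hz.2.le
  rw [sub_eq_zero.1 h, Complex.log_one] at h1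
  exact h0 h1.symm

lemma expQuot_of_ne {s : ℝ} {z : ℂ} (h0 : z ≠ 0) :
    expQuot s z = Complex.exp z * (Complex.exp (s * z) - 1) / (Complex.exp z - 1) := by
  simp only [expQuot, dslope_of_ne _ h0, slope_def_field, sub_zero, mul_zero, Complex.exp_zero]
  rw [← mul_div_assoc, div_div_div_cancel_right₀ h0]

lemma isOpen_strip : IsOpen strip := isOpen_Ioo.preimage Complex.continuous_im

lemma convex_strip : Convex ℝ strip :=
  (convex_Ioo (-π) π).is_linear_preimage Complex.imLm.isLinear

lemma differentiableOn_expQuot (s : ℝ) : DifferentiableOn ℂ (expQuot s) strip := by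
  have hd (f : ℂ → ℂ) (hf : Differentiable ℂ f) : Differentiable ℂ (dslope f 0) := by
    rw [← differentiableOn_univ] at hf ⊢
    exact (Complex.differentiableOn_dslope univ_mem).2 hf
  have h1 := hd (fun w : ℂ => Complex.exp (s * w)) (by fun_prop)
  have h2 := hd _ Complex.differentiable_exp
  intro z hz
  refine ((Complex.differentiable_exp z).mul (h1 z)).div (h2 z) ?_ |>.differentiableWithinAt
  rcases eq_or_ne z 0 with rfl | h0
  · simp [dslope_same]
  · rw [dslope_of_ne _ h0, slope_def_field]
    simpa using ⟨exp_sub_one_ne_zero hz h0, h0⟩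

lemma ofReal_mem_strip (x : ℝ) : (x : ℂ) ∈ strip := by
  simp [strip, Real.pi_pos]

lemma im_expQuot_ofReal (s x : ℝ) : (expQuot s x).im = 0 := by
  rcases eq_or_ne x 0 with rfl | h0
  · have h : HasDerivAt (fun w : ℂ => Complex.exp (s * w)) s 0 := by
      simpa using ((hasDerivAt_id (0 : ℂ)).const_mul (s : ℂ)).cexp
    simp [expQuot, dslope_same, h.deriv]
  · rw [expQuot_of_ne (by exact_mod_cast h0)]
    norm_cast

lemma norm_expQuot_le {s : ℝ} (hs : 0 < s) {z : ℂ} (hz : z.re ≤ -1) :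
    ‖expQuot s z‖ ≤ 4 * Real.exp z.re := by
  have h0 : z ≠ 0 := by rintro rfl; norm_num at hz
  have h1 : ‖Complex.exp (s * z) - 1‖ ≤ 2 := by
    refine (norm_sub_le _ _).trans ?_
    have : ‖Complex.exp (s * z)‖ ≤ 1 := by
      rw [Complex.norm_exp, Real.exp_le_one_iff]
      simp
      nlinarith
    simp only [norm_one]
    linarith
  have h2 : 1 / 2 ≤ ‖Complex.exp z - 1‖ := by
    have h3 : ‖Complex.exp z‖ ≤ 1 / 2 := by
      rw [Complex.norm_exp]
      have h4 := Real.add_one_le_exp (-z.re)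
      rw [show z.re = -(-z.re) by ring, Real.exp_neg]
      rw [inv_le_comm₀ (Real.exp_pos _) (by norm_num)]
      norm_num
      linarith
    have := norm_sub_norm_le (1 : ℂ) (Complex.exp z)
    rw [norm_sub_rev, norm_one] at this
    linarith
  rw [expQuot_of_ne h0, norm_div, norm_mul, Complex.norm_exp, div_le_iff₀ (by linarith)]
  have := Real.exp_pos z.re
  nlinarith

/-- A primitive on the strip which is real on the real line and whose imaginary part is small
far to the left. -/
lemma exists_primitive_expQuot {s : ℝ} (hs : 0 < s) : ∃ K : ℂ → ℂ,
    (∀ z ∈ strip, HasDerivAt K (expQuot s z) z) ∧ (∀ x : ℝ, (K x).im = 0) ∧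
    ∀ z ∈ strip, z.re ≤ -1 → |(K z).im| ≤ 4 * π * Real.exp z.re := by
  obtain ⟨K₀, hK₀⟩ := convex_strip.exists_forall_hasDerivWithinAt (differentiableOn_expQuot s)
  have hK₁ : ∀ z ∈ strip, HasDerivAt (fun w => K₀ w - K₀ 0) (expQuot s z) z := fun z hz =>
    ((hK₀ z hz).hasDerivAt (isOpen_strip.mem_nhds hz)).sub_const _
  generalize hK : (fun w => K₀ w - K₀ 0) = K at hK₁
  have hK0 : K 0 = 0 := by simp [← hK]
  have hreal : ∀ x : ℝ, (K x).im = 0 := by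
    have hd : ∀ x : ℝ, HasDerivAt (fun x : ℝ => (K x).im) 0 x := fun x => by
      have h := (hK₁ x (ofReal_mem_strip x)).comp_ofReal
      have h' := Complex.imCLM.hasFDerivAt.comp_hasDerivAt x h
      simpa [im_expQuot_ofReal, Function.comp_def] using h'
    intro x
    have := is_const_of_deriv_eq_zero (fun x => (hd x).differentiableAt)
      (fun x => (hd x).deriv) x 0
    simpa [hK0] using this
  refine ⟨K, hK₁, hreal, fun z hz hre => ?_⟩
  have hconv : Convex ℝ {w : ℂ | w.re = z.re ∧ w ∈ strip} :=
    ((convex_singleton z.re).is_linear_preimage Complex.reLm.isLinear).inter convex_strip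
  have hmv := hconv.norm_image_sub_le_of_norm_hasDerivWithin_le (f := K) (f' := expQuot s)
    (C := 4 * Real.exp z.re) (x := (z.re : ℂ)) (y := z)
    (fun w hw => (hK₁ w hw.2).hasDerivWithinAt)
    (fun w hw => by rw [← hw.1]; exact norm_expQuot_le hs (hw.1 ▸ hre))
    ⟨by simp, ofReal_mem_strip _⟩ ⟨rfl, hz⟩
  have hzim : z - z.re = z.im * Complex.I := by
    apply Complex.ext <;> simp
  rw [hzim, norm_mul, Complex.norm_I, mul_one, Complex.norm_real, Real.norm_eq_abs] at hmv
  have h1 : |(K z).im| ≤ ‖K z - K z.re‖ := by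
    have := Complex.abs_im_le_norm (K z - K z.re)
    rwa [Complex.sub_im, hreal, sub_zero] at this
  have h2 : |z.im| ≤ π := abs_le.2 ⟨hz.1.le, hz.2.le⟩
  have := Real.exp_pos z.re
  nlinarith

section Curve

variable {p φ : ℝ}

/-- The logarithm of the boundary curve `sin (p φ) / sin ((p - 1) φ) * exp (i φ)`. -/
noncomputable def logCurve (p φ : ℝ) : ℂ :=
  ((Real.log (sin (p * φ)) - Real.log (sin ((p - 1) * φ)) : ℝ) : ℂ) + (φ : ℝ) * Complex.I

/-- The derivative of `logCurve p`. -/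
noncomputable def logCurveDeriv (p φ : ℝ) : ℂ :=
  ((p * cot (p * φ) - (p - 1) * cot ((p - 1) * φ) : ℝ) : ℂ) + Complex.I

/-- The logarithm of the boundary curve shifted by `-1`, which is
`sin φ / sin ((p - 1) φ) * exp (i p φ)`. -/
noncomputable def logShift (p φ : ℝ) : ℂ :=
  ((Real.log (sin φ) - Real.log (sin ((p - 1) * φ)) : ℝ) : ℂ) + (p * φ : ℝ) * Complex.I

/-- The derivative of `logShift p`. -/
noncomputable def logShiftDeriv (p φ : ℝ) : ℂ :=
  ((cot φ - (p - 1) * cot ((p - 1) * φ) : ℝ) : ℂ) + p * Complex.I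

lemma mul_mem_of_mem (hp : 1 < p) (hφ : φ ∈ Ioo 0 (π / p)) :
    p * φ ∈ Ioo 0 π := by
  have h0 : 0 < p := by linarith
  have h1 := (lt_div_iff₀' h0).1 hφ.2
  exact ⟨mul_pos h0 hφ.1, h1⟩

lemma sin_mul_pos (hp : 1 < p) (hφ : φ ∈ Ioo 0 (π / p)) : 0 < sin (p * φ) :=
  sin_pos_of_mem_Ioo (mul_mem_of_mem hp hφ)

lemma sin_sub_one_mul_pos (hp : 1 < p) (hφ : φ ∈ Ioo 0 (π / p)) : 0 < sin ((p - 1) * φ) := by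
  have h := mul_mem_of_mem hp hφ
  exact sin_pos_of_mem_Ioo ⟨mul_pos (by linarith) hφ.1, by linarith [h.2, hφ.1]⟩

lemma sin_pos_of_mem (hp : 1 < p) (hφ : φ ∈ Ioo 0 (π / p)) : 0 < sin φ := by
  have h := mul_mem_of_mem hp hφ
  exact sin_pos_of_mem_Ioo ⟨hφ.1, by nlinarith [h.2, hφ.1]⟩

lemma hasDerivAt_log_sin_mul (a : ℝ) (h : 0 < sin (a * φ)) :
    HasDerivAt (fun φ => Real.log (sin (a * φ))) (a * cot (a * φ)) φ := by
  have := ((((hasDerivAt_id φ).const_mul a).sin).log h.ne')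
  refine this.congr_deriv ?_
  rw [cot_eq_cos_div_sin]
  simp only [id, mul_one]
  ring

lemma hasDerivAt_log_sin (h : 0 < sin φ) :
    HasDerivAt (fun φ => Real.log (sin φ)) (cot φ) φ := by
  simpa using hasDerivAt_log_sin_mul (φ := φ) 1 (by simpa using h)

lemma hasDerivAt_logCurve (hp : 1 < p) (hφ : φ ∈ Ioo 0 (π / p)) :
    HasDerivAt (logCurve p) (logCurveDeriv p φ) φ := by
  have h1 := ((hasDerivAt_log_sin_mul p (sin_mul_pos hp hφ)).sub
    (hasDerivAt_log_sin_mul (p - 1) (sin_sub_one_mul_pos hp hφ))).ofReal_comp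
  have h2 := (hasDerivAt_id φ).ofReal_comp.mul_const Complex.I
  exact (h1.add h2).congr_deriv (by simp [logCurveDeriv])

lemma hasDerivAt_logShift (hp : 1 < p) (hφ : φ ∈ Ioo 0 (π / p)) :
    HasDerivAt (logShift p) (logShiftDeriv p φ) φ := by
  have h1 := ((hasDerivAt_log_sin (sin_pos_of_mem hp hφ)).sub
    (hasDerivAt_log_sin_mul (p - 1) (sin_sub_one_mul_pos hp hφ))).ofReal_comp
  have h2 := ((hasDerivAt_id φ).const_mul p).ofReal_comp.mul_const Complex.I
  exact (h1.add h2).congr_deriv (by simp [logShiftDeriv])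

lemma exp_logCurve_sub_one (hp : 1 < p) (hφ : φ ∈ Ioo 0 (π / p)) :
    Complex.exp (logCurve p φ) - 1 = Complex.exp (logShift p φ) := by
  have h1 := sin_mul_pos hp hφ
  have h2 := sin_sub_one_mul_pos hp hφ
  have h3 := sin_pos_of_mem hp hφ
  have h4 : sin ((p - 1) * φ) = sin (p * φ) * cos φ - cos (p * φ) * sin φ := by
    rw [← sin_sub]; ring_nf
  have e (a b : ℝ) (ha : 0 < a) (hb : 0 < b) :
      Complex.exp ((Real.log a - Real.log b : ℝ) : ℂ) = a / b := by
    rw [← Complex.ofReal_exp, Real.exp_sub, Real.exp_log ha, Real.exp_log hb, Complex.ofReal_div]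
  rw [logCurve, logShift, Complex.exp_add, Complex.exp_add, e _ _ h1 h2, e _ _ h3 h2,
    Complex.exp_mul_I, Complex.exp_mul_I]
  have h5 : (sin ((p - 1) * φ) : ℂ) ≠ 0 := by exact_mod_cast h2.ne'
  rw [← mul_div_right_comm, ← mul_div_right_comm, div_sub_one h5, h4]
  congr 1
  push_cast
  ring

lemma logCurveDeriv_mul_exp (hp : 1 < p) (hφ : φ ∈ Ioo 0 (π / p)) :
    logCurveDeriv p φ * Complex.exp (logCurve p φ) =
      logShiftDeriv p φ * Complex.exp (logShift p φ) := by
  have h1 := (hasDerivAt_logCurve hp hφ).cexp.sub_const 1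
  have h2 := (hasDerivAt_logShift hp hφ).cexp
  rw [mul_comm, mul_comm (logShiftDeriv p φ)]
  refine h1.unique (h2.congr_of_eventuallyEq ?_)
  filter_upwards [isOpen_Ioo.mem_nhds hφ] with ψ hψ
  exact exp_logCurve_sub_one hp hψ

lemma logCurve_im : (logCurve p φ).im = φ := by simp [logCurve]

lemma logCurve_re :
    (logCurve p φ).re = Real.log (sin (p * φ)) - Real.log (sin ((p - 1) * φ)) := by simp [logCurve]

lemma logShift_im : (logShift p φ).im = p * φ := by simp [logShift]

lemma logCurve_mem_strip (hp : 1 < p) (hφ : φ ∈ Ioo 0 (π / p)) : logCurve p φ ∈ strip := by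
  have h := mul_mem_of_mem hp hφ
  simp only [strip, mem_ofPred_eq, logCurve_im]
  exact ⟨by linarith [hφ.1, pi_pos], by nlinarith [h.2, hφ.1]⟩

lemma logCurve_ne_zero (hφ : φ ∈ Ioo 0 (π / p)) : logCurve p φ ≠ 0 := by
  intro h
  have := logCurve_im (p := p) (φ := φ)
  rw [h] at this
  exact hφ.1.ne this

lemma tendsto_log_sin_sub_log_sin {a b : ℝ} (ha : 0 < a) (hb : 0 < b) :
    Tendsto (fun φ => Real.log (sin (a * φ)) - Real.log (sin (b * φ))) (𝓝[>] 0)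
      (𝓝 (Real.log a - Real.log b)) := by
  have h (c : ℝ) (hc : 0 < c) :
      Tendsto (fun φ => Real.log (sin (c * φ) / φ)) (𝓝[>] 0) (𝓝 (Real.log c)) := by
    have hd : HasDerivAt (fun φ => sin (c * φ)) c 0 := by
      simpa using ((hasDerivAt_id (0 : ℝ)).const_mul c).sin
    have ht := hd.tendsto_slope.mono_left (nhdsWithin_mono 0 (fun x (hx : 0 < x) => hx.ne'))
    refine (Tendsto.congr (fun x => ?_) ht).log hc.ne'
    simp [slope_def_field]
  have hpos (c : ℝ) (hc : 0 < c) : ∀ᶠ φ in 𝓝[>] (0 : ℝ), 0 < sin (c * φ) := by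
    filter_upwards [Ioo_mem_nhdsGT (div_pos pi_pos hc)] with φ hφ
    exact sin_pos_of_mem_Ioo ⟨mul_pos hc hφ.1, (lt_div_iff₀' hc).1 hφ.2⟩
  refine Tendsto.congr' ?_ ((h a ha).sub (h b hb))
  filter_upwards [hpos a ha, hpos b hb, self_mem_nhdsWithin] with φ h1 h2 (h3 : 0 < φ)
  rw [Real.log_div h1.ne' h3.ne', Real.log_div h2.ne' h3.ne']
  ring

lemma tendsto_logCurve_zero (hp : 1 < p) :
    Tendsto (logCurve p) (𝓝[>] 0) (𝓝 ((Real.log p - Real.log (p - 1) : ℝ) : ℂ)) := by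
  have h1 := (Complex.continuous_ofReal.tendsto _).comp
    (tendsto_log_sin_sub_log_sin (a := p) (b := p - 1) (by linarith) (by linarith))
  have h2 : Tendsto (fun φ : ℝ => (φ : ℂ) * Complex.I) (𝓝[>] 0) (𝓝 (((0 : ℝ) : ℂ) * Complex.I)) :=
    (Continuous.tendsto (by fun_prop) 0).mono_left nhdsWithin_le_nhds
  convert! h1.add h2 using 2
  simp

lemma tendsto_logShift_zero (hp : 1 < p) :
    Tendsto (logShift p) (𝓝[>] 0) (𝓝 ((- Real.log (p - 1) : ℝ) : ℂ)) := by
  have h1 := (Complex.continuous_ofReal.tendsto _).comp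
    (tendsto_log_sin_sub_log_sin (a := 1) (b := p - 1) (by linarith) (by linarith))
  have h2 : Tendsto (fun φ : ℝ => ((p * φ : ℝ) : ℂ) * Complex.I) (𝓝[>] 0)
      (𝓝 (((p * 0 : ℝ) : ℂ) * Complex.I)) :=
    (Continuous.tendsto (by fun_prop) 0).mono_left nhdsWithin_le_nhds
  simp only [one_mul] at h1
  convert! h1.add h2 using 2
  simp

lemma sin_pi_div_pos (hp : 1 < p) : 0 < sin (π / p) :=
  sin_pos_of_mem_Ioo ⟨div_pos pi_pos (by linarith), div_lt_self pi_pos hp⟩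

lemma sin_sub_one_mul_pi_div_pos (hp : 1 < p) : 0 < sin ((p - 1) * (π / p)) := by
  have h0 : p ≠ 0 := by linarith
  rw [show (p - 1) * (π / p) = π - π / p by field_simp, sin_pi_sub]
  exact sin_pi_div_pos hp

lemma tendsto_logCurve_re_atBot (hp : 1 < p) :
    Tendsto (fun φ => (logCurve p φ).re) (𝓝[<] (π / p)) atBot := by
  have h0 : p ≠ 0 := by linarith
  simp only [logCurve_re, sub_eq_add_neg]
  refine Tendsto.atBot_add (C := -Real.log (sin ((p - 1) * (π / p)))) ?_ ?_
  · refine Real.tendsto_log_nhdsGT_zero.comp (tendsto_nhdsWithin_iff.2 ⟨?_, ?_⟩)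
    · have : Tendsto (fun φ => sin (p * φ)) (𝓝 (π / p)) (𝓝 (sin (p * (π / p)))) :=
        Continuous.tendsto (by fun_prop) _
      rw [mul_div_cancel₀ _ h0, sin_pi] at this
      exact this.mono_left nhdsWithin_le_nhds
    · filter_upwards [Ioo_mem_nhdsLT (div_pos pi_pos (by linarith : 0 < p))] with φ hφ
      exact sin_mul_pos hp hφ
  · have : ContinuousAt (fun φ => -Real.log (sin ((p - 1) * φ))) (π / p) :=
      (ContinuousAt.log (f := fun φ => sin ((p - 1) * φ)) (by fun_prop)
        (sin_sub_one_mul_pi_div_pos hp).ne').neg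
    exact this.tendsto.mono_left nhdsWithin_le_nhds

lemma tendsto_logShift_pi_div (hp : 1 < p) :
    Tendsto (logShift p) (𝓝[<] (π / p)) (𝓝 (π * Complex.I)) := by
  have h0 : p ≠ 0 := by linarith
  have h1 : ContinuousAt (logShift p) (π / p) := by
    unfold logShift
    refine ContinuousAt.add (Complex.continuous_ofReal.continuousAt.comp ?_) (by fun_prop)
    exact (ContinuousAt.log (by fun_prop) (sin_pi_div_pos hp).ne').sub
      (ContinuousAt.log (by fun_prop) (sin_sub_one_mul_pi_div_pos hp).ne')
  have h2 : logShift p (π / p) = π * Complex.I := by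
    rw [logShift, show (p - 1) * (π / p) = π - π / p by field_simp, sin_pi_sub,
      mul_div_cancel₀ _ h0]
    simp
  rw [← h2]
  exact h1.tendsto.mono_left nhdsWithin_le_nhds

/-- The product of powers `w ^ s * (w - 1) ^ (-m)` along the boundary curve. -/
noncomputable def curvePow (p s : ℝ) (m : ℕ) (φ : ℝ) : ℂ :=
  Complex.exp (s * logCurve p φ - m * logShift p φ)

lemma tendsto_im_curvePow_zero (hp : 1 < p) (s : ℝ) (m : ℕ) :
    Tendsto (fun φ => (curvePow p s m φ).im) (𝓝[>] 0) (𝓝 0) := by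
  have h := (((tendsto_logCurve_zero hp).const_mul (s : ℂ)).sub
    ((tendsto_logShift_zero hp).const_mul (m : ℂ))).cexp
  have h' := (Complex.continuous_im.tendsto _).comp h
  convert! h' using 2
  rw [← Complex.ofReal_mul, ← Complex.ofReal_natCast, ← Complex.ofReal_mul, ← Complex.ofReal_sub,
    ← Complex.ofReal_exp, Complex.ofReal_im]

lemma tendsto_curvePow_pi_div (hp : 1 < p) {s : ℝ} (hs : 0 < s) (m : ℕ) :
    Tendsto (curvePow p s m) (𝓝[<] (π / p)) (𝓝 0) := by
  rw [tendsto_zero_iff_norm_tendsto_zero]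
  simp only [curvePow, Complex.norm_exp]
  refine Real.tendsto_exp_atBot.comp ?_
  have h1 := (tendsto_logCurve_re_atBot hp).const_mul_atBot hs
  have h2 := ((Complex.continuous_re.tendsto _).comp
    (tendsto_logShift_pi_div hp)).const_mul (-(m : ℝ))
  convert! h1.atBot_add h2 using 2 with φ
  simp [sub_eq_add_neg]

lemma hasDerivAt_curvePow (hp : 1 < p) (s : ℝ) (m : ℕ) (hφ : φ ∈ Ioo 0 (π / p)) :
    HasDerivAt (curvePow p s m)
      (curvePow p s m φ * (s * logCurveDeriv p φ - m * logShiftDeriv p φ)) φ :=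
  (((hasDerivAt_logCurve hp hφ).const_mul (s : ℂ)).sub
    ((hasDerivAt_logShift hp hφ).const_mul (m : ℂ))).cexp

lemma curvePow_succ_mul_logCurveDeriv (hp : 1 < p) (s : ℝ) (m : ℕ) (hφ : φ ∈ Ioo 0 (π / p)) :
    curvePow p s (m + 1) φ * logCurveDeriv p φ =
      curvePow p (s - 1) m φ * logShiftDeriv p φ := by
  have h := logCurveDeriv_mul_exp hp hφ
  have e : curvePow p s (m + 1) φ = curvePow p (s - 1) m φ *
      (Complex.exp (logCurve p φ) / Complex.exp (logShift p φ)) := by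
    rw [curvePow, curvePow, ← Complex.exp_sub, ← Complex.exp_add]
    push_cast
    ring_nf
  rw [e, mul_assoc, div_mul_eq_mul_div, mul_comm (Complex.exp _), h,
    mul_div_cancel_right₀ _ (Complex.exp_ne_zero _)]

lemma hasDerivAt_im {f : ℝ → ℂ} {f' : ℂ} {x : ℝ} (h : HasDerivAt f f' x) :
    HasDerivAt (fun x => (f x).im) f'.im x := by
  simpa [Function.comp_def] using Complex.imCLM.hasFDerivAt.comp_hasDerivAt x h

/-- A primitive of the imaginary part of `w ^ s * (w - 1) ^ (-m - 1) dw` along the curve. -/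
lemma exists_primitive_curvePow (hp : 1 < p) (m : ℕ) {s : ℝ} (hs : m < s) : ∃ G : ℝ → ℝ,
    (∀ φ ∈ Ioo 0 (π / p), HasDerivAt G (curvePow p s m φ * logShiftDeriv p φ).im φ) ∧
    Tendsto G (𝓝[>] 0) (𝓝 0) ∧
    Tendsto G (𝓝[<] (π / p)) (𝓝 (π * (∏ i ∈ Finset.range m, (s - i)) / m.factorial)) := by
  induction m generalizing s with
  | zero =>
    rw [Nat.cast_zero] at hs
    obtain ⟨K, hK, hK0, hKπ⟩ := exists_primitive_expQuot hs
    have hin : ∀ᶠ φ in 𝓝[<] (π / p), φ ∈ Ioo 0 (π / p) :=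
      Ioo_mem_nhdsLT (div_pos pi_pos (by linarith))
    refine ⟨fun φ => (logShift p φ + K (logCurve p φ)).im, fun φ hφ => hasDerivAt_im ?_, ?_, ?_⟩
    · have h := (hasDerivAt_logShift hp hφ).add
        (HasDerivAt.comp φ (hK _ (logCurve_mem_strip hp hφ)) (hasDerivAt_logCurve hp hφ))
      refine h.congr_deriv ?_
      rw [expQuot_of_ne (logCurve_ne_zero hφ), exp_logCurve_sub_one hp hφ]
      have h2 := logCurveDeriv_mul_exp hp hφ
      have h3 := Complex.exp_ne_zero (logShift p φ)
      simp only [curvePow, Nat.cast_zero, zero_mul, sub_zero]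
      field_simp
      linear_combination (Complex.exp (s * logCurve p φ) - 1) * h2
    · have h := (tendsto_logShift_zero hp).add
        (((hK _ (ofReal_mem_strip _)).continuousAt.tendsto).comp (tendsto_logCurve_zero hp))
      have h' := (Complex.continuous_im.tendsto _).comp h
      simpa [hK0, Function.comp_def, - Complex.ofReal_sub, - Complex.ofReal_neg] using h'
    · have h1 := (Complex.continuous_im.tendsto _).comp (tendsto_logShift_pi_div hp)
      have h2 : Tendsto (fun φ => (K (logCurve p φ)).im) (𝓝[<] (π / p)) (𝓝 0) := by
        have h3 := (Real.tendsto_exp_atBot.comp (tendsto_logCurve_re_atBot hp)).const_mul (4 * π)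
        rw [mul_zero] at h3
        refine squeeze_zero_norm' ?_ h3
        filter_upwards [hin, (tendsto_logCurve_re_atBot hp).eventually_le_atBot (-1)] with φ hφ hre
        exact hKπ _ (logCurve_mem_strip hp hφ) hre
      simpa [Function.comp_def] using h1.add h2
  | succ m ih =>
    push_cast at hs
    have hm : (0 : ℝ) < m + 1 := by positivity
    have hmC : (m + 1 : ℂ) ≠ 0 := by exact_mod_cast hm.ne'
    obtain ⟨G, hG, hG0, hGπ⟩ := ih (s := s - 1) (by linarith)
    refine ⟨fun φ => (s * G φ - (curvePow p s (m + 1) φ).im) / (m + 1), fun φ hφ => ?_, ?_, ?_⟩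
    · have h := (((hG φ hφ).const_mul s).sub
        (hasDerivAt_im (hasDerivAt_curvePow hp s (m + 1) hφ))).div_const ((m : ℝ) + 1)
      refine h.congr_deriv ?_
      rw [div_eq_iff hm.ne', ← Complex.im_ofReal_mul, ← Complex.sub_im, mul_comm _ ((m : ℝ) + 1),
        ← Complex.im_ofReal_mul, ← curvePow_succ_mul_logCurveDeriv hp s m hφ]
      congr 1
      push_cast
      ring
    · simpa using ((hG0.const_mul s).sub (tendsto_im_curvePow_zero hp s (m + 1))).div_const _
    · have h := ((hGπ.const_mul s).sub ((Complex.continuous_im.tendsto _).comp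
        (tendsto_curvePow_pi_div hp (s := s) (by linarith) (m + 1)))).div_const ((m : ℝ) + 1)
      convert! h using 2
      rw [Finset.prod_range_succ', Nat.factorial_succ]
      have : (m.factorial : ℝ) ≠ 0 := by positivity
      push_cast
      have e : ∀ i : ℕ, s - (i + 1 : ℝ) = s - 1 - i := fun i => by ring
      simp only [e, sub_zero, Complex.zero_im]
      field_simp

/-- The point `|w| ^ p / |w - 1|` of `(0, c(p))` attached to the angle `φ`. -/
noncomputable def angleMap (p φ : ℝ) : ℝ :=
  Real.exp (p * (logCurve p φ).re - (logShift p φ).re)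

/-- Minus the logarithmic derivative of `angleMap p`. -/
noncomputable def angleSlope (p φ : ℝ) : ℝ :=
  cot φ + (p - 1) ^ 2 * cot ((p - 1) * φ) - p ^ 2 * cot (p * φ)

/-- The density, in the angle variable, of the measure with moments `raney p r`. -/
noncomputable def angleDensity (p r φ : ℝ) : ℝ :=
  π⁻¹ * (Complex.exp (r * logCurve p φ)).im * angleSlope p φ

lemma logShiftDeriv_sub_mul_logCurveDeriv :
    logShiftDeriv p φ - p * logCurveDeriv p φ = angleSlope p φ := by
  simp only [logShiftDeriv, logCurveDeriv, angleSlope]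
  push_cast
  ring

lemma hasDerivAt_angleMap (hp : 1 < p) (hφ : φ ∈ Ioo 0 (π / p)) :
    HasDerivAt (angleMap p) (-(angleMap p φ * angleSlope p φ)) φ := by
  have re {f : ℝ → ℂ} {f' : ℂ} (h : HasDerivAt f f' φ) :
      HasDerivAt (fun x => (f x).re) f'.re φ := by
    simpa [Function.comp_def] using Complex.reCLM.hasFDerivAt.comp_hasDerivAt φ h
  have h := (((re (hasDerivAt_logCurve hp hφ)).const_mul p).sub
    (re (hasDerivAt_logShift hp hφ))).exp
  refine h.congr_deriv ?_
  have e := congrArg Complex.re (logShiftDeriv_sub_mul_logCurveDeriv (p := p) (φ := φ))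
  simp only [Complex.sub_re, Complex.re_ofReal_mul, Complex.ofReal_re] at e
  rw [← e, angleMap]
  simp only [Pi.sub_apply]
  ring

lemma angleMap_pos : 0 < angleMap p φ := Real.exp_pos _

lemma angleSlope_pos (hp : 1 < p) (hφ : φ ∈ Ioo 0 (π / p)) : 0 < angleSlope p φ := by
  have h1 := sin_mul_pos hp hφ
  have h2 := sin_sub_one_mul_pos hp hφ
  have h3 := sin_pos_of_mem hp hφ
  have e1 : sin (p * φ) = sin ((p - 1) * φ) * cos φ + cos ((p - 1) * φ) * sin φ := by
    rw [← sin_add]; ring_nf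
  have e2 : cos (p * φ) = cos ((p - 1) * φ) * cos φ - sin ((p - 1) * φ) * sin φ := by
    rw [← cos_add]; ring_nf
  simp only [angleSlope, cot_eq_cos_div_sin]
  rw [e1] at h1
  rw [e1, e2]
  generalize sin ((p - 1) * φ) = b at *
  generalize cos ((p - 1) * φ) = b' at *
  generalize sin φ = a at *
  generalize cos φ = a' at *
  have key : a' / a + (p - 1) ^ 2 * (b' / b) - p ^ 2 * ((b' * a' - b * a) / (b * a' + b' * a)) =
      ((a' * b - (p - 1) * b' * a) ^ 2 + p ^ 2 * (a * b) ^ 2) /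
        (a * b * (b * a' + b' * a)) := by
    generalize hD : b * a' + b' * a = D at *
    field_simp
    rw [← hD]
    ring
  rw [key]
  have : 0 < p ^ 2 * (a * b) ^ 2 := by positivity
  positivity

lemma strictAntiOn_angleMap (hp : 1 < p) : StrictAntiOn (angleMap p) (Ioo 0 (π / p)) := by
  refine strictAntiOn_of_deriv_neg (convex_Ioo _ _)
    (fun φ hφ => (hasDerivAt_angleMap hp hφ).continuousAt.continuousWithinAt) fun φ hφ => ?_
  rw [interior_Ioo] at hφ
  rw [(hasDerivAt_angleMap hp hφ).deriv, neg_lt_zero]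
  exact mul_pos angleMap_pos (angleSlope_pos hp hφ)

lemma tendsto_angleMap_zero (hp : 1 < p) :
    Tendsto (angleMap p) (𝓝[>] 0) (𝓝 (cRaney p)) := by
  have h1 := (Complex.continuous_re.tendsto _).comp (tendsto_logCurve_zero hp)
  have h2 := (Complex.continuous_re.tendsto _).comp (tendsto_logShift_zero hp)
  convert! ((h1.const_mul p).sub h2).rexp using 2
  rw [cRaney, Real.rpow_def_of_pos (by linarith), Real.rpow_def_of_pos (by linarith),
    ← Real.exp_add, Complex.ofReal_re, Complex.ofReal_re]
  ring_nf

lemma tendsto_angleMap_pi_div (hp : 1 < p) :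
    Tendsto (angleMap p) (𝓝[<] (π / p)) (𝓝 0) := by
  have h1 := (tendsto_logCurve_re_atBot hp).const_mul_atBot (by linarith : 0 < p)
  have h2 := (((Complex.continuous_re.tendsto _).comp (tendsto_logShift_pi_div hp))).neg
  refine Real.tendsto_exp_atBot.comp ?_
  simpa [sub_eq_add_neg, Function.comp_def] using h1.atBot_add h2

lemma angleMap_lt_cRaney (hp : 1 < p) (hφ : φ ∈ Ioo 0 (π / p)) : angleMap p φ < cRaney p := by
  have hψ : φ / 2 ∈ Ioo 0 (π / p) := ⟨by linarith [hφ.1], by linarith [hφ.1, hφ.2]⟩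
  refine (strictAntiOn_angleMap hp hψ hφ (by linarith [hφ.1])).trans_le ?_
  refine ge_of_tendsto (tendsto_angleMap_zero hp) ?_
  filter_upwards [Ioo_mem_nhdsGT hψ.1] with x hx
  exact (strictAntiOn_angleMap hp ⟨hx.1, hx.2.trans hψ.2⟩ hψ hx.2).le

lemma exists_angleMap_eq (hp : 1 < p) {y : ℝ} (hy : y ∈ Ioo 0 (cRaney p)) :
    ∃ φ ∈ Ioo 0 (π / p), angleMap p φ = y := by
  have hpos : 0 < π / p := div_pos pi_pos (by linarith)
  obtain ⟨a, hya, ha⟩ := (((tendsto_angleMap_zero hp).eventually (lt_mem_nhds hy.2)).and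
    (eventually_mem_set.2 (Ioo_mem_nhdsGT hpos))).exists
  obtain ⟨b, hyb, hb⟩ := (((tendsto_angleMap_pi_div hp).eventually (gt_mem_nhds hy.1)).and
    (eventually_mem_set.2 (Ioo_mem_nhdsLT hpos))).exists
  exact isPreconnected_Ioo.intermediate_value hb ha
    (fun φ hφ => (hasDerivAt_angleMap hp hφ).continuousAt.continuousWithinAt) ⟨hyb.le, hya.le⟩

lemma angleDensity_pos {r : ℝ} (hp : 1 < p) (hr : 0 < r) (hrp : r ≤ p)
    (hφ : φ ∈ Ioo 0 (π / p)) : 0 < angleDensity p r φ := by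
  refine mul_pos (mul_pos (inv_pos.2 pi_pos) ?_) (angleSlope_pos hp hφ)
  rw [Complex.exp_im, Complex.im_ofReal_mul, logCurve_im]
  refine mul_pos (Real.exp_pos _) (sin_pos_of_mem_Ioo ⟨mul_pos hr hφ.1, ?_⟩)
  nlinarith [(mul_mem_of_mem hp hφ).2, hφ.1]

lemma curvePow_eq (r : ℝ) (m : ℕ) :
    curvePow p (r + p * m) m φ =
      (angleMap p φ ^ m : ℝ) * Complex.exp (r * logCurve p φ) := by
  have e : p * logCurve p φ - logShift p φ =
      ((p * (logCurve p φ).re - (logShift p φ).re : ℝ) : ℂ) := by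
    apply Complex.ext
    · simp
    · simp [logCurve_im, logShift_im]
  rw [angleMap, ← Real.exp_nat_mul, Complex.ofReal_exp, Complex.ofReal_mul, ← e, ← Complex.exp_add,
    curvePow]
  push_cast
  ring_nf

lemma pow_mul_angleDensity (r : ℝ) (m : ℕ) :
    angleMap p φ ^ m * angleDensity p r φ =
      π⁻¹ * (curvePow p (r + p * m) m φ *
        (logShiftDeriv p φ - p * logCurveDeriv p φ)).im := by
  rw [logShiftDeriv_sub_mul_logCurveDeriv, curvePow_eq, Complex.im_mul_ofReal,
    Complex.im_ofReal_mul, angleDensity]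
  ring

lemma exists_primitive_pow_mul_angleDensity {r : ℝ} (hp : 1 < p) (hr : 0 < r) (m : ℕ) :
    ∃ G : ℝ → ℝ,
      (∀ φ ∈ Ioo 0 (π / p), HasDerivAt G (angleMap p φ ^ m * angleDensity p r φ) φ) ∧
      Tendsto G (𝓝[>] 0) (𝓝 0) ∧ Tendsto G (𝓝[<] (π / p)) (𝓝 (raney p r m)) := by
  have hπ := pi_ne_zero
  simp only [pow_mul_angleDensity]
  cases m with
  | zero =>
    obtain ⟨G, hG, hG0, hGπ⟩ := exists_primitive_curvePow hp 0 (s := r) (by simpa)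
    refine ⟨fun φ => π⁻¹ * (G φ - p / r * (curvePow p r 0 φ).im), fun φ hφ => ?_, ?_, ?_⟩
    · refine (((hG φ hφ).sub ((hasDerivAt_im
        (hasDerivAt_curvePow hp r 0 hφ)).const_mul (p / r))).const_mul π⁻¹).congr_deriv ?_
      rw [← Complex.im_ofReal_mul, ← Complex.sub_im]
      congr 2
      have : (r : ℂ) ≠ 0 := by exact_mod_cast hr.ne'
      push_cast
      simp only [mul_zero, add_zero, zero_mul, sub_zero]
      field_simp
    · simpa using (hG0.sub ((tendsto_im_curvePow_zero hp r 0).const_mul (p / r))).const_mul π⁻¹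
    · simpa [raney, hπ, Function.comp_def] using (hGπ.sub (((Complex.continuous_im.tendsto _).comp
        (tendsto_curvePow_pi_div hp hr 0)).const_mul (p / r))).const_mul π⁻¹
  | succ m =>
    have hs : ((m + 1 : ℕ) : ℝ) < r + p * (m + 1 : ℕ) := by
      have : (0 : ℝ) < (m + 1 : ℕ) := by positivity
      nlinarith
    generalize hsd : r + p * (m + 1 : ℕ) = s at hs
    obtain ⟨G, hG, hG0, hGπ⟩ := exists_primitive_curvePow hp (m + 1) hs
    obtain ⟨H, hH, hH0, hHπ⟩ := exists_primitive_curvePow hp m (s := s - 1)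
      (by push_cast at hs; linarith)
    refine ⟨fun φ => π⁻¹ * (G φ - p * H φ), fun φ hφ => ?_, ?_, ?_⟩
    · refine (((hG φ hφ).sub ((hH φ hφ).const_mul p)).const_mul π⁻¹).congr_deriv ?_
      rw [← Complex.im_ofReal_mul, ← Complex.sub_im, ← curvePow_succ_mul_logCurveDeriv hp s m hφ]
      ring_nf
    · simpa using (hG0.sub (hH0.const_mul p)).const_mul π⁻¹
    · convert! (hGπ.sub (hHπ.const_mul p)).const_mul π⁻¹ using 2
      have e1 : ∏ i ∈ Finset.Icc 1 m, (((m : ℝ) + 1) * p + r - (i : ℝ)) =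
          ∏ i ∈ Finset.range m, (s - 1 - i) := by
        have hI : Finset.Icc 1 m = Finset.Ico (0 + 1) (m + 1) := by ext; simp
        rw [hI, ← Finset.prod_Ico_add', ← Finset.range_eq_Ico]
        refine Finset.prod_congr rfl fun i _ => ?_
        rw [← hsd]
        push_cast
        ring
      have e2 : ∏ i ∈ Finset.range (m + 1), (s - i) = (∏ i ∈ Finset.range m, (s - 1 - i)) * s := by
        rw [Finset.prod_range_succ', Nat.cast_zero, sub_zero]
        congr 1
        refine Finset.prod_congr rfl fun i _ => ?_
        push_cast
        ring
      rw [raney, e1, e2, Nat.factorial_succ, ← hsd]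
      have : (m.factorial : ℝ) ≠ 0 := by positivity
      push_cast
      field_simp
      ring

lemma measurable_angleMap : Measurable (angleMap p) := by
  have h1 : Measurable (logCurve p) := by unfold logCurve; fun_prop
  have h2 : Measurable (logShift p) := by unfold logShift; fun_prop
  unfold angleMap
  fun_prop

lemma measurable_angleSlope : Measurable (angleSlope p) := by
  unfold angleSlope
  simp only [cot_eq_cos_div_sin]
  fun_prop

lemma measurable_angleDensity (r : ℝ) : Measurable (angleDensity p r) := by
  have h1 : Measurable (logCurve p) := by unfold logCurve; fun_prop
  have h2 := measurable_angleSlope (p := p)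
  unfold angleDensity
  fun_prop

/-- The measure with moments `raney p r`, in the angle variable. -/
noncomputable def angleMeasure (p r : ℝ) : Measure ℝ :=
  (volume.restrict (Ioo 0 (π / p))).withDensity fun φ => ENNReal.ofReal (angleDensity p r φ)

/-- The measure with moments `raney p r`. -/
noncomputable def raneyMeasure (p r : ℝ) : Measure ℝ :=
  (angleMeasure p r).map (angleMap p)

section Measure

variable {r : ℝ}

lemma pi_div_pos (hp : 1 < p) : 0 < π / p := div_pos pi_pos (by linarith)

lemma angleMeasure_compl : angleMeasure p r (Ioo 0 (π / p))ᶜ = 0 :=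
  withDensity_absolutelyContinuous _ _ (by simp [Measure.restrict_apply measurableSet_Ioo.compl])

lemma volume_inter_eq_zero_of_angleMeasure (hp : 1 < p) (hr : 0 < r) (hrp : r ≤ p) {s : Set ℝ}
    (h : angleMeasure p r s = 0) : volume (s ∩ Ioo 0 (π / p)) = 0 := by
  rw [angleMeasure, withDensity_apply_eq_zero (measurable_angleDensity r).ennreal_ofReal,
    Measure.restrict_apply' measurableSet_Ioo] at h
  refine measure_mono_null (subset_inter (subset_inter (fun φ hφ => ?_) inter_subset_left)
    inter_subset_right) h
  exact (ENNReal.ofReal_pos.2 (angleDensity_pos hp hr hrp hφ.2)).ne'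

lemma integrableOn_angleDensity (hp : 1 < p) (hr : 0 < r) (hrp : r ≤ p) :
    IntegrableOn (angleDensity p r) (Ioo 0 (π / p)) := by
  obtain ⟨G, hG, hG0, hGπ⟩ := exists_primitive_pow_mul_angleDensity hp hr 0
  simp only [pow_zero, one_mul] at hG
  exact integrableOn_Ioo_deriv_of_nonneg hG
    (fun φ hφ => (angleDensity_pos hp hr hrp hφ).le) hG0 hGπ

lemma integral_pow_mul_angleDensity (hp : 1 < p) (hr : 0 < r) (hrp : r ≤ p) (m : ℕ) :
    ∫ φ in Ioo 0 (π / p), angleMap p φ ^ m * angleDensity p r φ = raney p r m := by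
  obtain ⟨G, hG, hG0, hGπ⟩ := exists_primitive_pow_mul_angleDensity hp hr m
  rw [integral_Ioo_deriv_of_nonneg (pi_div_pos hp) hG
    (fun φ hφ => (mul_pos (pow_pos angleMap_pos m) (angleDensity_pos hp hr hrp hφ)).le) hG0 hGπ,
    sub_zero]

lemma isProbabilityMeasure_raneyMeasure (hp : 1 < p) (hr : 0 < r) (hrp : r ≤ p) :
    IsProbabilityMeasure (raneyMeasure p r) := by
  have : IsProbabilityMeasure (angleMeasure p r) := by
    refine ⟨?_⟩
    rw [angleMeasure, withDensity_apply _ MeasurableSet.univ, Measure.restrict_univ,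
      ← ofReal_integral_eq_lintegral_ofReal (integrableOn_angleDensity hp hr hrp)]
    · have := integral_pow_mul_angleDensity hp hr hrp 0
      simp only [pow_zero, one_mul] at this
      rw [this, raney, ENNReal.ofReal_one]
    · filter_upwards [ae_restrict_mem measurableSet_Ioo] with φ hφ using
        (angleDensity_pos hp hr hrp hφ).le
  exact Measure.isProbabilityMeasure_map measurable_angleMap.aemeasurable

lemma integral_pow_raneyMeasure (hp : 1 < p) (hr : 0 < r) (hrp : r ≤ p) (m : ℕ) :
    ∫ x, x ^ m ∂raneyMeasure p r = raney p r m := by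
  rw [raneyMeasure, integral_map measurable_angleMap.aemeasurable (by fun_prop), angleMeasure,
    integral_withDensity_eq_integral_toReal_smul (measurable_angleDensity r).ennreal_ofReal
      (ae_of_all _ fun _ => ENNReal.ofReal_lt_top), ← integral_pow_mul_angleDensity hp hr hrp m]
  refine setIntegral_congr_fun measurableSet_Ioo fun φ hφ => ?_
  simp only [ENNReal.toReal_ofReal (angleDensity_pos hp hr hrp hφ).le, smul_eq_mul]
  ring

lemma raneyMeasure_absolutelyContinuous (hp : 1 < p) : raneyMeasure p r ≪ volume := by
  refine Measure.AbsolutelyContinuous.mk fun s hs h0 => ?_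
  rw [raneyMeasure, Measure.map_apply measurable_angleMap hs]
  refine withDensity_absolutelyContinuous _ _ ?_
  have hS := measurable_angleMap (p := p) hs
  rw [Measure.restrict_apply hS]
  set S := angleMap p ⁻¹' s ∩ Ioo 0 (π / p)
  have hSm : MeasurableSet S := hS.inter measurableSet_Ioo
  have h1 := lintegral_image_eq_lintegral_abs_deriv_mul hSm
    (fun φ hφ => (hasDerivAt_angleMap hp hφ.2).hasDerivWithinAt)
    ((strictAntiOn_angleMap hp).injOn.mono inter_subset_right) fun _ => 1
  simp only [lintegral_const, mul_one, one_mul, Measure.restrict_apply MeasurableSet.univ,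
    univ_inter] at h1
  rw [measure_mono_null (image_subset_iff.2 inter_subset_left) h0] at h1
  have h2 : Measurable fun φ => ENNReal.ofReal |-(angleMap p φ * angleSlope p φ)| := by
    have := measurable_angleMap (p := p)
    have := measurable_angleSlope (p := p)
    fun_prop
  by_contra hne
  refine ((setLIntegral_pos_iff h2).2 ?_).ne h1
  refine (pos_iff_ne_zero.2 hne).trans_le (measure_mono (subset_inter (fun φ hφ => ?_) subset_rfl))
  refine (ENNReal.ofReal_pos.2 (abs_pos.2 (neg_ne_zero.2 ?_))).ne'
  exact (mul_pos angleMap_pos (angleSlope_pos hp hφ.2)).ne'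

lemma raneyMeasure_compl_Icc (hp : 1 < p) : raneyMeasure p r (Icc 0 (cRaney p))ᶜ = 0 := by
  rw [raneyMeasure, Measure.map_apply measurable_angleMap measurableSet_Icc.compl]
  refine measure_mono_null (compl_subset_compl.2 fun φ hφ => ?_) angleMeasure_compl
  exact ⟨angleMap_pos.le, (angleMap_lt_cRaney hp hφ).le⟩

lemma cRaney_pos (hp : 1 < p) : 0 < cRaney p :=
  mul_pos (Real.rpow_pos_of_pos (by linarith) _) (Real.rpow_pos_of_pos (by linarith) _)

lemma Icc_subset_of_raneyMeasure_compl (hp : 1 < p) (hr : 0 < r) (hrp : r ≤ p) {F : Set ℝ}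
    (hF : IsClosed F) (h : raneyMeasure p r Fᶜ = 0) : Icc 0 (cRaney p) ⊆ F := by
  rw [raneyMeasure, Measure.map_apply measurable_angleMap hF.measurableSet.compl] at h
  have h0 := volume_inter_eq_zero_of_angleMeasure hp hr hrp h
  have hcont : ContinuousOn (angleMap p) (Ioo 0 (π / p)) := fun φ hφ =>
    (hasDerivAt_angleMap hp hφ).continuousAt.continuousWithinAt
  rw [inter_comm, (hcont.isOpen_inter_preimage isOpen_Ioo hF.isOpen_compl).measure_eq_zero_iff volume]
    at h0
  rw [← closure_Ioo (cRaney_pos hp).ne, hF.closure_subset_iff]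
  intro y hy
  obtain ⟨φ, hφ, rfl⟩ := exists_angleMap_eq hp hy
  by_contra hyF
  exact eq_empty_iff_forall_notMem.1 h0 φ ⟨hφ, hyF⟩

lemma raney_pos (hp : 1 < p) (hr : 0 < r) (m : ℕ) : 0 < raney p r m := by
  cases m with
  | zero => exact one_pos
  | succ m =>
    refine mul_pos (by positivity) (Finset.prod_pos fun i hi => ?_)
    have h1 : (i : ℝ) ≤ m := by exact_mod_cast (Finset.mem_Icc.1 hi).2
    have h2 : (0 : ℝ) ≤ m := m.cast_nonneg
    nlinarith

lemma eq_raneyMeasure (hp : 1 < p) (hr : 0 < r) (hrp : r ≤ p) {ν : Measure ℝ}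
    [IsProbabilityMeasure ν] (h : ∀ m : ℕ, ∫ x, x ^ m ∂ν = raney p r m) :
    ν = raneyMeasure p r := by
  have := isProbabilityMeasure_raneyMeasure hp hr hrp
  refine eq_of_integral_pow_eq_of_ne_zero (cRaney_pos hp).le ?_ (fun m => ?_) fun m => ?_
  · filter_upwards [mem_ae_iff.2 (raneyMeasure_compl_Icc (r := r) hp)] with x hx
    exact abs_le.2 ⟨by linarith [hx.1, cRaney_pos hp], hx.2⟩
  · rw [integral_pow_raneyMeasure hp hr hrp]
    exact (raney_pos hp hr m).ne'
  · rw [h, integral_pow_raneyMeasure hp hr hrp]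

end Measure

end Curve

end Raney

/-- For integers `1 ≤ l < k`, `p = k/l`, and real `0 < r ≤ p`, there exists a
unique probability measure `μ(p,r)` on `ℝ` whose `m`-th moment is `A_m(p,r)` for every `m`;
moreover `μ(p,r)` is absolutely continuous w.r.t. Lebesgue measure and its (topological)
support equals `[0, c(p)]` (it is the smallest closed set of full measure). -/
theorem stmt_4 (k l : ℕ) (hl : 1 ≤ l) (hlk : l < k) (r : ℝ) (hr : 0 < r)
    (hrp : r ≤ (k : ℝ) / (l : ℝ)) :
    ∃ μ : Measure ℝ, IsProbabilityMeasure μ ∧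
      (∀ m : ℕ, ∫ x, x ^ m ∂μ = raney ((k : ℝ) / (l : ℝ)) r m) ∧
      (∀ ν : Measure ℝ, IsProbabilityMeasure ν →
        (∀ m : ℕ, ∫ x, x ^ m ∂ν = raney ((k : ℝ) / (l : ℝ)) r m) → ν = μ) ∧
      μ ≪ volume ∧
      μ ((Set.Icc (0 : ℝ) (cRaney ((k : ℝ) / (l : ℝ))))ᶜ) = 0 ∧
      (∀ F : Set ℝ, IsClosed F → μ Fᶜ = 0 →
        Set.Icc (0 : ℝ) (cRaney ((k : ℝ) / (l : ℝ))) ⊆ F) := by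
  have hp : (1 : ℝ) < (k : ℝ) / (l : ℝ) := by
    rw [one_lt_div (by exact_mod_cast hl)]
    exact_mod_cast hlk
  exact ⟨Raney.raneyMeasure ((k : ℝ) / l) r, Raney.isProbabilityMeasure_raneyMeasure hp hr hrp,
    Raney.integral_pow_raneyMeasure hp hr hrp, fun ν _ => Raney.eq_raneyMeasure hp hr hrp,
    Raney.raneyMeasure_absolutelyContinuous hp, Raney.raneyMeasure_compl_Icc hp,
    fun _ => Raney.Icc_subset_of_raneyMeasure_compl hp hr hrp⟩
end

section
/- Let p and r be real numbers with p ≥ 1 and 0 ≤ r ≤ p. Then there exists a unique probability measure μ(p,r) on ℝ with support contained in [0, c(p)] such that ∫ x^m dμ(p,r)(x) = A_m(p,r) for every natural number m. -/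
open MeasureTheory Real

open Set Filter Topology

/-- A `C¹` path `γ : [0, L] → ℂ` (with derivative `γ'`) from a positive real to a real in
`(-1, 0)`, running through the upper half plane. -/
structure IsUpperArc (γ γ' : ℝ → ℂ) (L : ℝ) : Prop where
  pos : 0 < L
  hasDerivAt : ∀ φ ∈ Icc 0 L, HasDerivAt γ (γ' φ) φ
  continuousOn : ContinuousOn γ' (Icc 0 L)
  start : ∃ u : ℝ, 0 < u ∧ γ 0 = u
  finish : ∃ s : ℝ, 0 < s ∧ s < 1 ∧ γ L = -s
  im_pos : ∀ φ ∈ Ioo 0 L, 0 < (γ φ).im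

lemma HasDerivAt.cpow_const_of_real {f : ℝ → ℂ} {f' : ℂ} {x : ℝ} (hf : HasDerivAt f f' x)
    (hx : f x ∈ Complex.slitPlane) (c : ℂ) :
    HasDerivAt (fun x => f x ^ c) (c * f x ^ (c - 1) * f') x := by
  have h1 : HasDerivAt (fun z : ℂ => z ^ c) (c * f x ^ (c - 1)) (f x) := by
    simpa using (hasDerivAt_id (f x)).cpow_const (c := c) hx
  exact h1.comp x hf

namespace IsUpperArc

variable {γ γ' : ℝ → ℂ} {L : ℝ}

lemma continuousOn_path (h : IsUpperArc γ γ' L) : ContinuousOn γ (Icc 0 L) :=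
  fun φ hφ => (h.hasDerivAt φ hφ).continuousAt.continuousWithinAt

lemma cases (h : IsUpperArc γ γ' L) {φ : ℝ} (hφ : φ ∈ Icc 0 L) :
    0 < (γ φ).im ∨ ∃ x : ℝ, x ≠ 0 ∧ -1 < x ∧ γ φ = x := by
  rcases eq_or_lt_of_le hφ.1 with h0 | h0
  · obtain ⟨u, hu, h1⟩ := h.start
    exact Or.inr ⟨u, hu.ne', by linarith, by rw [← h0, h1]⟩
  rcases eq_or_lt_of_le hφ.2 with h2 | h2
  · obtain ⟨s, hs, hs1, h1⟩ := h.finish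
    exact Or.inr ⟨-s, by linarith, by linarith, by rw [h2, h1]; simp⟩
  exact Or.inl (h.im_pos φ ⟨h0, h2⟩)

lemma ne_zero (h : IsUpperArc γ γ' L) {φ : ℝ} (hφ : φ ∈ Icc 0 L) : γ φ ≠ 0 := by
  rcases h.cases hφ with h1 | ⟨x, hx, -, h1⟩
  · intro h0
    simp [h0] at h1
  · rw [h1]
    exact_mod_cast hx

lemma one_add_mul_mem_slitPlane (h : IsUpperArc γ γ' L) {φ : ℝ} (hφ : φ ∈ Icc 0 L)
    {s : ℝ} (hs : s ∈ Icc (0 : ℝ) 1) : 1 + s * γ φ ∈ Complex.slitPlane := by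
  rcases h.cases hφ with h1 | ⟨x, -, hx, h1⟩
  · rcases eq_or_lt_of_le hs.1 with h0 | h0
    · simp [← h0]
    · right
      simp only [Complex.add_im, Complex.one_im, Complex.mul_im, Complex.ofReal_re,
        Complex.ofReal_im]
      nlinarith [mul_pos h0 h1]
  · left
    rw [h1]
    simp only [Complex.add_re, Complex.one_re, Complex.mul_re, Complex.ofReal_re,
        Complex.ofReal_im]
    rcases le_total 0 x with h0 | h0 <;> nlinarith [hs.1, hs.2]

lemma one_add_mem_slitPlane (h : IsUpperArc γ γ' L) {φ : ℝ} (hφ : φ ∈ Icc 0 L) :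
    1 + γ φ ∈ Complex.slitPlane := by
  simpa using h.one_add_mul_mem_slitPlane hφ (s := 1) (by simp)

lemma im_integral_log_deriv (h : IsUpperArc γ γ' L) :
    (∫ φ in (0 : ℝ)..L, γ' φ / γ φ).im = π := by
  have hmem : ∀ φ ∈ Icc 0 L, -Complex.I * γ φ ∈ Complex.slitPlane := by
    intro φ hφ
    rcases h.cases hφ with h1 | ⟨x, hx, -, h1⟩
    · left
      simpa using h1
    · right
      rw [h1]
      simpa using hx
  have hd : ∀ φ ∈ uIcc 0 L,
      HasDerivAt (fun φ => Complex.log (-Complex.I * γ φ)) (γ' φ / γ φ) φ := by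
    intro φ hφ
    rw [uIcc_of_le h.pos.le] at hφ
    have := (((h.hasDerivAt φ hφ).const_mul (-Complex.I))).clog_real (hmem φ hφ)
    convert this using 1
    rw [mul_div_mul_left _ _ (by simp)]
  rw [intervalIntegral.integral_eq_sub_of_hasDerivAt hd]
  · obtain ⟨u, hu, h0⟩ := h.start
    obtain ⟨s, hs, -, hL⟩ := h.finish
    have e1 : -Complex.I * γ L = (s : ℝ) * Complex.I := by rw [hL]; ring
    have e2 : -Complex.I * γ 0 = (u : ℝ) * -Complex.I := by rw [h0]; ring
    rw [e1, e2, Complex.sub_im, Complex.log_im, Complex.log_im, Complex.arg_real_mul _ hs,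
      Complex.arg_real_mul _ hu, Complex.arg_I, Complex.arg_neg_I]
    ring
  · apply ContinuousOn.intervalIntegrable
    rw [uIcc_of_le h.pos.le]
    exact h.continuousOn.div h.continuousOn_path fun φ hφ => h.ne_zero hφ

lemma hasDerivAt_one_add_mul_cpow (h : IsUpperArc γ γ' L) (α : ℝ) {s φ : ℝ}
    (hs : s ∈ Icc (0 : ℝ) 1) (hφ : φ ∈ Icc 0 L) :
    HasDerivAt (fun φ => (1 + s * γ φ) ^ (α : ℂ))
      (α * (1 + s * γ φ) ^ (α - 1 : ℂ) * (s * γ' φ)) φ := by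
  have h1 : HasDerivAt (fun φ => 1 + s * γ φ) (s * γ' φ) φ :=
    ((h.hasDerivAt φ hφ).const_mul (s : ℂ)).const_add 1
  exact h1.cpow_const_of_real (h.one_add_mul_mem_slitPlane hφ hs) _

lemma continuousOn_one_add_mul_cpow (h : IsUpperArc γ γ' L) (c : ℂ) :
    ContinuousOn (fun q : ℝ × ℝ => (1 + q.1 * γ q.2) ^ c) (Icc (0 : ℝ) 1 ×ˢ Icc 0 L) := by
  apply ContinuousOn.cpow_const
  · exact continuousOn_const.add ((Complex.continuous_ofReal.comp continuous_fst).continuousOn.mul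
      (h.continuousOn_path.comp continuousOn_snd fun q hq => hq.2))
  · exact fun q hq => h.one_add_mul_mem_slitPlane hq.2 hq.1

lemma im_integral_cpow_mul_log_deriv (h : IsUpperArc γ γ' L) (α : ℝ) :
    (∫ φ in (0 : ℝ)..L, (1 + γ φ) ^ (α : ℂ) * γ' φ / γ φ).im = π := by
  have hcont : ContinuousOn (fun q : ℝ × ℝ => (α : ℂ) * (1 + q.1 * γ q.2) ^ (α - 1 : ℂ) * γ' q.2)
      (Icc (0 : ℝ) 1 ×ˢ Icc 0 L) :=
    (continuousOn_const.mul (h.continuousOn_one_add_mul_cpow _)).mul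
      (h.continuousOn.comp continuousOn_snd fun q hq => hq.2)
  have hint : Integrable (Function.uncurry fun φ s : ℝ =>
      (α : ℂ) * (1 + s * γ φ) ^ (α - 1 : ℂ) * γ' φ)
      ((volume.restrict (Ioc 0 L)).prod (volume.restrict (Ioc (0 : ℝ) 1))) := by
    rw [Measure.prod_restrict]
    refine IntegrableOn.mono_set ?_ (prod_mono Ioc_subset_Icc_self Ioc_subset_Icc_self)
    exact (hcont.comp continuous_swap.continuousOn fun q hq => ⟨hq.2, hq.1⟩).integrableOn_compact
      (isCompact_Icc.prod isCompact_Icc)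
  have hswap := integral_integral_swap hint
  have hinner : ∀ φ ∈ Icc 0 L, ∫ s in Ioc (0 : ℝ) 1, (α : ℂ) * (1 + s * γ φ) ^ (α - 1 : ℂ) * γ' φ
      = (1 + γ φ) ^ (α : ℂ) * γ' φ / γ φ - γ' φ / γ φ := by
    intro φ hφ
    have hne := h.ne_zero hφ
    have hd : ∀ s ∈ uIcc (0 : ℝ) 1, HasDerivAt (fun s : ℝ => (1 + s * γ φ) ^ (α : ℂ) * γ' φ / γ φ)
        ((α : ℂ) * (1 + s * γ φ) ^ (α - 1 : ℂ) * γ' φ) s := by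
      intro s hs
      rw [uIcc_of_le zero_le_one] at hs
      have h1 : HasDerivAt (fun s : ℝ => 1 + s * γ φ) (1 * γ φ) s :=
        (Complex.ofRealCLM.hasDerivAt.mul_const (γ φ)).const_add 1
      refine (((h1.cpow_const_of_real (h.one_add_mul_mem_slitPlane hφ hs) α).mul_const
        (γ' φ)).div_const (γ φ)).congr_deriv ?_
      field_simp
    rw [← intervalIntegral.integral_of_le zero_le_one,
      intervalIntegral.integral_eq_sub_of_hasDerivAt hd]
    · simp
    · apply ContinuousOn.intervalIntegrable
      rw [uIcc_of_le zero_le_one]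
      exact hcont.comp (f := fun s : ℝ => (s, φ)) (by fun_prop) fun s hs => ⟨hs, hφ⟩
  have houter : ∀ s ∈ Ioc (0 : ℝ) 1, ∃ c : ℝ,
      ∫ φ in Ioc 0 L, (α : ℂ) * (1 + s * γ φ) ^ (α - 1 : ℂ) * γ' φ = c := by
    intro s hs
    have hs' : s ∈ Icc (0 : ℝ) 1 := Ioc_subset_Icc_self hs
    have hs0 : (s : ℂ) ≠ 0 := by exact_mod_cast hs.1.ne'
    have hd : ∀ φ ∈ uIcc 0 L, HasDerivAt (fun φ : ℝ => (1 + s * γ φ) ^ (α : ℂ) / s)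
        ((α : ℂ) * (1 + s * γ φ) ^ (α - 1 : ℂ) * γ' φ) φ := by
      intro φ hφ
      rw [uIcc_of_le h.pos.le] at hφ
      refine ((h.hasDerivAt_one_add_mul_cpow α hs' hφ).div_const (s : ℂ)).congr_deriv ?_
      field_simp
    rw [← intervalIntegral.integral_of_le h.pos.le,
      intervalIntegral.integral_eq_sub_of_hasDerivAt hd]
    · obtain ⟨u, hu, h0⟩ := h.start
      obtain ⟨t, ht, ht1, hL⟩ := h.finish
      refine ⟨(1 - s * t) ^ α / s - (1 + s * u) ^ α / s, ?_⟩
      rw [h0, hL]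
      push_cast [Complex.ofReal_cpow (show (0:ℝ) ≤ 1 - s * t by nlinarith [hs.1, hs.2]),
        Complex.ofReal_cpow (show (0:ℝ) ≤ 1 + s * u by nlinarith [hs.1, hs.2])]
      ring_nf
    · apply ContinuousOn.intervalIntegrable
      rw [uIcc_of_le h.pos.le]
      exact hcont.comp (f := fun φ : ℝ => (s, φ)) (by fun_prop) fun φ hφ => ⟨hs', hφ⟩
  choose! c hc using houter
  rw [setIntegral_congr_fun measurableSet_Ioc hc,
    setIntegral_congr_fun measurableSet_Ioc fun φ hφ => hinner φ (Ioc_subset_Icc_self hφ),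
    integral_complex_ofReal] at hswap
  have hc1 : IntervalIntegrable (fun φ => γ' φ / γ φ) volume 0 L := by
    apply ContinuousOn.intervalIntegrable
    rw [uIcc_of_le h.pos.le]
    exact h.continuousOn.div h.continuousOn_path fun φ hφ => h.ne_zero hφ
  have hc2 : IntervalIntegrable (fun φ => (1 + γ φ) ^ (α : ℂ) * γ' φ / γ φ) volume 0 L := by
    apply ContinuousOn.intervalIntegrable
    rw [uIcc_of_le h.pos.le]
    refine ContinuousOn.div (ContinuousOn.mul ?_ h.continuousOn) h.continuousOn_path
      fun φ hφ => h.ne_zero hφ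
    exact (continuousOn_const.add h.continuousOn_path).cpow_const
      fun φ hφ => h.one_add_mem_slitPlane hφ
  rw [← intervalIntegral.integral_of_le h.pos.le, intervalIntegral.integral_sub hc2 hc1] at hswap
  have := congrArg Complex.im hswap
  rw [Complex.sub_im, h.im_integral_log_deriv] at this
  simpa [sub_eq_zero] using this

lemma im_integral_cpow_mul_zpow (h : IsUpperArc γ γ' L) (a : ℝ) (m : ℕ) :
    (∫ φ in (0 : ℝ)..L, (1 + γ φ) ^ (a : ℂ) * γ' φ / γ φ ^ (m + 1)).im =
      π * (∏ i ∈ Finset.range m, (a - i)) / m.factorial := by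
  induction m generalizing a with
  | zero => simpa using h.im_integral_cpow_mul_log_deriv a
  | succ m ih =>
    have hE : ∀ φ ∈ uIcc 0 L, HasDerivAt (fun φ => (1 + γ φ) ^ (a : ℂ) / γ φ ^ (m + 1))
        (a * ((1 + γ φ) ^ ((a - 1 : ℝ) : ℂ) * γ' φ / γ φ ^ (m + 1)) -
          (m + 1) * ((1 + γ φ) ^ (a : ℂ) * γ' φ / γ φ ^ (m + 1 + 1))) φ := by
      intro φ hφ
      rw [uIcc_of_le h.pos.le] at hφ
      have hne := h.ne_zero hφ
      have h1 := ((h.hasDerivAt φ hφ).const_add 1).cpow_const_of_real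
        (h.one_add_mem_slitPlane hφ) a
      refine (h1.fun_div ((h.hasDerivAt φ hφ).fun_pow (m + 1)) (pow_ne_zero _ hne)).congr_deriv ?_
      push_cast
      field_simp
      ring_nf
    have hi : ∀ (b : ℝ) (n : ℕ),
        IntervalIntegrable (fun φ => (1 + γ φ) ^ (b : ℂ) * γ' φ / γ φ ^ n) volume 0 L := by
      intro b n
      apply ContinuousOn.intervalIntegrable
      rw [uIcc_of_le h.pos.le]
      refine ContinuousOn.div (ContinuousOn.mul ?_ h.continuousOn) (h.continuousOn_path.pow n)
        fun φ hφ => pow_ne_zero _ (h.ne_zero hφ)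
      exact (continuousOn_const.add h.continuousOn_path).cpow_const
        fun φ hφ => h.one_add_mem_slitPlane hφ
    have hreal : ((1 + γ L) ^ (a : ℂ) / γ L ^ (m + 1) - (1 + γ 0) ^ (a : ℂ) / γ 0 ^ (m + 1)).im
        = 0 := by
      obtain ⟨u, hu, h0⟩ := h.start
      obtain ⟨t, ht, ht1, hL⟩ := h.finish
      have : (1 + γ L) ^ (a : ℂ) / γ L ^ (m + 1) - (1 + γ 0) ^ (a : ℂ) / γ 0 ^ (m + 1) =
          (((1 - t) ^ a / (-t) ^ (m + 1) - (1 + u) ^ a / u ^ (m + 1) : ℝ) : ℂ) := by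
        rw [h0, hL]
        push_cast [Complex.ofReal_cpow (show (0:ℝ) ≤ 1 - t by linarith),
          Complex.ofReal_cpow (show (0:ℝ) ≤ 1 + u by linarith)]
        ring_nf
      rw [this, Complex.ofReal_im]
    have hFTC := intervalIntegral.integral_eq_sub_of_hasDerivAt hE
      (((hi (a - 1) (m + 1)).const_mul _).sub ((hi a (m + 1 + 1)).const_mul _))
    rw [intervalIntegral.integral_sub ((hi (a - 1) (m + 1)).const_mul _)
      ((hi a (m + 1 + 1)).const_mul _), intervalIntegral.integral_const_mul,
      intervalIntegral.integral_const_mul] at hFTC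
    have := congrArg Complex.im hFTC
    rw [hreal, Complex.sub_im, ← Nat.cast_succ, ← Complex.ofReal_natCast,
      Complex.im_ofReal_mul, Complex.im_ofReal_mul, ih] at this
    rw [Finset.prod_range_succ', Nat.factorial_succ]
    have h3 : ((m : ℝ) + 1) ≠ 0 := by positivity
    have h4 : (m.factorial : ℝ) ≠ 0 := by positivity
    push_cast at this ⊢
    have h5 : ∀ i : ℕ, a - (i + 1 : ℝ) = a - 1 - i := fun i => by ring
    simp only [h5]
    field_simp at this ⊢
    linarith

end IsUpperArc

/-- The contour integral for the binomial coefficients, for an arc that reaches the branch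
point `-1`. -/
lemma im_integral_cpow_mul_zpow_of_finish_neg_one {γ γ' : ℝ → ℂ} {L : ℝ} (hL : 0 < L)
    (hd : ∀ φ ∈ Icc 0 L, HasDerivAt γ (γ' φ) φ) (hc : ContinuousOn γ' (Icc 0 L))
    (h0 : ∃ u : ℝ, 0 < u ∧ γ 0 = u) (h1 : γ L = -1) (him : ∀ φ ∈ Ioo 0 L, 0 < (γ φ).im)
    {a : ℝ} (ha : 0 < a) (m : ℕ) :
    (∫ φ in (0 : ℝ)..L, (1 + γ φ) ^ (a : ℂ) * γ' φ / γ φ ^ (m + 1)).im =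
      π * (∏ i ∈ Finset.range m, (a - i)) / m.factorial := by
  set C := π * (∏ i ∈ Finset.range m, (a - i)) / m.factorial
  have harc : ∀ t ∈ Ioo (0 : ℝ) 1, IsUpperArc (fun φ => t * γ φ) (fun φ => t * γ' φ) L := by
    intro t ht
    refine ⟨hL, fun φ hφ => (hd φ hφ).const_mul _, continuousOn_const.mul hc, ?_, ?_, ?_⟩
    · obtain ⟨u, hu, h0⟩ := h0
      exact ⟨t * u, mul_pos ht.1 hu, by simp [h0]⟩
    · exact ⟨t, ht.1, ht.2, by simp [h1]⟩
    · intro φ hφ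
      simpa using mul_pos ht.1 (him φ hφ)
  have hγ : ContinuousOn γ (Icc 0 L) :=
    fun φ hφ => (hd φ hφ).continuousAt.continuousWithinAt
  have hne : ∀ φ ∈ Icc 0 L, γ φ ≠ 0 := by
    intro φ hφ h
    exact (harc (1 / 2) ⟨by norm_num, by norm_num⟩).ne_zero hφ (by simp [h])
  have hcont : ContinuousOn (fun q : ℝ × ℝ => (1 + q.1 * γ q.2) ^ (a : ℂ) * γ' q.2 /
      γ q.2 ^ (m + 1)) (Icc (1 / 2 : ℝ) 1 ×ˢ Icc 0 L) := by
    have hsnd : ∀ f : ℝ → ℂ, ContinuousOn f (Icc 0 L) →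
        ContinuousOn (fun q : ℝ × ℝ => f q.2) (Icc (1 / 2 : ℝ) 1 ×ˢ Icc 0 L) :=
      fun f hf => hf.comp continuousOn_snd fun q hq => hq.2
    refine ContinuousOn.div (ContinuousOn.mul ?_ (hsnd _ hc)) ((hsnd _ hγ).pow _)
      fun q hq => pow_ne_zero _ (hne _ hq.2)
    have hb : ContinuousOn (fun q : ℝ × ℝ => 1 + q.1 * γ q.2)
        (Icc (1 / 2 : ℝ) 1 ×ˢ Icc 0 L) :=
      continuousOn_const.add
        ((Complex.continuous_ofReal.comp continuous_fst).continuousOn.mul (hsnd _ hγ))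
    intro q hq
    refine ContinuousAt.comp_continuousWithinAt (g := fun z : ℂ => z ^ (a : ℂ))
      (Complex.continuousAt_cpow_const_of_re_pos ?_ (by simpa using ha)) (hb q hq)
    obtain ⟨⟨ht, ht1⟩, hφ, hφ1⟩ := hq
    rcases eq_or_lt_of_le hφ with h2 | h2
    · obtain ⟨u, hu, h0⟩ := h0
      left
      rw [← h2, h0]
      simp only [Complex.add_re, Complex.one_re, Complex.mul_re, Complex.ofReal_re,
        Complex.ofReal_im]
      nlinarith
    rcases eq_or_lt_of_le hφ1 with h3 | h3
    · left
      rw [h3, h1]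
      simpa using ht1
    · right
      have := mul_pos (by linarith : 0 < q.1) (him q.2 ⟨h2, h3⟩)
      simpa using ⟨by linarith, (him q.2 ⟨h2, h3⟩).ne'⟩
  have hval : ∀ t ∈ Ioo (0 : ℝ) 1,
      (∫ φ in (0 : ℝ)..L, (1 + t * γ φ) ^ (a : ℂ) * γ' φ / γ φ ^ (m + 1)).im = t ^ m * C := by
    intro t ht
    rw [show C = _ from ((harc t ht).im_integral_cpow_mul_zpow a m).symm, ← Complex.im_ofReal_mul,
      ← intervalIntegral.integral_const_mul]
    congr 2
    ext φ
    have : (t : ℂ) ≠ 0 := by exact_mod_cast ht.1.ne'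
    push_cast
    rw [mul_pow]
    field_simp
    ring
  obtain ⟨M, hM⟩ := (isCompact_Icc.prod isCompact_Icc).exists_bound_of_continuousOn hcont
  have hev : ∀ᶠ t in 𝓝[<] (1 : ℝ), t ∈ Ioo (1 / 2 : ℝ) 1 :=
    Ioo_mem_nhdsLT (by norm_num)
  have hlim : Tendsto (fun t : ℝ => ∫ φ in (0 : ℝ)..L,
      (1 + t * γ φ) ^ (a : ℂ) * γ' φ / γ φ ^ (m + 1)) (𝓝[<] 1)
      (𝓝 (∫ φ in (0 : ℝ)..L, (1 + γ φ) ^ (a : ℂ) * γ' φ / γ φ ^ (m + 1))) := by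
    apply intervalIntegral.tendsto_integral_filter_of_dominated_convergence (fun _ => M)
    · filter_upwards [hev] with t ht
      rw [uIoc_of_le hL.le]
      refine ContinuousOn.aestronglyMeasurable (ContinuousOn.mono ?_ Ioc_subset_Icc_self)
        measurableSet_Ioc
      exact hcont.comp (f := fun φ : ℝ => (t, φ)) (by fun_prop)
        fun φ hφ => ⟨Ioo_subset_Icc_self ht, hφ⟩
    · filter_upwards [hev] with t ht
      refine Eventually.of_forall fun φ hφ => ?_
      rw [uIoc_of_le hL.le] at hφ
      exact hM (t, φ) ⟨Ioo_subset_Icc_self ht, Ioc_subset_Icc_self hφ⟩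
    · exact intervalIntegrable_const
    · refine Eventually.of_forall fun φ hφ => ?_
      rw [uIoc_of_le hL.le] at hφ
      have h2 := (hcont.comp (f := fun t : ℝ => (t, φ)) (by fun_prop)
        fun t ht => ⟨ht, Ioc_subset_Icc_self hφ⟩) 1 (by norm_num)
      have h3 := h2.tendsto.mono_left (nhdsWithin_le_of_mem
        (mem_of_superset hev Ioo_subset_Icc_self))
      simpa [Function.comp_def] using h3
  have hlim2 : Tendsto (fun t : ℝ => t ^ m * C) (𝓝[<] 1) (𝓝 (1 ^ m * C)) :=
    ((continuous_id.pow m).mul continuous_const).continuousWithinAt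
  have hlim3 := ((Complex.continuous_im.tendsto _).comp hlim).congr' (f₂ := fun t => t ^ m * C) (by
    filter_upwards [hev] with t ht
    exact hval t ⟨by linarith [ht.1], ht.2⟩)
  simpa using tendsto_nhds_unique hlim3 hlim2

lemma contDiff_sinc : ContDiff ℝ 1 sinc := by
  rw [contDiff_iff_contDiffAt]
  intro x
  by_cases hx : x = 0
  · subst hx
    obtain ⟨q, hq⟩ := (Real.analyticAt_sin : AnalyticAt ℝ Real.sin 0)
    rw [sinc_eq_dslope]
    exact (AnalyticAt.contDiffAt ⟨_, hq.has_fpower_series_dslope_fslope⟩)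
  · have h : (fun y => sin y / y) =ᶠ[𝓝 x] sinc := by
      filter_upwards [isOpen_ne.mem_nhds hx] with y hy
      rw [sinc_of_ne_zero hy]
    exact ((contDiff_sin.contDiffAt).div contDiffAt_id hx).congr_of_eventuallyEq h.symm

lemma sinc_pos {x : ℝ} (h0 : 0 ≤ x) (h1 : x < π) : 0 < sinc x := by
  rcases eq_or_lt_of_le h0 with h | h
  · simp [← h]
  · rw [sinc_of_ne_zero h.ne']
    exact div_pos (sin_pos_of_pos_of_lt_pi h h1) h

/-- The modulus of the arc parametrising the support of the Raney distribution. -/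
noncomputable def raneyModulus (p φ : ℝ) : ℝ := sinc φ / ((p - 1) * sinc ((p - 1) * φ))

/-- The modulus of `1 + w` along the arc `w` parametrising the support of the Raney
distribution. -/
noncomputable def raneyRadius (p φ : ℝ) : ℝ := p * sinc (p * φ) / ((p - 1) * sinc ((p - 1) * φ))

/-- The arc `w` on which `(1 + w) ^ p / w` is positive. -/
noncomputable def raneyArc (p φ : ℝ) : ℂ :=
  (raneyModulus p φ : ℂ) * Complex.exp ((p * φ : ℝ) * Complex.I)

/-- The logarithmic derivative of `raneyModulus`. -/
noncomputable def raneyModulusLogDeriv (p φ : ℝ) : ℝ :=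
  cos φ / sin φ - (p - 1) * (cos ((p - 1) * φ) / sin ((p - 1) * φ))

/-- The logarithmic derivative of `raneyRadius`. -/
noncomputable def raneyRadiusLogDeriv (p φ : ℝ) : ℝ :=
  p * (cos (p * φ) / sin (p * φ)) - (p - 1) * (cos ((p - 1) * φ) / sin ((p - 1) * φ))

section RaneyArc

variable {p φ : ℝ}

lemma sub_one_mul_lt_pi (hp : 1 < p) (hφ : φ ∈ Icc 0 (π / p)) : (p - 1) * φ < π := by
  have h0 : 0 < p := by linarith
  have h1 : φ * p ≤ π := (le_div_iff₀ h0).1 hφ.2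
  rcases eq_or_lt_of_le hφ.1 with h | h
  · rw [← h, mul_zero]
    exact pi_pos
  · nlinarith

lemma lt_pi_of_mem_Icc (hp : 1 < p) (hφ : φ ∈ Icc 0 (π / p)) : φ < π :=
  hφ.2.trans_lt (div_lt_self pi_pos hp)

lemma mul_lt_pi_of_mem_Ioo (hp : 1 < p) (hφ : φ ∈ Ioo 0 (π / p)) : p * φ < π := by
  rw [mul_comm]
  exact (lt_div_iff₀ (by linarith)).1 hφ.2

lemma raney_denom_pos (hp : 1 < p) (hφ : φ ∈ Icc 0 (π / p)) :
    0 < (p - 1) * sinc ((p - 1) * φ) :=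
  mul_pos (by linarith) (sinc_pos (mul_nonneg (by linarith) hφ.1) (sub_one_mul_lt_pi hp hφ))

lemma raneyModulus_pos (hp : 1 < p) (hφ : φ ∈ Icc 0 (π / p)) : 0 < raneyModulus p φ :=
  div_pos (sinc_pos hφ.1 (lt_pi_of_mem_Icc hp hφ)) (raney_denom_pos hp hφ)

lemma sin_pos_of_mem_Ioo (hp : 1 < p) (hφ : φ ∈ Ioo 0 (π / p)) :
    0 < sin φ ∧ 0 < sin ((p - 1) * φ) ∧ 0 < sin (p * φ) :=
  ⟨sin_pos_of_pos_of_lt_pi hφ.1 (lt_pi_of_mem_Icc hp (Ioo_subset_Icc_self hφ)),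
    sin_pos_of_pos_of_lt_pi (mul_pos (by linarith) hφ.1)
      (sub_one_mul_lt_pi hp (Ioo_subset_Icc_self hφ)),
    sin_pos_of_pos_of_lt_pi (mul_pos (by linarith) hφ.1) (mul_lt_pi_of_mem_Ioo hp hφ)⟩

lemma raneyModulus_eq (hp : 1 < p) (hφ : 0 < φ) :
    raneyModulus p φ = sin φ / sin ((p - 1) * φ) := by
  have hk : 0 < p - 1 := by linarith
  rw [raneyModulus, sinc_of_ne_zero hφ.ne', sinc_of_ne_zero (by positivity)]
  field_simp

lemma raneyRadius_eq (hp : 1 < p) (hφ : 0 < φ) :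
    raneyRadius p φ = sin (p * φ) / sin ((p - 1) * φ) := by
  have hk : 0 < p - 1 := by linarith
  have h0 : 0 < p := by linarith
  rw [raneyRadius, sinc_of_ne_zero (by positivity), sinc_of_ne_zero (by positivity)]
  field_simp

lemma raneyRadius_pos (hp : 1 < p) (hφ : φ ∈ Ioo 0 (π / p)) : 0 < raneyRadius p φ := by
  rw [raneyRadius_eq hp hφ.1]
  exact div_pos (sin_pos_of_mem_Ioo hp hφ).2.2 (sin_pos_of_mem_Ioo hp hφ).2.1

lemma raneyRadius_pi_div (hp : 1 < p) : raneyRadius p (π / p) = 0 := by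
  have h0 : p ≠ 0 := by linarith
  rw [raneyRadius, mul_div_cancel₀ _ h0, sinc_of_ne_zero pi_ne_zero, sin_pi]
  simp

lemma continuousOn_raneyModulus (hp : 1 < p) :
    ContinuousOn (raneyModulus p) (Icc 0 (π / p)) :=
  continuous_sinc.continuousOn.div (by fun_prop) fun _ hφ => (raney_denom_pos hp hφ).ne'

lemma continuousOn_raneyRadius (hp : 1 < p) :
    ContinuousOn (raneyRadius p) (Icc 0 (π / p)) :=
  ContinuousOn.div (by fun_prop) (by fun_prop) fun _ hφ => (raney_denom_pos hp hφ).ne'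

lemma hasDerivAt_raneyModulus (hp : 1 < p) (hφ : φ ∈ Ioo 0 (π / p)) :
    HasDerivAt (raneyModulus p) (raneyModulus p φ * raneyModulusLogDeriv p φ) φ := by
  obtain ⟨h1, h2, -⟩ := sin_pos_of_mem_Ioo hp hφ
  have hd := (hasDerivAt_sin φ).fun_div (((hasDerivAt_id' φ).const_mul (p - 1)).sin) h2.ne'
  refine (hd.congr_of_eventuallyEq ?_).congr_deriv ?_
  · filter_upwards [isOpen_Ioi.mem_nhds hφ.1] with x hx using raneyModulus_eq hp hx
  · rw [raneyModulus_eq hp hφ.1, raneyModulusLogDeriv]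
    field_simp

lemma hasDerivAt_raneyRadius (hp : 1 < p) (hφ : φ ∈ Ioo 0 (π / p)) :
    HasDerivAt (raneyRadius p) (raneyRadius p φ * raneyRadiusLogDeriv p φ) φ := by
  obtain ⟨-, h2, h3⟩ := sin_pos_of_mem_Ioo hp hφ
  have hd := (((hasDerivAt_id' φ).const_mul p).sin).fun_div
    (((hasDerivAt_id' φ).const_mul (p - 1)).sin) h2.ne'
  refine (hd.congr_of_eventuallyEq ?_).congr_deriv ?_
  · filter_upwards [isOpen_Ioi.mem_nhds hφ.1] with x hx using raneyRadius_eq hp hx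
  · rw [raneyRadius_eq hp hφ.1, raneyRadiusLogDeriv]
    generalize sin ((p - 1) * φ) = s at *
    field_simp

lemma contDiffOn_raneyArc (hp : 1 < p) :
    ContDiffOn ℝ 1 (raneyArc p) {φ | sinc ((p - 1) * φ) ≠ 0} := by
  have hv : ContDiffOn ℝ 1 (raneyModulus p) {φ | sinc ((p - 1) * φ) ≠ 0} := by
    refine ContDiffOn.div contDiff_sinc.contDiffOn ?_ fun φ hφ => mul_ne_zero (by linarith) hφ
    exact (contDiff_const.mul
      (contDiff_sinc.comp (contDiff_const.mul contDiff_id))).contDiffOn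
  refine ContDiffOn.mul (Complex.ofRealCLM.contDiff.comp_contDiffOn hv) ?_
  exact (((Complex.ofRealCLM.contDiff.comp (contDiff_const.mul contDiff_id)).mul
    contDiff_const).cexp).contDiffOn

lemma isOpen_raney_domain : IsOpen {φ | sinc ((p - 1) * φ) ≠ 0} :=
  isOpen_ne.preimage (by fun_prop : Continuous fun φ => sinc ((p - 1) * φ))

lemma Icc_subset_raney_domain (hp : 1 < p) :
    Icc 0 (π / p) ⊆ {φ | sinc ((p - 1) * φ) ≠ 0} :=
  fun _ hφ => right_ne_zero_of_mul (raney_denom_pos hp hφ).ne'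

lemma hasDerivAt_raneyArc_deriv (hp : 1 < p) (hφ : φ ∈ Icc 0 (π / p)) :
    HasDerivAt (raneyArc p) (deriv (raneyArc p) φ) φ :=
  (((contDiffOn_raneyArc hp).differentiableOn one_ne_zero).differentiableAt
    (isOpen_raney_domain.mem_nhds (Icc_subset_raney_domain hp hφ))).hasDerivAt

lemma continuousOn_deriv_raneyArc (hp : 1 < p) :
    ContinuousOn (deriv (raneyArc p)) (Icc 0 (π / p)) :=
  ((contDiffOn_raneyArc hp).continuousOn_deriv_of_isOpen isOpen_raney_domain le_rfl).mono
    (Icc_subset_raney_domain hp)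

lemma deriv_raneyArc (hp : 1 < p) (hφ : φ ∈ Ioo 0 (π / p)) :
    deriv (raneyArc p) φ = raneyArc p φ * (raneyModulusLogDeriv p φ + p * Complex.I) := by
  have h1 := (hasDerivAt_raneyModulus hp hφ).ofReal_comp
  have h2 : HasDerivAt (fun φ : ℝ => Complex.exp ((p * φ : ℝ) * Complex.I))
      (Complex.exp ((p * φ : ℝ) * Complex.I) * ((p * 1 : ℝ) * Complex.I)) φ :=
    ((((hasDerivAt_id' φ).const_mul p).ofReal_comp).mul_const Complex.I).cexp
  rw [HasDerivAt.deriv (f := raneyArc p) (h1.mul h2), raneyArc]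
  push_cast
  ring

lemma raneyArc_zero : raneyArc p 0 = ((1 / (p - 1) : ℝ) : ℂ) := by
  simp [raneyArc, raneyModulus]

lemma raneyArc_pi_div (hp : 1 < p) : raneyArc p (π / p) = -1 := by
  have h0 : p ≠ 0 := by linarith
  have h1 : 0 < π / p := div_pos pi_pos (by linarith)
  have h2 : sin (π / p) ≠ 0 :=
    (sin_pos_of_pos_of_lt_pi h1 (div_lt_self pi_pos hp)).ne'
  have h3 : (p - 1) * (π / p) = π - π / p := by field_simp
  rw [raneyArc, raneyModulus_eq hp h1, h3, sin_pi_sub, div_self h2, mul_div_cancel₀ _ h0,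
    Complex.exp_pi_mul_I]
  simp

lemma raneyArc_im_pos (hp : 1 < p) (hφ : φ ∈ Ioo 0 (π / p)) : 0 < (raneyArc p φ).im := by
  rw [raneyArc, Complex.im_ofReal_mul, Complex.exp_ofReal_mul_I_im]
  exact mul_pos (raneyModulus_pos hp (Ioo_subset_Icc_self hφ)) (sin_pos_of_mem_Ioo hp hφ).2.2

lemma one_add_raneyArc (hp : 1 < p) (hφ : φ ∈ Ioo 0 (π / p)) :
    1 + raneyArc p φ = raneyRadius p φ * Complex.exp (φ * Complex.I) := by
  have h2 := (sin_pos_of_mem_Ioo hp hφ).2.1.ne'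
  have h3 : (p - 1) * φ = p * φ - φ := by ring
  rw [raneyArc, raneyModulus_eq hp hφ.1, raneyRadius_eq hp hφ.1]
  apply Complex.ext
  · rw [Complex.add_re, Complex.re_ofReal_mul, Complex.re_ofReal_mul,
      Complex.exp_ofReal_mul_I_re, Complex.exp_ofReal_mul_I_re, Complex.one_re]
    field_simp
    rw [h3, sin_sub]
    ring
  · rw [Complex.add_im, Complex.im_ofReal_mul, Complex.im_ofReal_mul,
      Complex.exp_ofReal_mul_I_im, Complex.exp_ofReal_mul_I_im, Complex.one_im]
    ring

lemma one_add_raneyArc_cpow (hp : 1 < p) (hφ : φ ∈ Ioo 0 (π / p)) (a : ℝ) :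
    (1 + raneyArc p φ) ^ (a : ℂ) =
      (raneyRadius p φ ^ a : ℝ) * Complex.exp ((a * φ : ℝ) * Complex.I) := by
  have hb := raneyRadius_pos hp hφ
  have hb' : (raneyRadius p φ : ℂ) ≠ 0 := by exact_mod_cast hb.ne'
  have hlt := lt_pi_of_mem_Icc hp (Ioo_subset_Icc_self hφ)
  rw [one_add_raneyArc hp hφ, Complex.cpow_def_of_ne_zero
    (mul_ne_zero hb' (Complex.exp_ne_zero _)), Complex.log_ofReal_mul hb (Complex.exp_ne_zero _),
    Complex.log_exp (by simp; linarith [hφ.1, pi_pos]) (by simpa using hlt.le),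
    rpow_def_of_pos hb, Complex.ofReal_exp, ← Complex.exp_add]
  congr 1
  push_cast
  ring

lemma im_raneyArc_integrand (hp : 1 < p) (hφ : φ ∈ Ioo 0 (π / p)) (r : ℝ) (m : ℕ) :
    ((1 + raneyArc p φ) ^ ((m * p + r : ℝ) : ℂ) * deriv (raneyArc p) φ /
      raneyArc p φ ^ (m + 1)).im =
      raneyRadius p φ ^ (m * p + r) / raneyModulus p φ ^ m *
        (raneyModulusLogDeriv p φ * sin (r * φ) + p * cos (r * φ)) := by
  have hv := raneyModulus_pos hp (Ioo_subset_Icc_self hφ)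
  have hv' : (raneyModulus p φ : ℂ) ≠ 0 := by exact_mod_cast hv.ne'
  have hne : raneyArc p φ ≠ 0 := mul_ne_zero hv' (Complex.exp_ne_zero _)
  have hexp : Complex.exp (((m * p + r) * φ : ℝ) * Complex.I) =
      Complex.exp ((r * φ : ℝ) * Complex.I) * Complex.exp ((p * φ : ℝ) * Complex.I) ^ m := by
    rw [← Complex.exp_nat_mul, ← Complex.exp_add]
    congr 1
    push_cast
    ring
  have : (1 + raneyArc p φ) ^ ((m * p + r : ℝ) : ℂ) * deriv (raneyArc p) φ /
      raneyArc p φ ^ (m + 1) =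
      (raneyRadius p φ ^ (m * p + r) / raneyModulus p φ ^ m : ℝ) *
        (Complex.exp ((r * φ : ℝ) * Complex.I) * (raneyModulusLogDeriv p φ + p * Complex.I)) := by
    rw [one_add_raneyArc_cpow hp hφ, deriv_raneyArc hp hφ, hexp, pow_succ]
    have h1 : raneyArc p φ ^ m =
        (raneyModulus p φ : ℂ) ^ m * Complex.exp ((p * φ : ℝ) * Complex.I) ^ m := by
      rw [raneyArc, mul_pow]
    rw [h1]
    have hE := Complex.exp_ne_zero ((p * φ : ℝ) * Complex.I)
    generalize Complex.exp ((p * φ : ℝ) * Complex.I) = e at *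
    push_cast
    field_simp
  rw [this, Complex.im_ofReal_mul, Complex.mul_im, Complex.exp_ofReal_mul_I_re,
    Complex.exp_ofReal_mul_I_im]
  simp only [Complex.add_re, Complex.add_im, Complex.mul_re, Complex.mul_im, Complex.I_re,
    Complex.I_im, Complex.ofReal_re, Complex.ofReal_im]
  ring

end RaneyArc

section RaneyMeasure

variable {p r φ : ℝ}

/-- The support parametrisation: the value `(1 + w) ^ p / w` along the arc. -/
noncomputable def raneyPoint (p φ : ℝ) : ℝ := raneyRadius p φ ^ p / raneyModulus p φ

/-- The density of the Raney distribution in the angular parameter. -/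
noncomputable def raneyDensity (p r φ : ℝ) : ℝ :=
  raneyRadius p φ ^ r * sin (r * φ) * (raneyModulusLogDeriv p φ - p * raneyRadiusLogDeriv p φ) / π

lemma raneyModulusLogDeriv_sub_nonneg (hp : 1 < p) (hφ : φ ∈ Ioo 0 (π / p)) :
    0 ≤ raneyModulusLogDeriv p φ - p * raneyRadiusLogDeriv p φ := by
  obtain ⟨h1, h2, h3⟩ := sin_pos_of_mem_Ioo hp hφ
  have hs : sin (p * φ) = sin φ * cos ((p - 1) * φ) + cos φ * sin ((p - 1) * φ) := by
    rw [← sin_add]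
    ring_nf
  have hc : cos (p * φ) = cos φ * cos ((p - 1) * φ) - sin φ * sin ((p - 1) * φ) := by
    rw [← cos_add]
    ring_nf
  have hq1 := sin_sq_add_cos_sq φ
  have hq2 := sin_sq_add_cos_sq ((p - 1) * φ)
  have hle := cos_le_one (p * φ)
  have hk : 0 < p - 1 := by linarith
  have key : raneyModulusLogDeriv p φ - p * raneyRadiusLogDeriv p φ =
      (sin ((p - 1) * φ) ^ 2 + (p - 1) ^ 2 * sin φ ^ 2 -
        2 * (p - 1) * cos (p * φ) * (sin φ * sin ((p - 1) * φ))) /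
        (sin φ * sin ((p - 1) * φ) * sin (p * φ)) := by
    rw [raneyModulusLogDeriv, raneyRadiusLogDeriv]
    generalize sin (p * φ) = S at *
    generalize cos (p * φ) = cS at *
    generalize sin ((p - 1) * φ) = K at *
    generalize cos ((p - 1) * φ) = cK at *
    generalize sin φ = T at *
    generalize cos φ = cT at *
    rw [eq_div_iff (by positivity)]
    field_simp
    subst hs hc
    linear_combination K ^ 2 * hq1 + (p - 1) ^ 2 * T ^ 2 * hq2
  rw [key]
  refine div_nonneg ?_ (by positivity)
  nlinarith [sq_nonneg (sin ((p - 1) * φ) - (p - 1) * sin φ),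
    mul_nonneg (mul_pos hk (mul_pos h1 h2)).le (sub_nonneg.2 hle)]

lemma raneyDensity_nonneg (hp : 1 < p) (hr0 : 0 < r) (hrp : r ≤ p) (hφ : φ ∈ Ioo 0 (π / p)) :
    0 ≤ raneyDensity p r φ := by
  have h : r * φ ≤ p * φ := mul_le_mul_of_nonneg_right hrp hφ.1.le
  have hs : 0 < sin (r * φ) :=
    sin_pos_of_pos_of_lt_pi (mul_pos hr0 hφ.1) (h.trans_lt (mul_lt_pi_of_mem_Ioo hp hφ))
  exact div_nonneg (mul_nonneg (mul_nonneg (rpow_nonneg (raneyRadius_pos hp hφ).le _) hs.le)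
    (raneyModulusLogDeriv_sub_nonneg hp hφ)) pi_pos.le

lemma mul_sin_le_sin_mul {t x : ℝ} (ht0 : 0 ≤ t) (ht1 : t ≤ 1) (hx0 : 0 ≤ x) (hx1 : x ≤ π) :
    t * sin x ≤ sin (t * x) := by
  have := strictConcaveOn_sin_Icc.concaveOn.2 (x := 0) (y := x) (by simp [pi_pos.le]) ⟨hx0, hx1⟩
    (sub_nonneg.2 ht1) ht0 (by ring)
  simpa using this

lemma raneyPoint_nonneg (hp : 1 < p) (hφ : φ ∈ Ioo 0 (π / p)) : 0 ≤ raneyPoint p φ :=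
  div_nonneg (rpow_nonneg (raneyRadius_pos hp hφ).le _)
    (raneyModulus_pos hp (Ioo_subset_Icc_self hφ)).le

lemma raneyPoint_le (hp : 1 < p) (hφ : φ ∈ Ioo 0 (π / p)) : raneyPoint p φ ≤ cRaney p := by
  obtain ⟨h1, h2, h3⟩ := sin_pos_of_mem_Ioo hp hφ
  have h0 : 0 < p := by linarith
  have hk : 0 < p - 1 := by linarith
  have hb := raneyRadius_pos hp hφ
  have hv := raneyModulus_pos hp (Ioo_subset_Icc_self hφ)
  have hle := (mul_lt_pi_of_mem_Ioo hp hφ).le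
  have hnn : 0 ≤ p * φ := (mul_pos h0 hφ.1).le
  have e1 : sin (p * φ) ≤ p * sin φ := by
    have := mul_sin_le_sin_mul (t := 1 / p) (by positivity) ((div_le_one h0).2 hp.le) hnn hle
    rw [show 1 / p * (p * φ) = φ by field_simp] at this
    field_simp at this
    linarith
  have e2 : (p - 1) * sin (p * φ) ≤ p * sin ((p - 1) * φ) := by
    have := mul_sin_le_sin_mul (t := (p - 1) / p) (by positivity)
      ((div_le_one h0).2 (by linarith)) hnn hle
    rw [show (p - 1) / p * (p * φ) = (p - 1) * φ by field_simp, div_mul_eq_mul_div,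
      div_le_iff₀ h0] at this
    linarith
  have hbv : raneyRadius p φ / raneyModulus p φ ≤ p := by
    rw [raneyRadius_eq hp hφ.1, raneyModulus_eq hp hφ.1, div_div_div_cancel_right₀ h2.ne',
      div_le_iff₀ h1]
    exact e1
  have hb1 : raneyRadius p φ ≤ p / (p - 1) := by
    rw [raneyRadius_eq hp hφ.1, div_le_div_iff₀ h2 hk]
    linarith
  calc raneyPoint p φ
      = raneyRadius p φ ^ (p - 1) * (raneyRadius p φ / raneyModulus p φ) := by
        rw [raneyPoint, rpow_sub_one hb.ne']
        field_simp
    _ ≤ (p / (p - 1)) ^ (p - 1) * p := by gcongr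
    _ = cRaney p := by
        rw [cRaney, div_rpow h0.le hk.le, rpow_sub_one h0.ne', ← neg_sub p 1, rpow_neg hk.le]
        field_simp

lemma hasDerivAt_raney_boundary (hp : 1 < p) (r : ℝ) (m : ℕ) (hφ : φ ∈ Ioo 0 (π / p)) :
    HasDerivAt
      (fun φ => raneyRadius p φ ^ (m * p + r) / raneyModulus p φ ^ m * sin (r * φ))
      (raneyRadius p φ ^ (m * p + r) / raneyModulus p φ ^ m *
        (((m * p + r) * raneyRadiusLogDeriv p φ - m * raneyModulusLogDeriv p φ) * sin (r * φ) +
          r * cos (r * φ))) φ := by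
  have hb := raneyRadius_pos hp hφ
  have hv := raneyModulus_pos hp (Ioo_subset_Icc_self hφ)
  have h1 := (hasDerivAt_raneyRadius hp hφ).rpow_const (p := m * p + r) (Or.inl hb.ne')
  have h2 := (hasDerivAt_raneyModulus hp hφ).fun_pow m
  have h3 := ((hasDerivAt_id' φ).const_mul r).sin
  refine ((h1.fun_div h2 (by positivity)).fun_mul h3).congr_deriv ?_
  rw [rpow_sub_one hb.ne']
  rcases m with _ | m
  · simp
    field_simp
  · push_cast
    field_simp
    ring

lemma raneyPoint_pow_mul_radius_rpow (hp : 1 < p) (r : ℝ) (m : ℕ) (hφ : φ ∈ Ioo 0 (π / p)) :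
    raneyPoint p φ ^ m * raneyRadius p φ ^ r =
      raneyRadius p φ ^ (m * p + r) / raneyModulus p φ ^ m := by
  have hb := raneyRadius_pos hp hφ
  rw [raneyPoint, div_pow, rpow_add hb, mul_comm (m : ℝ), rpow_mul_natCast hb.le]
  ring

lemma raneyPoint_pow_mul_density (hp : 1 < p) (r : ℝ) (m : ℕ) (hφ : φ ∈ Ioo 0 (π / p)) :
    (m * p + r) * π * (raneyPoint p φ ^ m * raneyDensity p r φ) =
      r * ((1 + raneyArc p φ) ^ ((m * p + r : ℝ) : ℂ) * deriv (raneyArc p) φ /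
        raneyArc p φ ^ (m + 1)).im -
      p * (raneyRadius p φ ^ (m * p + r) / raneyModulus p φ ^ m *
        (((m * p + r) * raneyRadiusLogDeriv p φ - m * raneyModulusLogDeriv p φ) * sin (r * φ) +
          r * cos (r * φ))) := by
  rw [im_raneyArc_integrand hp hφ, ← raneyPoint_pow_mul_radius_rpow hp r m hφ, raneyDensity]
  have := pi_ne_zero
  field_simp
  ring

end RaneyMeasure

section RaneyMoments

variable {p r : ℝ}

lemma continuousOn_raneyArc_integrand (hp : 1 < p) {a : ℝ} (ha : 0 < a) (m : ℕ) :
    ContinuousOn (fun φ => (1 + raneyArc p φ) ^ (a : ℂ) * deriv (raneyArc p) φ /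
      raneyArc p φ ^ (m + 1)) (Icc 0 (π / p)) := by
  have hw : ContinuousOn (raneyArc p) (Icc 0 (π / p)) :=
    fun φ hφ => (hasDerivAt_raneyArc_deriv hp hφ).continuousAt.continuousWithinAt
  refine ContinuousOn.div (ContinuousOn.mul ?_ (continuousOn_deriv_raneyArc hp)) (hw.pow _)
    fun φ hφ => pow_ne_zero _ (mul_ne_zero (by exact_mod_cast (raneyModulus_pos hp hφ).ne')
      (Complex.exp_ne_zero _))
  intro φ hφ
  refine ContinuousAt.comp_continuousWithinAt (g := fun z : ℂ => z ^ (a : ℂ))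
    (Complex.continuousAt_cpow_const_of_re_pos ?_ (by simpa using ha))
    ((continuousOn_const.add hw) φ hφ)
  rcases eq_or_lt_of_le hφ.1 with h2 | h2
  · left
    have : 0 < 1 / (p - 1) := one_div_pos.2 (by linarith)
    rw [← h2, raneyArc_zero, Complex.add_re, Complex.one_re, Complex.ofReal_re]
    linarith
  rcases eq_or_lt_of_le hφ.2 with h3 | h3
  · left
    simp [h3, raneyArc_pi_div hp]
  · right
    simpa using (raneyArc_im_pos hp ⟨h2, h3⟩).ne'

lemma integral_im_raneyArc_integrand (hp : 1 < p) {a : ℝ} (ha : 0 < a) (m : ℕ) :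
    ∫ φ in (0 : ℝ)..(π / p), ((1 + raneyArc p φ) ^ (a : ℂ) * deriv (raneyArc p) φ /
      raneyArc p φ ^ (m + 1)).im = π * (∏ i ∈ Finset.range m, (a - i)) / m.factorial := by
  have hL : 0 < π / p := div_pos pi_pos (by linarith)
  rw [← im_integral_cpow_mul_zpow_of_finish_neg_one hL
    (fun φ hφ => hasDerivAt_raneyArc_deriv hp hφ) (continuousOn_deriv_raneyArc hp)
    ⟨1 / (p - 1), one_div_pos.2 (by linarith), raneyArc_zero⟩ (raneyArc_pi_div hp)
    (fun φ hφ => raneyArc_im_pos hp hφ) ha m]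
  exact Complex.imCLM.intervalIntegral_comp_comm
    ((continuousOn_raneyArc_integrand hp ha m).intervalIntegrable_of_Icc hL.le)

lemma integral_raneyPoint_pow_mul_density (hp : 1 < p) (hr0 : 0 < r) (hrp : r ≤ p) (m : ℕ) :
    ∫ φ in (0 : ℝ)..(π / p), raneyPoint p φ ^ m * raneyDensity p r φ =
      r / (m * p + r) * ((∏ i ∈ Finset.range m, (m * p + r - i)) / m.factorial) := by
  have hL : 0 < π / p := div_pos pi_pos (by linarith)
  have h0 : p ≠ 0 := by linarith
  have ha : 0 < m * p + r := by positivity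
  set F : ℝ → ℝ := fun φ => ((1 + raneyArc p φ) ^ ((m * p + r : ℝ) : ℂ) *
    deriv (raneyArc p) φ / raneyArc p φ ^ (m + 1)).im with hF
  set E : ℝ → ℝ := fun φ =>
    raneyRadius p φ ^ (m * p + r) / raneyModulus p φ ^ m * sin (r * φ) with hE
  have hFc : ContinuousOn F (Icc 0 (π / p)) :=
    Complex.continuous_im.comp_continuousOn (continuousOn_raneyArc_integrand hp ha m)
  have hEc : ContinuousOn E (Icc 0 (π / p)) := by
    refine ContinuousOn.mul (ContinuousOn.div ?_ ((continuousOn_raneyModulus hp).pow m)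
      fun φ hφ => pow_ne_zero _ (raneyModulus_pos hp hφ).ne') (by fun_prop)
    exact (continuousOn_raneyRadius hp).rpow_const fun φ hφ => Or.inr ha.le
  have hFi := hFc.intervalIntegrable_of_Icc (μ := volume) hL.le
  have hD : ContinuousOn (fun φ => r * (∫ t in (0 : ℝ)..φ, F t) - p * E φ) (Icc 0 (π / p)) := by
    refine (continuousOn_const.mul ?_).sub (continuousOn_const.mul hEc)
    have := intervalIntegral.continuousOn_primitive_interval
      ((intervalIntegrable_iff' (by simp)).1 hFi)
    rwa [uIcc_of_le hL.le] at this
  have hD' : ∀ φ ∈ Ioo 0 (π / p),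
      HasDerivAt (fun φ => r * (∫ t in (0 : ℝ)..φ, F t) - p * E φ)
        ((m * p + r) * π * (raneyPoint p φ ^ m * raneyDensity p r φ)) φ := by
    intro φ hφ
    rw [raneyPoint_pow_mul_density hp r m hφ]
    have hFo : ContinuousOn F (Ioo 0 (π / p)) := hFc.mono Ioo_subset_Icc_self
    refine HasDerivAt.sub (HasDerivAt.const_mul _ ?_)
      ((hasDerivAt_raney_boundary hp r m hφ).const_mul _)
    refine intervalIntegral.integral_hasDerivAt_right ?_
      (hFo.stronglyMeasurableAtFilter isOpen_Ioo φ hφ) (hFo.continuousAt (isOpen_Ioo.mem_nhds hφ))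
    exact (hFc.mono (Icc_subset_Icc_right hφ.2.le)).intervalIntegrable_of_Icc hφ.1.le
  have hi := intervalIntegral.integrableOn_deriv_of_nonneg hD hD' fun φ hφ =>
    mul_nonneg (mul_pos ha pi_pos).le
      (mul_nonneg (pow_nonneg (raneyPoint_nonneg hp hφ) m) (raneyDensity_nonneg hp hr0 hrp hφ))
  have h1 := intervalIntegral.integral_eq_sub_of_hasDerivAt_of_le hL.le hD hD'
    ((intervalIntegrable_iff_integrableOn_Ioc_of_le hL.le).2 hi)
  have hE0 : E 0 = 0 := by simp [hE]
  have hE1 : E (π / p) = 0 := by simp [hE, raneyRadius_pi_div hp, zero_rpow ha.ne']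
  rw [intervalIntegral.integral_const_mul, hE0, hE1, intervalIntegral.integral_same,
    integral_im_raneyArc_integrand hp ha m] at h1
  have := pi_ne_zero
  field_simp at h1 ⊢
  refine mul_left_cancel₀ this ?_
  linear_combination h1

lemma raney_eq (hp : 0 ≤ p) (hr0 : 0 < r) (m : ℕ) :
    raney p r m = r / (m * p + r) * ((∏ i ∈ Finset.range m, (m * p + r - i)) / m.factorial) := by
  rcases m with _ | m
  · simp [raney, hr0.ne']
  · have ha : (m + 1 : ℕ) * p + r ≠ 0 := by positivity
    rw [raney, Finset.prod_range_succ', ← Finset.Ico_add_one_right_eq_Icc,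
      Finset.prod_Ico_eq_prod_range, add_tsub_cancel_right]
    push_cast at ha ⊢
    simp only [add_comm (1 : ℝ)]
    field_simp
    ring

end RaneyMoments

section MomentProblem

lemma exists_isProbabilityMeasure_of_density {L c : ℝ} (hL : 0 ≤ L) {x d : ℝ → ℝ} {A : ℕ → ℝ}
    (hx : Measurable x) (hd : Measurable d) (hd0 : ∀ φ ∈ Ioo 0 L, 0 ≤ d φ)
    (hx0 : ∀ φ ∈ Ioo 0 L, x φ ∈ Icc 0 c) (hA0 : A 0 = 1)
    (hA : ∀ m, ∫ φ in (0 : ℝ)..L, x φ ^ m * d φ = A m) :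
    ∃ μ : Measure ℝ, IsProbabilityMeasure μ ∧ μ (Icc 0 c)ᶜ = 0 ∧
      ∀ m : ℕ, ∫ y, y ^ m ∂μ = A m := by
  have hA' : ∀ m, ∫ φ in Ioo 0 L, x φ ^ m * d φ = A m := fun m => by
    rw [← integral_Ioc_eq_integral_Ioo, ← intervalIntegral.integral_of_le hL, hA]
  have hae : ∀ᵐ φ ∂(volume.restrict (Ioo 0 L)), 0 ≤ d φ :=
    ae_restrict_of_forall_mem measurableSet_Ioo hd0
  have hint : Integrable d (volume.restrict (Ioo 0 L)) := by
    by_contra h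
    have := hA' 0
    simp [integral_undef h, hA0] at this
  set ν := (volume.restrict (Ioo 0 L)).withDensity fun φ => ENNReal.ofReal (d φ)
  have hν : IsProbabilityMeasure ν := by
    refine ⟨?_⟩
    rw [withDensity_apply _ MeasurableSet.univ, Measure.restrict_univ,
      ← ofReal_integral_eq_lintegral_ofReal hint hae]
    have := hA' 0
    simp only [pow_zero, one_mul, hA0] at this
    rw [this, ENNReal.ofReal_one]
  refine ⟨ν.map x, Measure.isProbabilityMeasure_map hx.aemeasurable, ?_, fun m => ?_⟩
  · rw [Measure.map_apply hx measurableSet_Icc.compl]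
    refine withDensity_absolutelyContinuous _ _ ?_
    rw [Measure.restrict_apply (hx measurableSet_Icc.compl)]
    convert measure_empty (μ := volume)
    ext φ
    simp only [mem_inter_iff, mem_preimage, mem_empty_iff_false, iff_false, not_and]
    exact fun h1 h2 => h1 (hx0 φ h2)
  · rw [integral_map hx.aemeasurable (by fun_prop), integral_withDensity_eq_integral_toReal_smul
      (by fun_prop) (by simp), ← hA' m]
    refine integral_congr_ae ?_
    filter_upwards [hae] with φ hφ
    rw [ENNReal.toReal_ofReal hφ, smul_eq_mul, mul_comm]

lemma eq_of_forall_moment_eq {c : ℝ} {μ ν : Measure ℝ} [IsFiniteMeasure μ] [IsFiniteMeasure ν]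
    (hμ : μ (Icc 0 c)ᶜ = 0) (hν : ν (Icc 0 c)ᶜ = 0)
    (h : ∀ m : ℕ, ∫ x, x ^ m ∂μ = ∫ x, x ^ m ∂ν) : μ = ν := by
  have hint : ∀ (κ : Measure ℝ) [IsFiniteMeasure κ], κ (Icc 0 c)ᶜ = 0 →
      ∀ f : ℝ → ℝ, Continuous f → Integrable f κ := by
    intro κ _ hκ f hf
    rw [← Measure.restrict_eq_self_of_ae_mem (s := Icc 0 c) hκ]
    exact hf.continuousOn.integrableOn_compact isCompact_Icc
  have hpoly : ∀ q : Polynomial ℝ, ∫ x, q.eval x ∂μ = ∫ x, q.eval x ∂ν := by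
    intro q
    simp_rw [Polynomial.eval_eq_sum_range]
    rw [integral_finsetSum _ fun i _ => hint μ hμ _ (by fun_prop),
      integral_finsetSum _ fun i _ => hint ν hν _ (by fun_prop)]
    simp_rw [integral_const_mul, h]
  refine ext_of_forall_integral_eq_of_IsFiniteMeasure fun f => ?_
  refine eq_of_forall_dist_le fun ε hε => ?_
  set M := μ.real univ + ν.real univ + 1
  have hM : 0 < M := by positivity
  obtain ⟨q, hq⟩ := exists_polynomial_near_of_continuousOn 0 c f f.continuous.continuousOn
    (ε / M) (by positivity)
  have key : ∀ (κ : Measure ℝ) [IsFiniteMeasure κ], κ (Icc 0 c)ᶜ = 0 →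
      |(∫ x, q.eval x ∂κ) - ∫ x, f x ∂κ| ≤ ε / M * κ.real univ := by
    intro κ _ hκ
    rw [← integral_sub (hint κ hκ _ q.continuous) (hint κ hκ _ f.continuous)]
    rw [← Real.norm_eq_abs]
    refine norm_integral_le_of_norm_le_const ?_
    have : ∀ᵐ x ∂κ, x ∈ Icc 0 c := hκ
    filter_upwards [this] with x hx using (hq x hx).le
  have h1 := abs_le.1 (key μ hμ)
  have h2 := abs_le.1 (key ν hν)
  rw [hpoly q] at h1
  have h3 : ε / M * μ.real univ + ε / M * ν.real univ ≤ ε := by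
    rw [← mul_add, div_mul_eq_mul_div, div_le_iff₀ hM]
    nlinarith
  rw [Real.dist_eq, abs_le]
  constructor <;> linarith [h1.1, h1.2, h2.1, h2.2]

end MomentProblem

section RaneyCases

open ProbabilityTheory

variable {p r : ℝ}

lemma Gamma_add_nat {s : ℝ} (hs : 0 < s) (m : ℕ) :
    Gamma (s + m) = Gamma s * ∏ i ∈ Finset.range m, (s + i) := by
  induction m with
  | zero => simp
  | succ m ih =>
    rw [Finset.prod_range_succ, ← mul_assoc, ← ih, Nat.cast_succ, ← add_assoc,
      Gamma_add_one (by positivity), mul_comm]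

lemma pow_mul_betaPDFReal {α β : ℝ} (hα : 0 < α) (hβ : 0 < β) (m : ℕ) (x : ℝ) :
    x ^ m * betaPDFReal α β x = beta (α + m) β / beta α β * betaPDFReal (α + m) β x := by
  rw [betaPDFReal, betaPDFReal]
  split_ifs with h
  · have h1 := (beta_pos hα hβ).ne'
    have h2 := (beta_pos (α := α + m) (by positivity) hβ).ne'
    rw [add_sub_right_comm, rpow_add_natCast h.1.ne']
    field_simp
  · simp

lemma integral_pow_betaMeasure {α β : ℝ} (hα : 0 < α) (hβ : 0 < β) (m : ℕ) :
    ∫ x, x ^ m ∂(betaMeasure α β) = beta (α + m) β / beta α β := by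
  have hnn : ∀ {α β : ℝ}, 0 < α → 0 < β → ∀ x, 0 ≤ betaPDFReal α β x := by
    intro α β hα hβ x
    by_cases h : 0 < x ∧ x < 1
    · exact (betaPDFReal_pos h.1 h.2 hα hβ).le
    · rw [betaPDFReal, if_neg h]
  have hα' : 0 < α + m := by positivity
  have h1 : ∫ x, betaPDFReal (α + m) β x = 1 := by
    rw [integral_eq_lintegral_of_nonneg_ae (.of_forall (hnn hα' hβ)) (by fun_prop)]
    exact (congrArg _ (lintegral_betaPDF_eq_one hα' hβ)).trans ENNReal.toReal_one
  rw [betaMeasure, integral_withDensity_eq_integral_toReal_smul (by unfold betaPDF; fun_prop)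
    (by simp [betaPDF])]
  simp_rw [betaPDF, ENNReal.toReal_ofReal (hnn hα hβ _), smul_eq_mul, mul_comm _ (_ ^ m),
    pow_mul_betaPDFReal hα hβ, integral_const_mul, h1, mul_one]

lemma betaMeasure_compl_Icc (α β : ℝ) : betaMeasure α β (Icc 0 1)ᶜ = 0 := by
  rw [betaMeasure, withDensity_apply _ measurableSet_Icc.compl]
  refine setLIntegral_eq_zero measurableSet_Icc.compl fun x hx => ?_
  by_cases h : 0 ≤ x
  · exact betaPDF_eq_zero_of_one_le (not_le.1 fun h1 => hx ⟨h, h1⟩).le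
  · exact betaPDF_eq_zero_of_nonpos (not_le.1 h).le

lemma raney_one (hr0 : 0 < r) (m : ℕ) :
    raney 1 r m = (∏ i ∈ Finset.range m, (r + i)) / m.factorial := by
  rw [raney_eq zero_le_one hr0]
  rcases m with _ | m
  · simp [hr0.ne']
  · have ha : (m + 1 : ℝ) + r ≠ 0 := by positivity
    rw [Finset.prod_range_succ', Finset.prod_range_succ' (fun i : ℕ => r + (i : ℝ)),
      ← Finset.prod_range_reflect]
    have : ∏ j ∈ Finset.range m, (((m + 1 : ℕ) : ℝ) * 1 + r - ((m - 1 - j + 1 : ℕ) : ℝ)) =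
        ∏ j ∈ Finset.range m, (r + ((j + 1 : ℕ) : ℝ)) := by
      refine Finset.prod_congr rfl fun j hj => ?_
      have hj' : j + 1 ≤ m := Finset.mem_range.1 hj
      rw [show m - 1 - j + 1 = m - j by omega, Nat.cast_sub (by omega)]
      push_cast
      ring
    rw [this]
    push_cast
    field_simp
    ring

lemma beta_add_nat_div_beta (hr0 : 0 < r) (hr1 : r < 1) (m : ℕ) :
    beta (r + m) (1 - r) / beta r (1 - r) = raney 1 r m := by
  have h1 := (Gamma_pos_of_pos hr0).ne'
  have h2 := (Gamma_pos_of_pos (sub_pos.2 hr1)).ne'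
  rw [raney_one hr0, beta, beta, Gamma_add_nat hr0, add_sub_cancel, Gamma_one,
    show r + m + (1 - r) = (m : ℝ) + 1 by ring, Gamma_nat_eq_factorial]
  field_simp

lemma cRaney_one : cRaney 1 = 1 := by simp [cRaney]

lemma raney_zero_right (m : ℕ) : raney p 0 m = 0 ^ m := by
  rcases m with _ | m <;> simp [raney]

lemma cRaney_nonneg (hp : 1 ≤ p) : 0 ≤ cRaney p :=
  mul_nonneg (rpow_nonneg (by linarith) _) (rpow_nonneg (by linarith) _)

lemma exists_dirac_moment {y c : ℝ} (hy : y ∈ Icc 0 c) :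
    ∃ μ : Measure ℝ, IsProbabilityMeasure μ ∧ μ (Icc 0 c)ᶜ = 0 ∧
      ∀ m : ℕ, ∫ x, x ^ m ∂μ = y ^ m :=
  ⟨Measure.dirac y, inferInstance, by simp [hy.1, hy.2], fun m => integral_dirac _ _⟩

lemma exists_raney_measure_one (hr0 : 0 < r) (hr1 : r ≤ 1) :
    ∃ μ : Measure ℝ, IsProbabilityMeasure μ ∧ μ (Icc 0 (cRaney 1))ᶜ = 0 ∧
      ∀ m : ℕ, ∫ x, x ^ m ∂μ = raney 1 r m := by
  rw [cRaney_one]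
  rcases eq_or_lt_of_le hr1 with rfl | h
  · obtain ⟨μ, h1, h2, h3⟩ := exists_dirac_moment (y := 1) (c := 1) (by simp)
    refine ⟨μ, h1, h2, fun m => ?_⟩
    have h4 : ∏ i ∈ Finset.range m, ((1 : ℝ) + i) = m.factorial := by
      rw [← Finset.prod_range_add_one_eq_factorial]
      push_cast
      exact Finset.prod_congr rfl fun i _ => add_comm _ _
    rw [h3, one_pow, raney_one hr0, h4, div_self (by positivity)]
  · exact ⟨betaMeasure r (1 - r), isProbabilityMeasureBeta hr0 (sub_pos.2 h),
      betaMeasure_compl_Icc _ _, fun m => by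
        rw [integral_pow_betaMeasure hr0 (sub_pos.2 h), beta_add_nat_div_beta hr0 h]⟩

lemma measurable_raneyModulus : Measurable (raneyModulus p) := by
  unfold raneyModulus
  fun_prop

lemma measurable_raneyRadius : Measurable (raneyRadius p) := by
  unfold raneyRadius
  fun_prop

lemma measurable_raneyPoint : Measurable (raneyPoint p) :=
  (measurable_raneyRadius.pow_const p).div measurable_raneyModulus

lemma measurable_raneyDensity : Measurable (raneyDensity p r) := by
  have := measurable_raneyRadius (p := p)
  unfold raneyDensity raneyModulusLogDeriv raneyRadiusLogDeriv
  fun_prop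

lemma exists_raney_measure (hp : 1 ≤ p) (hr0 : 0 ≤ r) (hrp : r ≤ p) :
    ∃ μ : Measure ℝ, IsProbabilityMeasure μ ∧ μ (Icc 0 (cRaney p))ᶜ = 0 ∧
      ∀ m : ℕ, ∫ x, x ^ m ∂μ = raney p r m := by
  rcases eq_or_lt_of_le hr0 with rfl | hr
  · simp_rw [raney_zero_right]
    exact exists_dirac_moment ⟨le_rfl, cRaney_nonneg hp⟩
  rcases eq_or_lt_of_le hp with rfl | hp'
  · exact exists_raney_measure_one hr hrp
  · refine exists_isProbabilityMeasure_of_density (div_pos pi_pos (by linarith)).le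
      measurable_raneyPoint measurable_raneyDensity
      (fun φ hφ => raneyDensity_nonneg hp' hr hrp hφ)
      (fun φ hφ => ⟨raneyPoint_nonneg hp' hφ, raneyPoint_le hp' hφ⟩) rfl fun m => ?_
    rw [integral_raneyPoint_pow_mul_density hp' hr hrp, raney_eq (by linarith) hr]

end RaneyCases

/-- For real `p ≥ 1` and `0 ≤ r ≤ p`, there exists a unique probability
measure `μ(p,r)` on `ℝ` with support contained in `[0, c(p)]` whose `m`-th moment is
`A_m(p,r)` for every natural `m`. -/
theorem stmt_5 (p r : ℝ) (hp : 1 ≤ p) (hr0 : 0 ≤ r) (hrp : r ≤ p) :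
    ∃! μ : Measure ℝ, IsProbabilityMeasure μ ∧
      μ ((Set.Icc (0 : ℝ) (cRaney p))ᶜ) = 0 ∧
      ∀ m : ℕ, ∫ x, x ^ m ∂μ = raney p r m := by
  obtain ⟨μ, h1, h2, h3⟩ := exists_raney_measure hp hr0 hrp
  refine ⟨μ, ⟨h1, h2, h3⟩, fun ν ⟨h1', h2', h3'⟩ => ?_⟩
  exact eq_of_forall_moment_eq h2' h2 fun m => (h3' m).trans (h3 m).symm
end

section
/- Let r be a real number with 0 < r ≤ 2 and define W_{2,r}(x) = sin(r·arccos(√(x/4))) / (π·x^{1−r/2}) for x ∈ (0,4). Then W_{2,r}(x) ≥ 0 for all x ∈ (0,4), and for every natural number m, ∫₀⁴ x^m · W_{2,r}(x) dx = A_m(2,r); in particular (taking m = 0) W_{2,r} is a probability density on (0,4). -/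
open Real

lemma re_one_add_cexp_cpow {r φ : ℝ} (hr : 0 < r) (hφ : φ ∈ Set.Icc (-(π / 2)) (π / 2)) :
    ((1 + Complex.exp ((2 * φ : ℝ) * Complex.I)) ^ (r : ℂ)).re
      = (2 * cos φ) ^ r * cos (r * φ) := by
  have hfac : 1 + Complex.exp ((2 * φ : ℝ) * Complex.I)
      = ((2 * cos φ : ℝ) : ℂ) * Complex.exp (φ * Complex.I) := by
    have h₁ : Complex.exp ((2 * φ : ℝ) * Complex.I)
        = Complex.exp (φ * Complex.I) * Complex.exp (φ * Complex.I) := by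
      rw [← Complex.exp_add]; push_cast; ring_nf
    have h₂ : Complex.exp (-φ * Complex.I) * Complex.exp (φ * Complex.I) = 1 := by
      rw [← Complex.exp_add]; simp
    rw [h₁]
    push_cast
    rw [Complex.two_cos]
    linear_combination -h₂
  rw [hfac]
  rcases (cos_nonneg_of_mem_Icc hφ).eq_or_lt with hc | hc
  · have : (r : ℂ) ≠ 0 := by exact_mod_cast hr.ne'
    simp [← hc, Complex.zero_cpow this, zero_rpow hr.ne']
  · have hpos : 0 < 2 * cos φ := by positivity
    have hlog : Complex.log (Complex.exp (φ * Complex.I)) = φ * Complex.I := by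
      apply Complex.log_exp
      · simp; linarith [hφ.1, pi_pos]
      · simp; linarith [hφ.2, pi_pos]
    rw [Complex.cpow_def_of_ne_zero
        (mul_ne_zero (by exact_mod_cast hpos.ne') (Complex.exp_ne_zero _)),
      Complex.log_ofReal_mul hpos (Complex.exp_ne_zero _), hlog, Complex.exp_re,
      rpow_def_of_pos hpos]
    simp [mul_comm]

lemma integral_two_cos_rpow_mul_cos {r : ℝ} (hr : 0 < r) :
    ∫ φ in (0 : ℝ)..π / 2, (2 * cos φ) ^ r * cos (r * φ) = π / 2 := by
  set f : ℂ → ℂ := fun z ↦ (1 + z) ^ (r : ℂ) with hf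
  have hcont : ContinuousOn f (Metric.closedBall 0 |1|) := by
    intro z hz
    have hz' : ‖z‖ ≤ 1 := by simpa using hz
    have hre := (abs_le.mp (Complex.abs_re_le_norm z)).1
    refine ContinuousAt.continuousWithinAt ?_
    exact ContinuousAt.comp (f := fun z : ℂ ↦ 1 + z) (g := fun w : ℂ ↦ w ^ (r : ℂ))
      (Complex.continuousAt_cpow_const_of_re_pos (Or.inl (by simp; linarith)) (by simpa))
      (by fun_prop)
  have hdiff : ∀ z ∈ Metric.ball (0 : ℂ) |1| \ ∅, DifferentiableAt ℂ f z := by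
    intro z hz
    have hz' : ‖z‖ < 1 := by simpa using hz
    have hre := (abs_le.mp (Complex.abs_re_le_norm z)).1
    exact DifferentiableAt.cpow_const (by fun_prop)
      (Or.inl (by simp; linarith))
  have hmean : Real.circleAverage f 0 1 = 1 := by
    rw [circleAverage_of_differentiable_on_off_countable Set.countable_empty hcont hdiff]
    simp [hf]
  set g : ℝ → ℂ := fun θ ↦ f (circleMap 0 1 θ) with hg
  have hgcont : Continuous g :=
    hcont.comp_continuous (continuous_circleMap 0 1) fun θ ↦ by simp
  have hgper : Function.Periodic g (2 * π) := fun θ ↦ by simp [hg, periodic_circleMap 0 1 θ]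
  have hshift : ∫ θ in (-π)..π, g θ = 2 * π := by
    have h := hgper.intervalIntegral_add_eq (-π) 0
    rw [show -π + 2 * π = π by ring, zero_add] at h
    rw [h]
    rw [Real.circleAverage_def, inv_smul_eq_iff₀ (by positivity)] at hmean
    rw [hmean]; simp
  have hre : ∫ θ in (-π)..π, (g θ).re = 2 * π := by
    have h := Complex.reCLM.intervalIntegral_comp_comm (μ := MeasureTheory.volume)
      (hgcont.intervalIntegrable (-π) π)
    simp only [Complex.reCLM_apply] at h
    rw [h, hshift]; simp
  have hcomp := intervalIntegral.mul_integral_comp_mul_left (a := -(π / 2)) (b := π / 2)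
    (f := fun θ ↦ (g θ).re) (2 : ℝ)
  rw [show 2 * -(π / 2) = -π by ring, show 2 * (π / 2) = π by ring, hre] at hcomp
  have hcongr : ∫ φ in (-(π / 2))..(π / 2), (g (2 * φ)).re
      = ∫ φ in (-(π / 2))..(π / 2), (2 * cos φ) ^ r * cos (r * φ) := by
    refine intervalIntegral.integral_congr fun φ hφ ↦ ?_
    rw [Set.uIcc_of_le (by linarith [pi_pos])] at hφ
    simpa [hg, hf, circleMap] using re_one_add_cexp_cpow hr hφ
  have hc : Continuous fun φ : ℝ ↦ (2 * cos φ) ^ r * cos (r * φ) :=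
    (Continuous.rpow_const (by fun_prop) fun _ ↦ Or.inr hr.le).mul (by fun_prop)
  have heven : ∫ φ in (-(π / 2))..0, (2 * cos φ) ^ r * cos (r * φ)
      = ∫ φ in (0 : ℝ)..π / 2, (2 * cos φ) ^ r * cos (r * φ) := by
    have h := intervalIntegral.integral_comp_neg (a := 0) (b := π / 2)
      (fun φ : ℝ ↦ (2 * cos φ) ^ r * cos (r * φ))
    simpa using h.symm
  rw [hcongr, ← intervalIntegral.integral_add_adjacent_intervals
    (hc.intervalIntegrable _ 0) (hc.intervalIntegrable 0 _), heven] at hcomp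
  linarith

lemma integral_two_cos_rpow_mul_cos_recurrence (r : ℝ) {s : ℝ} (hs : 0 < s) :
    ((s + 2) ^ 2 - r ^ 2) * ∫ φ in (0 : ℝ)..π / 2, (2 * cos φ) ^ (s + 2) * cos (r * φ)
      = 4 * (s + 2) * (s + 1) * ∫ φ in (0 : ℝ)..π / 2, (2 * cos φ) ^ s * cos (r * φ) := by
  have hc : ∀ t : ℝ, 0 ≤ t → Continuous fun φ : ℝ ↦ (2 * cos φ) ^ t := fun t ht ↦
    Continuous.rpow_const (by fun_prop) fun _ ↦ Or.inr ht
  have hc₀ := hc s hs.le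
  have hc₁ := hc (s + 1) (by linarith)
  have hc₂ := hc (s + 2) (by linarith)
  have hderiv : ∀ φ ∈ Set.Ioo (0 : ℝ) (π / 2), HasDerivAt
      (fun φ ↦ -2 * (s + 2) * (sin φ * (2 * cos φ) ^ (s + 1) * cos (r * φ))
        + r * ((2 * cos φ) ^ (s + 2) * sin (r * φ)))
      (4 * (s + 2) * (s + 1) * ((2 * cos φ) ^ s * cos (r * φ))
        - ((s + 2) ^ 2 - r ^ 2) * ((2 * cos φ) ^ (s + 2) * cos (r * φ))) φ := by
    intro φ hφ
    have hcos : 0 < cos φ := cos_pos_of_mem_Ioo ⟨by linarith [hφ.1, pi_pos], hφ.2⟩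
    have hpos : 0 < 2 * cos φ := by positivity
    have d₀ : HasDerivAt (fun φ : ℝ ↦ 2 * cos φ) (2 * -sin φ) φ :=
      (hasDerivAt_cos φ).const_mul 2
    have d₁ := d₀.rpow_const (p := s + 1) (Or.inl hpos.ne')
    have d₂ := d₀.rpow_const (p := s + 2) (Or.inl hpos.ne')
    have dr : HasDerivAt (fun φ : ℝ ↦ r * φ) r φ := by
      simpa using (hasDerivAt_id φ).const_mul r
    have e₁ : (2 * cos φ) ^ (s + 1) = (2 * cos φ) ^ s * (2 * cos φ) := by
      rw [rpow_add hpos, rpow_one]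
    have e₂ : (2 * cos φ) ^ (s + 2) = (2 * cos φ) ^ s * (2 * cos φ) ^ 2 := by
      rw [rpow_add hpos, rpow_two]
    refine (((((hasDerivAt_sin φ).mul d₁).mul dr.cos).const_mul (-2 * (s + 2))).add
      ((d₂.mul dr.sin).const_mul r)).congr_deriv ?_
    simp only [Pi.mul_apply]
    rw [show s + 1 - 1 = s by ring, show s + 2 - 1 = s + 1 by ring, e₁, e₂]
    linear_combination (4 * (s + 2) * (s + 1) * (2 * cos φ) ^ s * cos (r * φ))
      * sin_sq_add_cos_sq φ
  have hint := intervalIntegral.integral_eq_sub_of_hasDerivAt_of_le (by positivity)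
    (Continuous.continuousOn (by fun_prop)) hderiv
    (Continuous.intervalIntegrable (by fun_prop) _ _)
  rw [intervalIntegral.integral_sub (Continuous.intervalIntegrable (by fun_prop) _ _)
    (Continuous.intervalIntegrable (by fun_prop) _ _), intervalIntegral.integral_const_mul,
    intervalIntegral.integral_const_mul] at hint
  simp [zero_rpow (show s + 1 ≠ 0 by linarith), zero_rpow (show s + 2 ≠ 0 by linarith)] at hint
  linarith

lemma integral_sin_mul_sin_mul_two_cos_rpow (r : ℝ) {s : ℝ} (hs : 0 < s)
    (hint : IntervalIntegrable (fun φ ↦ sin (r * φ) * sin φ * (2 * cos φ) ^ (s - 1))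
      MeasureTheory.volume 0 (π / 2)) :
    2 * s * ∫ φ in (0 : ℝ)..π / 2, sin (r * φ) * sin φ * (2 * cos φ) ^ (s - 1)
      = r * ∫ φ in (0 : ℝ)..π / 2, (2 * cos φ) ^ s * cos (r * φ) := by
  have hc : Continuous fun φ : ℝ ↦ (2 * cos φ) ^ s :=
    Continuous.rpow_const (by fun_prop) fun _ ↦ Or.inr hs.le
  have hderiv : ∀ φ ∈ Set.Ioo (0 : ℝ) (π / 2), HasDerivAt
      (fun φ ↦ (2 * cos φ) ^ s * sin (r * φ))
      (r * ((2 * cos φ) ^ s * cos (r * φ))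
        - 2 * s * (sin (r * φ) * sin φ * (2 * cos φ) ^ (s - 1))) φ := by
    intro φ hφ
    have hcos : 0 < cos φ := cos_pos_of_mem_Ioo ⟨by linarith [hφ.1, pi_pos], hφ.2⟩
    have hpos : 0 < 2 * cos φ := by positivity
    have d₀ : HasDerivAt (fun φ : ℝ ↦ 2 * cos φ) (2 * -sin φ) φ :=
      (hasDerivAt_cos φ).const_mul 2
    have dr : HasDerivAt (fun φ : ℝ ↦ r * φ) r φ := by
      simpa using (hasDerivAt_id φ).const_mul r
    refine ((d₀.rpow_const (p := s) (Or.inl hpos.ne')).mul dr.sin).congr_deriv ?_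
    ring
  have hi : IntervalIntegrable (fun φ ↦ r * ((2 * cos φ) ^ s * cos (r * φ)))
      MeasureTheory.volume 0 (π / 2) := Continuous.intervalIntegrable (by fun_prop) _ _
  have h := intervalIntegral.integral_eq_sub_of_hasDerivAt_of_le (by positivity)
    (Continuous.continuousOn (by fun_prop)) hderiv (hi.sub (hint.const_mul (2 * s)))
  rw [intervalIntegral.integral_sub hi (hint.const_mul (2 * s)),
    intervalIntegral.integral_const_mul, intervalIntegral.integral_const_mul] at h
  simp [zero_rpow hs.ne'] at h
  linarith

lemma four_mul_cos_sq_image_Ioo :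
    (fun φ : ℝ ↦ 4 * cos φ ^ 2) '' Set.Ioo 0 (π / 2) = Set.Ioo 0 4 := by
  ext x
  constructor
  · rintro ⟨φ, hφ, rfl⟩
    have hcos : 0 < cos φ := cos_pos_of_mem_Ioo ⟨by linarith [hφ.1, pi_pos], hφ.2⟩
    have hsin : 0 < sin φ := sin_pos_of_pos_of_lt_pi hφ.1 (by linarith [hφ.2, pi_pos])
    exact ⟨by positivity, by nlinarith [sin_sq_add_cos_sq φ]⟩
  · rintro ⟨h0, h4⟩
    have hs : √(x / 4) < 1 := by rw [sqrt_lt' one_pos]; linarith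
    have hp : 0 < √(x / 4) := sqrt_pos.mpr (by linarith)
    refine ⟨arccos √(x / 4), ⟨arccos_pos.mpr hs, arccos_lt_pi_div_two.mpr hp⟩, ?_⟩
    simp only
    rw [cos_arccos (by linarith) hs.le, sq_sqrt (by linarith)]
    ring

lemma four_mul_cos_sq_injOn : Set.InjOn (fun φ : ℝ ↦ 4 * cos φ ^ 2) (Set.Ioo 0 (π / 2)) := by
  intro a ha b hb hab
  have hca : 0 < cos a := cos_pos_of_mem_Ioo ⟨by linarith [ha.1, pi_pos], ha.2⟩
  have hcb : 0 < cos b := cos_pos_of_mem_Ioo ⟨by linarith [hb.1, pi_pos], hb.2⟩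
  refine injOn_cos ⟨ha.1.le, by linarith [ha.2, pi_pos]⟩ ⟨hb.1.le, by linarith [hb.2, pi_pos]⟩ ?_
  exact (sq_eq_sq₀ hca.le hcb.le).mp (by simpa using hab)

lemma hasDerivAt_four_mul_cos_sq (φ : ℝ) :
    HasDerivAt (fun φ : ℝ ↦ 4 * cos φ ^ 2) (-(8 * cos φ * sin φ)) φ :=
  (((hasDerivAt_cos φ).pow 2).const_mul 4).congr_deriv (by push_cast; ring)

lemma raneyDensity_comp_four_mul_cos_sq (r : ℝ) (m : ℕ) {φ : ℝ} (hφ : φ ∈ Set.Ioo 0 (π / 2)) :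
    |-(8 * cos φ * sin φ)| • ((4 * cos φ ^ 2) ^ m *
      (sin (r * arccos √(4 * cos φ ^ 2 / 4)) / (π * (4 * cos φ ^ 2) ^ (1 - r / 2))))
      = 4 / π * (sin (r * φ) * sin φ * (2 * cos φ) ^ (2 * m + r - 1)) := by
  have hcos : 0 < cos φ := cos_pos_of_mem_Ioo ⟨by linarith [hφ.1, pi_pos], hφ.2⟩
  have hsin : 0 < sin φ := sin_pos_of_pos_of_lt_pi hφ.1 (by linarith [hφ.2, pi_pos])
  have hpos : 0 < 2 * cos φ := by positivity
  have hsq : 4 * cos φ ^ 2 = (2 * cos φ) ^ (2 : ℝ) := by rw [rpow_two]; ring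
  have harc : arccos √(4 * cos φ ^ 2 / 4) = φ := by
    rw [mul_div_cancel_left₀ _ (by norm_num), sqrt_sq hcos.le,
      arccos_cos hφ.1.le (by linarith [hφ.2, pi_pos])]
  have hpow : (2 * cos φ) ^ (2 * m + r - 1)
      = (2 * cos φ) * (4 * cos φ ^ 2) ^ m / (4 * cos φ ^ 2) ^ (1 - r / 2) := by
    rw [← rpow_natCast (4 * cos φ ^ 2), hsq, ← rpow_mul hpos.le, ← rpow_mul hpos.le]
    nth_rewrite 2 [← rpow_one (2 * cos φ)]
    rw [← rpow_add hpos, ← rpow_sub hpos]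
    congr 1; ring
  have hne : (4 * cos φ ^ 2) ^ (1 - r / 2) ≠ 0 := by positivity
  rw [harc, hpow, abs_neg, abs_of_pos (by positivity), smul_eq_mul]
  field_simp
  ring

lemma raneyDensity_integrableOn {r : ℝ} (hr : 0 < r) (m : ℕ) :
    MeasureTheory.IntegrableOn (fun x : ℝ ↦
      x ^ m * (sin (r * arccos √(x / 4)) / (π * x ^ (1 - r / 2)))) (Set.Ioo 0 4) := by
  have h₁ : IntervalIntegrable (fun x : ℝ ↦ x ^ (r / 2 - 1)) MeasureTheory.volume 0 4 :=
    intervalIntegral.intervalIntegrable_rpow' (by linarith)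
  have h₂ := h₁.mul_continuousOn (g := fun x : ℝ ↦ x ^ m * sin (r * arccos √(x / 4)) / π)
    (Continuous.continuousOn (by fun_prop))
  rw [intervalIntegrable_iff_integrableOn_Ioo_of_le (by norm_num)] at h₂
  refine h₂.congr_fun (fun x hx ↦ ?_) measurableSet_Ioo
  have hx0 : 0 < x := hx.1
  simp only
  rw [show r / 2 - 1 = -(1 - r / 2) by ring, rpow_neg hx0.le]
  field_simp

lemma integral_raneyDensity {r : ℝ} (hr : 0 < r) (m : ℕ) :
    (2 * m + r) * ∫ x in (0 : ℝ)..4,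
        x ^ m * (sin (r * arccos √(x / 4)) / (π * x ^ (1 - r / 2)))
      = 2 * r / π * ∫ φ in (0 : ℝ)..π / 2, (2 * cos φ) ^ (2 * m + r) * cos (r * φ) := by
  have hd : ∀ φ ∈ Set.Ioo 0 (π / 2), HasDerivWithinAt (fun φ : ℝ ↦ 4 * cos φ ^ 2)
      (-(8 * cos φ * sin φ)) (Set.Ioo 0 (π / 2)) φ := fun φ _ ↦
    (hasDerivAt_four_mul_cos_sq φ).hasDerivWithinAt
  have hint := raneyDensity_integrableOn hr m
  rw [← four_mul_cos_sq_image_Ioo,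
    MeasureTheory.integrableOn_image_iff_integrableOn_abs_deriv_smul measurableSet_Ioo hd
      four_mul_cos_sq_injOn] at hint
  replace hint := hint.congr_fun
    (fun φ hφ ↦ raneyDensity_comp_four_mul_cos_sq r m hφ) measurableSet_Ioo
  rw [← intervalIntegrable_iff_integrableOn_Ioo_of_le (by positivity)] at hint
  have hint' : IntervalIntegrable (fun φ ↦ sin (r * φ) * sin φ * (2 * cos φ) ^ (2 * m + r - 1))
      MeasureTheory.volume 0 (π / 2) :=
    (hint.const_mul (π / 4)).congr fun φ _ ↦ by field_simp
  have key := integral_sin_mul_sin_mul_two_cos_rpow r (s := 2 * m + r) (by positivity) hint'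
  have hsub : ∫ x in (0 : ℝ)..4, x ^ m * (sin (r * arccos √(x / 4)) / (π * x ^ (1 - r / 2)))
      = 4 / π * ∫ φ in (0 : ℝ)..π / 2, sin (r * φ) * sin φ * (2 * cos φ) ^ (2 * m + r - 1) := by
    rw [intervalIntegral.integral_of_le (by norm_num), MeasureTheory.integral_Ioc_eq_integral_Ioo,
      ← four_mul_cos_sq_image_Ioo,
      MeasureTheory.integral_image_eq_integral_abs_deriv_smul measurableSet_Ioo hd
        four_mul_cos_sq_injOn,
      MeasureTheory.setIntegral_congr_fun measurableSet_Ioo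
        (fun φ hφ ↦ raneyDensity_comp_four_mul_cos_sq r m hφ),
      ← MeasureTheory.integral_Ioc_eq_integral_Ioo,
      ← intervalIntegral.integral_of_le (by positivity), intervalIntegral.integral_const_mul]
  rw [hsub]
  linear_combination 2 / π * key

lemma raney_two_succ (r : ℝ) (m : ℕ) :
    raney 2 r (m + 1)
      = r / (Nat.factorial (m + 1) : ℝ) * ∏ k ∈ Finset.range m, (r + m + 2 + k) := by
  rw [raney]
  congr 1
  refine Finset.prod_nbij' (fun i ↦ m - i) (fun k ↦ m - k) ?_ ?_ ?_ ?_ ?_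
  · intro i hi; simp only [Finset.mem_Icc, Finset.mem_range] at *; omega
  · intro i hi; simp only [Finset.mem_Icc, Finset.mem_range] at *; omega
  · intro i hi; simp only [Finset.mem_Icc] at *; omega
  · intro i hi; simp only [Finset.mem_range] at *; omega
  · intro i hi
    rw [Nat.cast_sub (Finset.mem_Icc.mp hi).2]
    ring

lemma raney_two_recurrence (r : ℝ) (m : ℕ) :
    (m + 1) * (m + 1 + r) * raney 2 r (m + 1) = (2 * m + r) * (2 * m + r + 1) * raney 2 r m := by
  cases m with
  | zero => simp [raney]; ring
  | succ n =>
    rw [raney_two_succ, raney_two_succ]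
    have hprod : (r + n + 2) * ∏ k ∈ Finset.range (n + 1), (r + (n + 1 : ℕ) + 2 + k)
        = (∏ k ∈ Finset.range n, (r + n + 2 + k)) * (r + 2 * n + 2) * (r + 2 * n + 3) := by
      have h := Finset.prod_range_succ' (fun k : ℕ ↦ r + n + 2 + k) (n + 1)
      rw [Finset.prod_range_succ, Finset.prod_range_succ] at h
      have hshift : ∏ k ∈ Finset.range (n + 1), (r + n + 2 + ((k + 1 : ℕ) : ℝ))
          = ∏ k ∈ Finset.range (n + 1), (r + (n + 1 : ℕ) + 2 + k) :=
        Finset.prod_congr rfl fun k _ ↦ by push_cast; ring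
      rw [hshift] at h
      push_cast at h ⊢
      linear_combination -h
    have hfac : (Nat.factorial (n + 1) : ℝ) ≠ 0 := by positivity
    have hn : (n : ℝ) + 1 + 1 ≠ 0 := by positivity
    rw [Nat.factorial_succ (n + 1)]
    push_cast at hprod ⊢
    field_simp
    linear_combination r * hprod

lemma integral_raneyDensity_eq {r : ℝ} (hr : 0 < r) (m : ℕ) :
    ∫ x in (0 : ℝ)..4, x ^ m * (sin (r * arccos √(x / 4)) / (π * x ^ (1 - r / 2)))
      = raney 2 r m := by
  induction m with
  | zero =>
    have h := integral_raneyDensity hr 0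
    simp only [Nat.cast_zero, mul_zero, zero_add, integral_two_cos_rpow_mul_cos hr] at h
    refine mul_left_cancel₀ hr.ne' (h.trans ?_)
    rw [raney]
    field_simp
  | succ m ih =>
    have h₀ := integral_raneyDensity hr m
    have h₁ := integral_raneyDensity hr (m + 1)
    have hK := integral_two_cos_rpow_mul_cos_recurrence r (s := 2 * m + r) (by positivity)
    have hR := raney_two_recurrence r m
    rw [show (2 : ℝ) * (m + 1 : ℕ) + r = 2 * m + r + 2 by push_cast; ring] at h₁
    rw [ih] at h₀
    have hne : (2 * (m : ℝ) + r + 2) * ((m + 1) * (m + 1 + r)) ≠ 0 := by positivity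
    refine mul_left_cancel₀ hne ?_
    linear_combination (m + 1) * (m + 1 + r) * h₁ + 2 * r / π / 4 * hK
      - (2 * m + r + 2) * (2 * m + r + 1) * h₀ - (2 * m + r + 2) * hR

lemma raneyDensity_nonneg_s6 {r x : ℝ} (hr0 : 0 ≤ r) (hr2 : r ≤ 2) (hx : 0 ≤ x) :
    0 ≤ sin (r * arccos √(x / 4)) / (π * x ^ (1 - r / 2)) := by
  have h₁ : arccos √(x / 4) ≤ π / 2 := arccos_le_pi_div_two.mpr (sqrt_nonneg _)
  have h₀ : 0 ≤ arccos √(x / 4) := arccos_nonneg _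
  have hsin : 0 ≤ sin (r * arccos √(x / 4)) :=
    sin_nonneg_of_nonneg_of_le_pi (by positivity) (by nlinarith)
  positivity

/-- For `0 < r ≤ 2` and `W_{2,r}(x) = sin(r·arccos(√(x/4)))/(π·x^(1−r/2))` on
`(0,4)`: `W_{2,r} ≥ 0` on `(0,4)` and `∫₀⁴ x^m·W_{2,r}(x) dx = A_m(2,r)` for every `m`;
in particular (`m = 0`) `W_{2,r}` is a probability density on `(0,4)`. -/
theorem stmt_6 (r : ℝ) (hr0 : 0 < r) (hr2 : r ≤ 2) :
    (∀ x ∈ Set.Ioo (0 : ℝ) 4,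
      0 ≤ Real.sin (r * Real.arccos (Real.sqrt (x / 4))) / (π * x ^ (1 - r / 2))) ∧
    ∀ m : ℕ,
      (∫ x in (0:ℝ)..4,
        x ^ m * (Real.sin (r * Real.arccos (Real.sqrt (x / 4))) / (π * x ^ (1 - r / 2))))
      = raney 2 r m := by
  exact ⟨fun x hx ↦ raneyDensity_nonneg_s6 hr0.le hr2 hx.1.le, integral_raneyDensity_eq hr0⟩
end

section
/- Let c be a real number that is not zero or a negative integer. Then for every real z with |z| < 1, ∑_{n=0}^{∞} [(c/2)_n · ((c−1)/2)_n / ((c)_n · n!)] · z^n = 2^{c−1} · (1 + √(1 − z))^{1−c}, where (a)_n = a(a+1)⋯(a+n−1) denotes the rising factorial (Pochhammer symbol) with (a)_0 = 1. -/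
open Real Polynomial

theorem Complex.hasDerivAt_iteratedDeriv {f : ℂ → ℂ} {U : Set ℂ} (hU : IsOpen U)
    (hf : DifferentiableOn ℂ f U) (n : ℕ) {z : ℂ} (hz : z ∈ U) :
    HasDerivAt (iteratedDeriv n f) (iteratedDeriv (n + 1) f z) z := by
  have h : DifferentiableOn ℂ (iteratedDeriv n f) U := by
    induction n with
    | zero => simpa using hf
    | succ n ih => rw [iteratedDeriv_succ]; exact ih.deriv hU
  rw [iteratedDeriv_succ]
  exact (h.differentiableAt (hU.mem_nhds hz)).hasDerivAt

/-- The `n`-th derivative of a solution of the hypergeometric equation with parameters `a`, `b`, `c`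
solves the equation with parameters `a + n`, `b + n`, `c + n`. -/
theorem hypergeometric_ode_iteratedDeriv {a b c : ℂ} {f : ℂ → ℂ} {U : Set ℂ} (hU : IsOpen U)
    (hf : DifferentiableOn ℂ f U)
    (hode : ∀ z ∈ U, z * (1 - z) * iteratedDeriv 2 f z
      + (c - (a + b + 1) * z) * iteratedDeriv 1 f z - a * b * f z = 0)
    (n : ℕ) : ∀ z ∈ U, z * (1 - z) * iteratedDeriv (n + 2) f z
      + (c + n - (a + b + 1 + 2 * n) * z) * iteratedDeriv (n + 1) f z
      - (a + n) * (b + n) * iteratedDeriv n f z = 0 := by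
  induction n with
  | zero => simpa using hode
  | succ n ih =>
    intro z hz
    have h0 := Complex.hasDerivAt_iteratedDeriv hU hf n hz
    have h1 := Complex.hasDerivAt_iteratedDeriv hU hf (n + 1) hz
    have h2 := Complex.hasDerivAt_iteratedDeriv hU hf (n + 2) hz
    have hid := hasDerivAt_id z
    have hD := (((hid.mul (hid.const_sub 1)).mul h2).add
      (((hid.const_mul (a + b + 1 + 2 * n)).const_sub (c + n)).mul h1)).sub
      (h0.const_mul ((a + n) * (b + n)))
    have hE := hD.unique ((hasDerivAt_const z (0 : ℂ)).congr_of_eventuallyEq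
      (Filter.eventuallyEq_of_mem (hU.mem_nhds hz) fun w hw => by simpa using ih w hw))
    simp only [id, Pi.mul_apply] at hE
    push_cast
    linear_combination hE

/-- A solution of the hypergeometric equation that is holomorphic on the unit disc and takes the
value `1` at `0` is the sum of the Gauss hypergeometric series. -/
theorem hasSum_hypergeometric_of_ode {a b c : ℂ} (hc : ∀ n : ℕ, c ≠ -(n : ℂ)) {f : ℂ → ℂ}
    (hf : DifferentiableOn ℂ f (Metric.ball 0 1)) (hf0 : f 0 = 1)
    (hode : ∀ z ∈ Metric.ball (0 : ℂ) 1, z * (1 - z) * iteratedDeriv 2 f z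
      + (c - (a + b + 1) * z) * iteratedDeriv 1 f z - a * b * f z = 0)
    {z : ℂ} (hz : z ∈ Metric.ball (0 : ℂ) 1) :
    HasSum (fun n : ℕ => (ascPochhammer ℂ n).eval a * (ascPochhammer ℂ n).eval b /
      ((ascPochhammer ℂ n).eval c * (Nat.factorial n : ℂ)) * z ^ n) (f z) := by
  have hcn (n : ℕ) : c + n ≠ 0 := fun h => hc n (eq_neg_of_add_eq_zero_left h)
  have hpos (n : ℕ) : (ascPochhammer ℂ n).eval c ≠ 0 := by
    induction n with
    | zero => simp
    | succ n ih => rw [ascPochhammer_succ_eval]; exact mul_ne_zero ih (hcn n)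
  have hcoeff (n : ℕ) : iteratedDeriv n f 0 =
      (ascPochhammer ℂ n).eval a * (ascPochhammer ℂ n).eval b / (ascPochhammer ℂ n).eval c := by
    induction n with
    | zero => simp [hf0]
    | succ n ih =>
      have h := hypergeometric_ode_iteratedDeriv Metric.isOpen_ball hf hode n 0 (by simp)
      rw [ih] at h
      simp only [ascPochhammer_succ_eval]
      have := hpos n
      have := hcn n
      field_simp at h ⊢
      linear_combination h
  refine (Complex.hasSum_taylorSeries_on_ball hf hz).congr_fun fun n => ?_
  rw [hcoeff]
  simp only [smul_eq_mul, sub_zero]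
  have := hpos n
  field_simp

theorem Complex.eval_ascPochhammer_ofReal (n : ℕ) (x : ℝ) :
    (ascPochhammer ℂ n).eval (x : ℂ) = ((ascPochhammer ℝ n).eval x : ℝ) := by
  induction n with
  | zero => simp
  | succ n ih => simp [ascPochhammer_succ_eval, ih]

namespace HypergeometricSqrt

open Complex in
theorem re_cpow_half_pos {w : ℂ} (hw : w ∈ slitPlane) : 0 < (w ^ (1 / 2 : ℂ)).re := by
  have h0 := slitPlane_ne_zero hw
  rw [cpow_def_of_ne_zero h0, exp_re]
  refine mul_pos (Real.exp_pos _) (Real.cos_pos_of_mem_Ioo ?_)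
  have h1 := neg_pi_lt_arg w
  have h2 := lt_of_le_of_ne (arg_le_pi w) (mem_slitPlane_iff_arg.1 hw).1
  have h3 : (log w * (1 / 2)).im = arg w / 2 := by
    rw [show (1 / 2 : ℂ) = ((1 / 2 : ℝ) : ℂ) by norm_num, im_mul_ofReal, log_im]; ring
  rw [h3]
  constructor <;> linarith

theorem cpow_half_sq (w : ℂ) : (w ^ (1 / 2 : ℂ)) ^ 2 = w := by
  simp [one_div]

theorem one_sub_mem_slitPlane {z : ℂ} (hz : z ∈ Metric.ball (0 : ℂ) 1) :
    1 - z ∈ Complex.slitPlane := by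
  refine Or.inl ?_
  have := (Complex.re_le_norm z).trans_lt (mem_ball_zero_iff.1 hz)
  simpa using this

theorem hasDerivAt_sqrt {z : ℂ} (hz : z ∈ Metric.ball (0 : ℂ) 1) :
    HasDerivAt (fun w : ℂ => (1 - w) ^ (1 / 2 : ℂ)) (-1 / (2 * (1 - z) ^ (1 / 2 : ℂ))) z := by
  have hw := one_sub_mem_slitPlane hz
  have h := ((hasDerivAt_id' z).const_sub 1).cpow_const (c := 1 / 2) hw
  convert h using 1
  have h0 := Complex.slitPlane_ne_zero hw
  rw [Complex.cpow_sub _ _ h0, Complex.cpow_one]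
  have hs := cpow_half_sq (1 - z)
  have hs0 : (1 - z) ^ (1 / 2 : ℂ) ≠ 0 := fun h => by
    have := re_cpow_half_pos hw
    rw [h] at this
    simp at this
  field_simp
  linear_combination hs

/-- The holomorphic extension of `2 ^ (c - 1) * (1 + √(1 - z)) ^ (1 - c)` to the unit disc. -/
noncomputable def closedForm (c z : ℂ) : ℂ := ((1 + (1 - z) ^ (1 / 2 : ℂ)) / 2) ^ (1 - c)

theorem hasDerivAt_closedForm (c : ℂ) {z : ℂ} (hz : z ∈ Metric.ball (0 : ℂ) 1) :
    HasDerivAt (closedForm c) ((c - 1) * closedForm c z /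
      (2 * ((1 - z) ^ (1 / 2 : ℂ) * (1 + (1 - z) ^ (1 / 2 : ℂ))))) z := by
  have hre := re_cpow_half_pos (one_sub_mem_slitPlane hz)
  have hs := hasDerivAt_sqrt hz
  have hmem : (1 + (1 - z) ^ (1 / 2 : ℂ)) / 2 ∈ Complex.slitPlane := by
    refine Or.inl ?_
    rw [Complex.div_ofNat_re, Complex.add_re, Complex.one_re]
    positivity
  have h : HasDerivAt (closedForm c) _ z :=
    ((hs.const_add 1).div_const 2).cpow_const (c := 1 - c) hmem
  convert h using 1
  have h0 := Complex.slitPlane_ne_zero hmem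
  rw [Complex.cpow_sub _ _ h0, Complex.cpow_one, closedForm]
  generalize (1 - z) ^ (1 / 2 : ℂ) = s at *
  have hs0 : s ≠ 0 := fun h => by simp [h] at hre
  have hs1 : 1 + s ≠ 0 := fun h => by simp [h] at h0
  field_simp
  ring

theorem closedForm_ode (c : ℂ) {z : ℂ} (hz : z ∈ Metric.ball (0 : ℂ) 1) :
    z * (1 - z) * iteratedDeriv 2 (closedForm c) z
      + (c - (c / 2 + (c - 1) / 2 + 1) * z) * iteratedDeriv 1 (closedForm c) z
      - c / 2 * ((c - 1) / 2) * closedForm c z = 0 := by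
  have hre := re_cpow_half_pos (one_sub_mem_slitPlane hz)
  have hs := hasDerivAt_sqrt hz
  have hF := hasDerivAt_closedForm c hz
  have hsq := cpow_half_sq (1 - z)
  have hs0 : (1 - z) ^ (1 / 2 : ℂ) ≠ 0 := fun h => by rw [h] at hre; simp at hre
  have hs1 : 1 + (1 - z) ^ (1 / 2 : ℂ) ≠ 0 := fun h => by
    have := congrArg Complex.re h
    rw [Complex.add_re, Complex.one_re, Complex.zero_re] at this
    linarith
  have hderiv := ((hF.const_mul (c - 1)).div ((hs.mul (hs.const_add 1)).const_mul 2)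
    (mul_ne_zero two_ne_zero (mul_ne_zero hs0 hs1))).congr_of_eventuallyEq
    (Filter.eventuallyEq_of_mem (Metric.isOpen_ball.mem_nhds hz) fun w hw =>
      (hasDerivAt_closedForm c hw).deriv)
  rw [iteratedDeriv_succ, iteratedDeriv_one, hderiv.deriv, hF.deriv]
  simp only [Pi.mul_apply]
  generalize closedForm c z = F at *
  generalize (1 - z) ^ (1 / 2 : ℂ) = s at *
  obtain rfl : z = 1 - s ^ 2 := by linear_combination hsq
  field_simp
  ring

theorem closedForm_ofReal (c : ℝ) {z : ℝ} (hz : z ≤ 1) :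
    closedForm c z = ((2 : ℝ) ^ (c - 1) * (1 + √(1 - z)) ^ (1 - c) : ℝ) := by
  have h : (1 - (z : ℂ)) ^ (1 / 2 : ℂ) = (√(1 - z) : ℝ) := by
    rw [Real.sqrt_eq_rpow, Complex.ofReal_cpow (sub_nonneg.2 hz)]
    norm_num
  have hs := Real.sqrt_nonneg (1 - z)
  have hr : (2 : ℝ) ^ (c - 1) * (1 + √(1 - z)) ^ (1 - c) = ((1 + √(1 - z)) / 2) ^ (1 - c) := by
    rw [Real.div_rpow (by positivity) (by norm_num), ← neg_sub 1 c, Real.rpow_neg (by norm_num),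
      div_eq_inv_mul]
  rw [closedForm, h, hr, Complex.ofReal_cpow (by positivity)]
  push_cast
  rfl

end HypergeometricSqrt

/-- For `c` not zero or a negative integer and `|z| < 1`,
`∑_{n=0}^∞ (c/2)_n·((c−1)/2)_n / ((c)_n·n!) · z^n = 2^(c−1)·(1 + √(1−z))^(1−c)`,
where `(a)_n` is the rising factorial (Pochhammer symbol). -/
theorem stmt_10 (c : ℝ) (hc : ∀ n : ℕ, c ≠ -(n : ℝ)) (z : ℝ) (hz : |z| < 1) :
    HasSum (fun n : ℕ =>
      (ascPochhammer ℝ n).eval (c / 2) * (ascPochhammer ℝ n).eval ((c - 1) / 2) /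
        ((ascPochhammer ℝ n).eval c * (Nat.factorial n : ℝ)) * z ^ n)
      ((2 : ℝ) ^ (c - 1) * (1 + Real.sqrt (1 - z)) ^ (1 - c)) := by
  have hsum := hasSum_hypergeometric_of_ode (a := c / 2) (b := (c - 1) / 2) (c := c)
    (fun n h => hc n (by exact_mod_cast h))
    (fun w hw => (HypergeometricSqrt.hasDerivAt_closedForm c hw).differentiableAt
      |>.differentiableWithinAt)
    (by simp [HypergeometricSqrt.closedForm, one_add_one_eq_two])
    (fun w hw => HypergeometricSqrt.closedForm_ode c hw)
    (z := z) (by simpa using hz)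
  rw [HypergeometricSqrt.closedForm_ofReal c (abs_lt.1 hz).2.le] at hsum
  rw [← Complex.hasSum_ofReal]
  convert hsum using 2 with n
  push_cast [← Complex.eval_ascPochhammer_ofReal]
  rfl
end

section
/- Define W(x) = √3 · [ (1 + √(1 − 4x²/27))^{2/3} − (1 − √(1 − 4x²/27))^{2/3} ] / (2^{5/3}·π·x^{2/3}) for x ∈ (0, 3√3/2). Then W(x) ≥ 0 on (0, 3√3/2) and for every natural number m, ∫₀^{3√3/2} x^m · W(x) dx = A_m(3/2, 1/2) = (1/2)·Γ(3m/2 + 1/2) / (m!·Γ(m/2 + 3/2)). -/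
open Real

open Set MeasureTheory intervalIntegral

theorem intervalIntegrable_beta {a b : ℝ} (ha : 0 < a) (hb : 0 < b) :
    IntervalIntegrable (fun x : ℝ => x ^ (a - 1) * (1 - x) ^ (b - 1)) volume 0 1 := by
  have h := Complex.betaIntegral_convergent (u := (a : ℂ)) (v := (b : ℂ)) (by simpa) (by simpa)
  rw [intervalIntegrable_iff_integrableOn_Ioc_of_le zero_le_one] at h ⊢
  refine IntegrableOn.congr_fun (Integrable.re h) (fun x hx => ?_) measurableSet_Ioc
  have h1 : (0 : ℝ) ≤ 1 - x := by linarith [hx.2]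
  have : (x : ℂ) ^ ((a : ℂ) - 1) * (1 - (x : ℂ)) ^ ((b : ℂ) - 1) =
      ((x ^ (a - 1) * (1 - x) ^ (b - 1) : ℝ) : ℂ) := by
    push_cast [Complex.ofReal_cpow hx.1.le, Complex.ofReal_cpow h1]
    rfl
  simp only [this]
  exact Complex.ofReal_re _

theorem integral_beta {a b : ℝ} (ha : 0 < a) (hb : 0 < b) :
    ∫ x in (0 : ℝ)..1, x ^ (a - 1) * (1 - x) ^ (b - 1) =
      Gamma a * Gamma b / Gamma (a + b) := by
  have h := Complex.betaIntegral_eq_Gamma_mul_div (a : ℂ) (b : ℂ) (by simpa) (by simpa)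
  have h' : Complex.betaIntegral a b =
      ((∫ x in (0 : ℝ)..1, x ^ (a - 1) * (1 - x) ^ (b - 1) : ℝ) : ℂ) := by
    rw [Complex.betaIntegral, ← intervalIntegral.integral_ofReal]
    refine intervalIntegral.integral_congr fun x hx => ?_
    rw [uIcc_of_le zero_le_one] at hx
    have h1 : (0 : ℝ) ≤ 1 - x := by linarith [hx.2]
    push_cast [Complex.ofReal_cpow hx.1, Complex.ofReal_cpow h1]
    rfl
  rw [h', ← Complex.ofReal_add, Complex.Gamma_ofReal, Complex.Gamma_ofReal,
    Complex.Gamma_ofReal] at h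
  exact_mod_cast h

theorem beta_mul_one_sub_two_mul_eq {a b x : ℝ} (hx : x ∈ Ioo (0 : ℝ) 1) :
    x ^ (a - 1) * (1 - x) ^ (b - 1) * (1 - 2 * x) =
      x ^ (a - 1) * (1 - x) ^ (b + 1 - 1) - x ^ (a + 1 - 1) * (1 - x) ^ (b - 1) := by
  have h0 := hx.1
  have h1 : 0 < 1 - x := sub_pos.2 hx.2
  rw [add_sub_right_comm, add_sub_right_comm, rpow_add_one h0.ne', rpow_add_one h1.ne']
  ring

theorem intervalIntegrable_beta_mul_one_sub_two_mul {a b : ℝ} (ha : 0 < a) (hb : 0 < b) :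
    IntervalIntegrable (fun x : ℝ => x ^ (a - 1) * (1 - x) ^ (b - 1) * (1 - 2 * x))
      volume 0 1 :=
  (intervalIntegrable_beta ha hb).mul_continuousOn (by fun_prop)

theorem integral_beta_mul_one_sub_two_mul {a b : ℝ} (ha : 0 < a) (hb : 0 < b) :
    ∫ x in (0 : ℝ)..1, x ^ (a - 1) * (1 - x) ^ (b - 1) * (1 - 2 * x) =
      (b - a) / (a + b) * (Gamma a * Gamma b / Gamma (a + b)) := by
  have h : ∫ x in (0 : ℝ)..1, x ^ (a - 1) * (1 - x) ^ (b - 1) * (1 - 2 * x) =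
      ∫ x in (0 : ℝ)..1, (x ^ (a - 1) * (1 - x) ^ (b + 1 - 1) -
        x ^ (a + 1 - 1) * (1 - x) ^ (b - 1)) := by
    rw [integral_of_le zero_le_one, integral_of_le zero_le_one, integral_Ioc_eq_integral_Ioo,
      integral_Ioc_eq_integral_Ioo]
    exact setIntegral_congr_fun measurableSet_Ioo fun x hx => beta_mul_one_sub_two_mul_eq hx
  rw [h, intervalIntegral.integral_sub (intervalIntegrable_beta ha (by linarith))
    (intervalIntegrable_beta (by linarith) hb), integral_beta ha (by linarith),
    integral_beta (by linarith) hb, ← add_assoc, add_right_comm a 1 b,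
    Gamma_add_one ha.ne', Gamma_add_one hb.ne', Gamma_add_one (by positivity)]
  have := (Gamma_pos_of_pos (add_pos ha hb)).ne'
  have := (add_pos ha hb).ne'
  field_simp

theorem integral_zero_one_eq_integral_zero_half_add {h : ℝ → ℝ}
    (hh : IntervalIntegrable h volume 0 1) :
    ∫ x in (0 : ℝ)..1, h x = ∫ x in (0 : ℝ)..(1 / 2), (h x + h (1 - x)) := by
  have h1 : IntervalIntegrable h volume 0 (1 / 2) :=
    hh.mono_set (uIcc_subset_uIcc_left (by norm_num [uIcc_of_le]))
  have h2 : IntervalIntegrable h volume (1 / 2) 1 :=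
    hh.mono_set (uIcc_subset_uIcc_right (by norm_num [uIcc_of_le]))
  have h3 : IntervalIntegrable (fun x => h (1 - x)) volume 0 (1 / 2) := by
    have := (h2.comp_sub_left 1).symm
    norm_num at this
    exact this
  rw [intervalIntegral.integral_add h1 h3, intervalIntegral.integral_comp_sub_left,
    ← intervalIntegral.integral_add_adjacent_intervals h1 h2]
  norm_num

theorem hasDerivAt_sqrt_mul_one_sub {u : ℝ} (hu : u ∈ Ioo (0 : ℝ) (1 / 2)) :
    HasDerivAt (fun u : ℝ => 3 * √3 * √(u * (1 - u)))
      (3 * √3 * ((1 - 2 * u) / (2 * √(u * (1 - u))))) u := by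
  have hv : 0 < u * (1 - u) := mul_pos hu.1 (by linarith [hu.2])
  have h : HasDerivAt (fun u : ℝ => u * (1 - u)) (1 - 2 * u) u := by
    convert! (hasDerivAt_id u).mul ((hasDerivAt_id u).const_sub 1) using 1
    simp
    ring
  exact (h.sqrt hv.ne').const_mul _

theorem injOn_sqrt_mul_one_sub :
    InjOn (fun u : ℝ => 3 * √3 * √(u * (1 - u))) (Ioo 0 (1 / 2)) := by
  intro u hu v hv huv
  have h3 : (3 * √3 : ℝ) ≠ 0 := by positivity
  have h := mul_left_cancel₀ h3 huv
  rw [sqrt_inj (mul_nonneg hu.1.le (by linarith [hu.2]))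
    (mul_nonneg hv.1.le (by linarith [hv.2]))] at h
  have h' : (u - v) * (1 - u - v) = 0 := by linarith
  rcases mul_eq_zero.1 h' with h' | h' <;> linarith [hu.2, hv.2]

theorem sqrt_one_sub_sqrt_mul_one_sub {u : ℝ} (hu : u ∈ Ioo (0 : ℝ) (1 / 2)) :
    √(1 - 4 * (3 * √3 * √(u * (1 - u))) ^ 2 / 27) = 1 - 2 * u := by
  rw [sqrt_eq_iff_mul_self_eq_of_pos (by linarith [hu.2]), mul_pow, mul_pow,
    sq_sqrt (by norm_num), sq_sqrt (mul_nonneg hu.1.le (by linarith [hu.2]))]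
  ring

theorem image_sqrt_mul_one_sub :
    (fun u : ℝ => 3 * √3 * √(u * (1 - u))) '' Ioo 0 (1 / 2) = Ioo 0 (3 * √3 / 2) := by
  have h3 : (0 : ℝ) < √3 := by positivity
  have h3' : √3 ^ 2 = (3 : ℝ) := sq_sqrt (by norm_num)
  ext x
  constructor
  · rintro ⟨u, hu, rfl⟩
    have hv : 0 < u * (1 - u) := mul_pos hu.1 (by linarith [hu.2])
    refine ⟨by positivity, ?_⟩
    have : √(u * (1 - u)) < 1 / 2 := by
      rw [sqrt_lt' (by norm_num)]
      nlinarith [mul_pos (sub_pos.2 hu.2) (sub_pos.2 hu.2)]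
    simp only
    nlinarith
  · rintro ⟨h0, h1⟩
    have hx : x ^ 2 < 27 / 4 := by nlinarith
    have hx' : 0 < 1 - 4 * x ^ 2 / 27 := by linarith
    have hs := sqrt_pos.2 hx'
    have hs' : √(1 - 4 * x ^ 2 / 27) < 1 := by
      rw [sqrt_lt' one_pos]
      nlinarith [pow_pos h0 2]
    have hsq := sq_sqrt hx'.le
    set s := √(1 - 4 * x ^ 2 / 27)
    refine ⟨(1 - s) / 2, ⟨by linarith, by linarith⟩, ?_⟩
    have h : (1 - s) / 2 * (1 - (1 - s) / 2) = (x / (3 * √3)) ^ 2 := by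
      rw [div_pow, mul_pow, h3']
      linarith
    simp only
    rw [h, sqrt_sq (by positivity)]
    field_simp

theorem density_comp_sqrt_mul_one_sub (m : ℕ) {u : ℝ} (hu : u ∈ Ioo (0 : ℝ) (1 / 2)) :
    3 * √3 * ((1 - 2 * u) / (2 * √(u * (1 - u)))) *
      ((3 * √3 * √(u * (1 - u))) ^ m * (√3 *
        ((1 + (1 - 2 * u)) ^ ((2 : ℝ) / 3) - (1 - (1 - 2 * u)) ^ ((2 : ℝ) / 3)) /
        ((2 : ℝ) ^ ((5 : ℝ) / 3) * π * (3 * √3 * √(u * (1 - u))) ^ ((2 : ℝ) / 3)))) =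
    (3 * √3) ^ (m + 1) * √3 / (12 * π) *
      (u ^ ((m / 2 + 1 / 6 : ℝ) - 1) * (1 - u) ^ ((m / 2 + 5 / 6 : ℝ) - 1) * (1 - 2 * u) +
      (1 - u) ^ ((m / 2 + 1 / 6 : ℝ) - 1) * (1 - (1 - u)) ^ ((m / 2 + 5 / 6 : ℝ) - 1) *
        (1 - 2 * (1 - u))) := by
  have hu0 := hu.1
  have hv0 : 0 < 1 - u := by linarith [hu.2]
  have split {y : ℝ} (hy : 0 < y) :
      √y = (y ^ (1 / 6 : ℝ)) ^ 3 ∧ y ^ (2 / 3 : ℝ) = (y ^ (1 / 6 : ℝ)) ^ 4 ∧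
      y ^ ((m / 2 + 1 / 6 : ℝ) - 1) = √y ^ m / (y ^ (1 / 6 : ℝ)) ^ 5 ∧
      y ^ ((m / 2 + 5 / 6 : ℝ) - 1) = √y ^ m / y ^ (1 / 6 : ℝ) := by
    refine ⟨?_, ?_, ?_, ?_⟩
    · rw [sqrt_eq_rpow, ← rpow_mul_natCast hy.le]; norm_num
    · rw [← rpow_mul_natCast hy.le]; norm_num
    · rw [sqrt_eq_rpow, ← rpow_mul_natCast hy.le, ← rpow_mul_natCast hy.le, ← rpow_sub hy]
      congr 1; push_cast; ring
    · rw [sqrt_eq_rpow, ← rpow_mul_natCast hy.le, ← rpow_sub hy]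
      congr 1; ring
  have h2 : (2 : ℝ) ^ ((5 : ℝ) / 3) = 2 * 2 ^ ((2 : ℝ) / 3) := by
    rw [← rpow_one_add' (by norm_num) (by norm_num)]; norm_num
  have h3 : (3 * √3 : ℝ) ^ ((2 : ℝ) / 3) = 3 := by
    have : (3 * √3 : ℝ) = 3 ^ ((3 : ℝ) / 2) := by
      rw [sqrt_eq_rpow, ← rpow_one_add' (by norm_num) (by norm_num)]; norm_num
    rw [this, ← rpow_mul (by norm_num)]; norm_num
  have hr {y : ℝ} (hy : 0 < y) : √y ^ ((2 : ℝ) / 3) = (y ^ (1 / 6 : ℝ)) ^ 2 := by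
    rw [sqrt_eq_rpow, ← rpow_mul hy.le, ← rpow_mul_natCast hy.le]; norm_num
  rw [show 1 + (1 - 2 * u) = 2 * (1 - u) by ring, show 1 - (1 - 2 * u) = 2 * u by ring,
    show 1 - (1 - u) = u by ring, sqrt_mul hu0.le, mul_rpow (by positivity : (0 : ℝ) ≤ 3 * √3) (by positivity), h3,
    mul_rpow (sqrt_nonneg u) (sqrt_nonneg _), hr hu0, hr hv0, h2,
    mul_rpow zero_le_two hv0.le, mul_rpow zero_le_two hu0.le,
    (split hu0).2.1, (split hu0).2.2.1, (split hu0).2.2.2,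
    (split hv0).2.1, (split hv0).2.2.1, (split hv0).2.2.2, (split hu0).1, (split hv0).1]
  have hs := rpow_pos_of_pos hu0 (1 / 6)
  have ht := rpow_pos_of_pos hv0 (1 / 6)
  have hc : (0 : ℝ) < 2 ^ ((2 : ℝ) / 3) := by positivity
  have hpi := pi_pos
  generalize u ^ (1 / 6 : ℝ) = s at *
  generalize (1 - u) ^ (1 / 6 : ℝ) = t at *
  generalize (2 : ℝ) ^ ((2 : ℝ) / 3) = c at *
  simp only [mul_pow, pow_succ (_ : ℝ) m]
  field_simp
  ring

theorem Gamma_mul_Gamma_add_two_thirds (m : ℕ) :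
    √3 * (3 * √3) ^ (m + 1) * (Gamma (m / 2 + 1 / 6) * Gamma (m / 2 + 5 / 6)) *
      Gamma (m / 2 + 1 / 2) = 18 * π * Gamma (3 * m / 2 + 1 / 2) := by
  have hs3 : √3 * √3 = (3 : ℝ) := mul_self_sqrt (by norm_num)
  induction m using Nat.twoStepInduction with
  | zero =>
    have h := Gamma_mul_Gamma_one_sub (1 / 6)
    rw [show π * (1 / 6) = π / 6 by ring, sin_pi_div_six,
      show (1 - 1 / 6 : ℝ) = 5 / 6 by norm_num] at h
    simp only [Nat.cast_zero, zero_div, mul_zero, zero_add, pow_one]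
    rw [h]
    linear_combination (6 * π * Gamma (1 / 2)) * hs3
  | one =>
    have h := Gamma_mul_Gamma_one_sub (1 / 3)
    rw [show π * (1 / 3) = π / 3 by ring, sin_pi_div_three,
      show (1 - 1 / 3 : ℝ) = 2 / 3 by norm_num] at h
    have h4 := Gamma_add_one (s := 1 / 3) (by norm_num)
    norm_num at h h4 ⊢
    rw [h4]
    have h' : √3 * (Gamma (1 / 3) * Gamma (2 / 3)) = 2 * π := by
      rw [h]; field_simp
    linear_combination 9 * √3 ^ 2 / 3 * h' + 6 * π * hs3
  | more m ih _ =>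
    have e1 : Gamma (((m + 2 : ℕ) : ℝ) / 2 + 1 / 6) =
        (m / 2 + 1 / 6) * Gamma (m / 2 + 1 / 6) := by
      rw [← Gamma_add_one (by positivity)]; congr 1; push_cast; ring
    have e2 : Gamma (((m + 2 : ℕ) : ℝ) / 2 + 5 / 6) =
        (m / 2 + 5 / 6) * Gamma (m / 2 + 5 / 6) := by
      rw [← Gamma_add_one (by positivity)]; congr 1; push_cast; ring
    have e3 : Gamma (((m + 2 : ℕ) : ℝ) / 2 + 1 / 2) =
        (m / 2 + 1 / 2) * Gamma (m / 2 + 1 / 2) := by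
      rw [← Gamma_add_one (by positivity)]; congr 1; push_cast; ring
    have e4 : Gamma (3 * ((m + 2 : ℕ) : ℝ) / 2 + 1 / 2) =
        (3 * m / 2 + 5 / 2) * ((3 * m / 2 + 3 / 2) * ((3 * m / 2 + 1 / 2) *
          Gamma (3 * m / 2 + 1 / 2))) := by
      rw [← Gamma_add_one (by positivity), show 3 * (m : ℝ) / 2 + 3 / 2 =
        3 * m / 2 + 1 / 2 + 1 by ring, ← Gamma_add_one (by positivity),
        show 3 * (m : ℝ) / 2 + 5 / 2 = 3 * m / 2 + 1 / 2 + 1 + 1 by ring,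
        ← Gamma_add_one (by positivity)]
      congr 1; push_cast; ring
    have e5 : (3 * √3 : ℝ) ^ (m + 2 + 1) = 27 * (3 * √3) ^ (m + 1) := by
      linear_combination 9 * (3 * √3 : ℝ) ^ (m + 1) * hs3
    rw [e1, e2, e3, e4, e5]
    linear_combination 27 * ((m : ℝ) / 2 + 1 / 6) * (m / 2 + 5 / 6) * (m / 2 + 1 / 2) * ih

theorem Gamma_eq_prod_Icc_mul_Gamma_sub (n : ℕ) {s : ℝ} (hs : n < s) :
    Gamma s = (∏ i ∈ Finset.Icc 1 n, (s - i)) * Gamma (s - n) := by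
  induction n with
  | zero => simp
  | succ n ih =>
    push_cast at hs
    rw [ih (by linarith), Finset.prod_Icc_succ_top (by omega), mul_assoc]
    congr 1
    have h : s - ((n + 1 : ℕ) : ℝ) ≠ 0 := by push_cast; linarith
    rw [← Gamma_add_one h]
    congr 1; push_cast; ring

theorem raney_three_halves_one_half (m : ℕ) :
    raney (3 / 2) (1 / 2) m = (1 / 2) * Gamma (3 * (m : ℝ) / 2 + 1 / 2) /
      ((Nat.factorial m : ℝ) * Gamma ((m : ℝ) / 2 + 3 / 2)) := by
  cases m with
  | zero =>
    have h := Gamma_add_one (s := 1 / 2) (by norm_num)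
    have h' := Gamma_pos_of_pos (s := 1 / 2) (by norm_num)
    norm_num at h h'
    norm_num [raney, h]
    field_simp
  | succ m =>
    have hpos : (0 : ℝ) < ((m + 1 : ℕ) : ℝ) / 2 + 3 / 2 := by positivity
    have h := Gamma_eq_prod_Icc_mul_Gamma_sub m (s := ((m : ℝ) + 1) * (3 / 2) + 1 / 2)
      (by linarith [(Nat.cast_nonneg m : (0 : ℝ) ≤ m)])
    rw [show ((m : ℝ) + 1) * (3 / 2) + 1 / 2 - m = ((m + 1 : ℕ) : ℝ) / 2 + 3 / 2 by
      push_cast; ring] at h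
    rw [raney, show 3 * ((m + 1 : ℕ) : ℝ) / 2 + 1 / 2 = ((m : ℝ) + 1) * (3 / 2) + 1 / 2 by
      push_cast; ring, h]
    have := (Gamma_pos_of_pos hpos).ne'
    field_simp

/-- For
`W(x) = √3·[(1 + √(1 − 4x²/27))^(2/3) − (1 − √(1 − 4x²/27))^(2/3)]/(2^(5/3)·π·x^(2/3))`
on `(0, 3√3/2)`: `W ≥ 0` there, and
`∫₀^{3√3/2} x^m·W(x) dx = A_m(3/2, 1/2) = (1/2)·Γ(3m/2 + 1/2)/(m!·Γ(m/2 + 3/2))`. -/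
theorem stmt_12 :
    (∀ x ∈ Set.Ioo (0 : ℝ) (3 * Real.sqrt 3 / 2),
      0 ≤ Real.sqrt 3 *
        ((1 + Real.sqrt (1 - 4 * x ^ 2 / 27)) ^ ((2 : ℝ) / 3) -
          (1 - Real.sqrt (1 - 4 * x ^ 2 / 27)) ^ ((2 : ℝ) / 3)) /
        ((2 : ℝ) ^ ((5 : ℝ) / 3) * π * x ^ ((2 : ℝ) / 3))) ∧
    ∀ m : ℕ,
      (∫ x in (0:ℝ)..(3 * Real.sqrt 3 / 2),
        x ^ m * (Real.sqrt 3 *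
          ((1 + Real.sqrt (1 - 4 * x ^ 2 / 27)) ^ ((2 : ℝ) / 3) -
            (1 - Real.sqrt (1 - 4 * x ^ 2 / 27)) ^ ((2 : ℝ) / 3)) /
          ((2 : ℝ) ^ ((5 : ℝ) / 3) * π * x ^ ((2 : ℝ) / 3))))
      = raney (3 / 2) (1 / 2) m ∧
      raney (3 / 2) (1 / 2) m =
        (1 / 2) * Gamma (3 * (m : ℝ) / 2 + 1 / 2) /
          ((Nat.factorial m : ℝ) * Gamma ((m : ℝ) / 2 + 3 / 2)) := by
  refine ⟨fun x hx => ?_, fun m => ⟨?_, raney_three_halves_one_half m⟩⟩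
  · have hx0 := hx.1
    have hs := sqrt_nonneg (1 - 4 * x ^ 2 / 27)
    have hs' : √(1 - 4 * x ^ 2 / 27) ≤ 1 := by
      rw [sqrt_le_one]
      nlinarith [sq_nonneg x]
    refine div_nonneg (mul_nonneg (sqrt_nonneg _) (sub_nonneg.2 ?_)) (by positivity)
    exact rpow_le_rpow (by linarith) (by linarith) (by norm_num)
  · have ha : (0 : ℝ) < m / 2 + 1 / 6 := by positivity
    have hb : (0 : ℝ) < m / 2 + 5 / 6 := by positivity
    rw [raney_three_halves_one_half, integral_of_le (by positivity),
      integral_Ioc_eq_integral_Ioo, ← image_sqrt_mul_one_sub,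
      integral_image_eq_integral_abs_deriv_smul measurableSet_Ioo
        (fun u hu => (hasDerivAt_sqrt_mul_one_sub hu).hasDerivWithinAt) injOn_sqrt_mul_one_sub]
    have key := integral_zero_one_eq_integral_zero_half_add
      (intervalIntegrable_beta_mul_one_sub_two_mul ha hb)
    rw [integral_beta_mul_one_sub_two_mul ha hb, integral_of_le (by norm_num),
      integral_Ioc_eq_integral_Ioo] at key
    rw [setIntegral_congr_fun measurableSet_Ioo (g := fun u : ℝ =>
      (3 * √3) ^ (m + 1) * √3 / (12 * π) *
      (u ^ ((m / 2 + 1 / 6 : ℝ) - 1) * (1 - u) ^ ((m / 2 + 5 / 6 : ℝ) - 1) * (1 - 2 * u) +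
      (1 - u) ^ ((m / 2 + 1 / 6 : ℝ) - 1) * (1 - (1 - u)) ^ ((m / 2 + 5 / 6 : ℝ) - 1) *
        (1 - 2 * (1 - u)))) ?_, MeasureTheory.integral_const_mul, ← key]
    · have h := Gamma_mul_Gamma_add_two_thirds m
      have hg : (0 : ℝ) < Gamma (m / 2 + 1 / 2) := Gamma_pos_of_pos (by positivity)
      rw [show (m : ℝ) / 2 + 1 / 6 + (m / 2 + 5 / 6) = m + 1 by ring, Gamma_nat_eq_factorial,
        show (m : ℝ) / 2 + 3 / 2 = m / 2 + 1 / 2 + 1 by ring, Gamma_add_one (by positivity)]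
      rw [← eq_div_iff (by positivity), mul_comm √3] at h
      have e : (3 * √3) ^ (m + 1) * √3 / (12 * π) * ((m / 2 + 5 / 6 - (m / 2 + 1 / 6)) / (m + 1) *
          (Gamma (m / 2 + 1 / 6) * Gamma (m / 2 + 5 / 6) / (m.factorial : ℝ))) =
          (3 * √3) ^ (m + 1) * √3 * (Gamma (m / 2 + 1 / 6) * Gamma (m / 2 + 5 / 6)) /
            (18 * π * ((m + 1) * (m.factorial : ℝ))) := by
        field_simp
        ring
      rw [e, h]
      field_simp
    · intro u hu
      have hu0 := hu.1
      have h2 : 0 < 1 - 2 * u := by linarith [hu.2]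
      have h := density_comp_sqrt_mul_one_sub m hu
      simp only [smul_eq_mul, sqrt_one_sub_sqrt_mul_one_sub hu]
      rw [abs_of_nonneg (by positivity), h]
end
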